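/- arXiv:1901.01980 — 9 statements merged into one kernel-verified Lean document; each statement's English description precedes it below -/
import Mathlib

section
/- Let (M₁,d₁) and (M₂,d₂) be compact metric spaces, let X^t be a flow on M₁ and Y^t a flow on M₂, and suppose X^t and Y^t are conjugate, i.e. there is a homeomorphism h : M₁ → M₂ mapping each orbit {X^t(x) : t ∈ ℝ} of X^t onto an orbit of Y^t. If Y^t is N-expansive for some integer N > 0, then X^t is N-expansive. In particular, N-expansiveness is a conjugacy invariant. -/
open Set Metric

/-- `α` belongs to `ℋ(A)`: a family of homeomorphisms of `ℝ` fixing the origin,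
indexed by points of `A`, such that `α x_α = id` for some `x_α ∈ A` and
for each fixed `t` the map `x ↦ α x t` is continuous on `A`. -/
def MemH {M : Type*} [MetricSpace M] (A : Set M) (α : M → ℝ ≃ₜ ℝ) (xα : M) : Prop :=
  xα ∈ A ∧ (∀ t : ℝ, α xα t = t) ∧ (∀ x ∈ A, α x 0 = 0) ∧
    ∀ t : ℝ, ContinuousOn (fun x => α x t) A

/-- A flow `φ` on a metric space is `N`-expansive if for every `ε > 0` there is `δ > 0`
such that whenever `A ⊆ M` and `α ∈ ℋ(A)` satisfy `diam(𝒳ᵗ_α(A)) < δ` for all `t ∈ ℝ`,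
there is `B ⊆ A` with at most `N` elements such that `A ⊆ X^{(-ε,ε)}(B)`. -/
def NExpansive {M : Type*} [MetricSpace M] (φ : Flow ℝ M) (N : ℕ) : Prop :=
  ∀ ε : ℝ, 0 < ε → ∃ δ : ℝ, 0 < δ ∧
    ∀ (A : Set M) (α : M → ℝ ≃ₜ ℝ) (xα : M), MemH A α xα →
      (∀ t : ℝ, Metric.diam ((fun x => φ (α x t) x) '' A) < δ) →
      ∃ B ⊆ A, B.Finite ∧ B.ncard ≤ N ∧
        ∀ a ∈ A, ∃ b ∈ B, ∃ s : ℝ, |s| < ε ∧ φ s b = a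


/-- The finite version of `N`-expansiveness. -/
def FinExp {M : Type*} [MetricSpace M] (φ : Flow ℝ M) (N : ℕ) : Prop :=
  ∀ ε : ℝ, 0 < ε → ∃ δ : ℝ, 0 < δ ∧
    ∀ (p : Fin (N + 1) → M) (α : Fin (N + 1) → ℝ ≃ₜ ℝ), (∀ i, α i 0 = 0) →
      (∀ t i j, dist (φ (α i t) (p i)) (φ (α j t) (p j)) < δ) →
      ∃ i j, i ≠ j ∧ ∃ s : ℝ, |s| < ε ∧ φ s (p i) = p j

theorem finExp_of_nexp {M : Type*} [MetricSpace M] (φ : Flow ℝ M) (N : ℕ)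
    (H : NExpansive φ N) : FinExp φ N := by
  intro ε hε
  obtain ⟨δ, hδ, H⟩ := H (ε / 2) (by linarith)
  refine ⟨δ / 2, by linarith, fun p α h0 hd => ?_⟩
  by_cases hp : Function.Injective p
  swap
  · simp only [Function.Injective, not_forall] at hp
    obtain ⟨i, j, hij, hne⟩ := hp
    exact ⟨i, j, hne, 0, by simpa using hε, by rw [φ.map_zero_apply, hij]⟩
  have hinv : ∀ i, Function.invFun p (p i) = i := Function.leftInverse_invFun hp
  have h00 : (α 0).symm 0 = 0 := by rw [Homeomorph.symm_apply_eq, h0]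
  obtain ⟨B, hBA, hBf, hBN, hB⟩ := H (range p)
    (fun x => (α 0).symm.trans (α (Function.invFun p x))) (p 0)
    ⟨mem_range_self 0, fun t => by simp [hinv], by
      rintro _ ⟨i, rfl⟩; simp [h00, h0], fun t => (finite_range p).continuousOn _⟩ (by
      intro t
      refine lt_of_le_of_lt (Metric.diam_le_of_forall_dist_le (C := δ / 2) (by linarith) ?_)
        (by linarith)
      rintro _ ⟨_, ⟨i, rfl⟩, rfl⟩ _ ⟨_, ⟨j, rfl⟩, rfl⟩
      simp only [hinv]
      exact (hd _ i j).le)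
  choose b hbB s hs hbs using fun i => hB (p i) (mem_range_self i)
  have hcard : hBf.toFinset.card < (Finset.univ : Finset (Fin (N + 1))).card := by
    rw [← Set.ncard_eq_toFinset_card B hBf]; simp; omega
  obtain ⟨i, -, j, -, hij, hb⟩ := Finset.exists_ne_map_eq_of_card_lt_of_maps_to hcard
    (f := b) (fun i _ => by simpa using hbB i)
  refine ⟨i, j, hij, s j - s i, ?_, ?_⟩
  · have := abs_sub (s j) (s i)
    linarith [hs i, hs j]
  · rw [← hbs i, ← φ.map_add, ← hbs j, hb]; congr 1; ring

theorem nexp_of_finExp {M : Type*} [MetricSpace M] [CompactSpace M] (φ : Flow ℝ M) (N : ℕ)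
    (H : FinExp φ N) : NExpansive φ N := by
  intro ε hε
  obtain ⟨δ, hδ, H⟩ := H ε hε
  refine ⟨δ, hδ, fun A α x₀ hα hd => ?_⟩
  by_contra hno
  have key : ∀ k ≤ N + 1, ∃ S : Finset M, S.card = k ∧ (S : Set M) ⊆ A ∧
      ∀ a ∈ S, ∀ b ∈ S, a ≠ b → ∀ s : ℝ, |s| < ε → φ s a ≠ b := by
    intro k
    induction k with
    | zero => intro _; exact ⟨∅, by simp⟩
    | succ k ih =>
      intro hk
      obtain ⟨S, hSc, hSA, hS⟩ := ih (by omega)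
      have : ∃ a ∈ A, ∀ b ∈ S, ∀ s : ℝ, |s| < ε → φ s b ≠ a := by
        by_contra! hcon
        refine hno ⟨S, hSA, S.finite_toSet, ?_, hcon⟩
        rw [Set.ncard_coe_finset]; omega
      obtain ⟨a, haA, ha⟩ := this
      classical
      have haS : a ∉ S := fun h => ha a h 0 (by simpa using hε) (φ.map_zero_apply a)
      refine ⟨insert a S, by rw [Finset.card_insert_of_notMem haS, hSc], ?_, ?_⟩
      · simp only [Finset.coe_insert]; exact Set.insert_subset haA hSA
      · intro x hx y hy hxy s hs
        rw [Finset.mem_insert] at hx hy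
        rcases hx with rfl | hx <;> rcases hy with rfl | hy
        · exact absurd rfl hxy
        · intro h
          refine ha y hy (-s) (by simpa using hs) ?_
          rw [← h, ← φ.map_add, neg_add_cancel, φ.map_zero_apply]
        · exact ha x hx s hs
        · exact hS x hx y hy hxy s hs
  obtain ⟨S, hSc, hSA, hS⟩ := key (N + 1) le_rfl
  let e := (Finset.equivFinOfCardEq hSc).symm
  have heA : ∀ i, (e i : M) ∈ A := fun i => hSA (e i).2
  obtain ⟨i, j, hij, s, hs, hφ⟩ := H (fun i => e i) (fun i => α (e i))
    (fun i => hα.2.2.1 _ (heA i)) (fun t i j => lt_of_le_of_lt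
      (Metric.dist_le_diam_of_mem (Metric.isBounded_of_compactSpace)
        (mem_image_of_mem (fun x => φ (α x t) x) (heA i))
        (mem_image_of_mem (fun x => φ (α x t) x) (heA j))) (hd t))
  exact hS _ (e i).2 _ (e j).2 (fun h => hij (e.injective (Subtype.ext h))) s hs hφ

/-- Bebutov's function: strictly increasing along the flow near a non-fixed point. -/
theorem crossSection {M : Type*} [MetricSpace M] (φ : Flow ℝ M) (z : M)
    (hz : ∃ a, φ a z ≠ z) :
    ∃ F : M → ℝ, Continuous F ∧ ∃ c > 0, ∃ r > 0, ∀ᶠ x in nhds z, ∀ s s' : ℝ, -r ≤ s' → s' ≤ s →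
      s ≤ r → c * (s - s') ≤ F (φ s x) - F (φ s' x) := by
  obtain ⟨a, ha⟩ := hz
  refine ⟨fun w => ∫ v in (0:ℝ)..a, dist (φ v w) z, ?_, dist (φ a z) z / 2,
    half_pos (dist_pos.2 ha), ?_⟩
  · apply intervalIntegral.continuous_parametric_intervalIntegral_of_continuous' (μ := MeasureTheory.volume) (f := fun w v => dist (φ v w) z)
    unfold Function.uncurry
    fun_prop
  have hc : Continuous (fun q : M × ℝ => dist (φ (q.2 + a) q.1) z - dist (φ q.2 q.1) z) := by
    fun_prop
  have hev : ∀ᶠ q : M × ℝ in nhds (z, 0),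
      dist (φ a z) z / 2 < dist (φ (q.2 + a) q.1) z - dist (φ q.2 q.1) z := by
    refine hc.continuousAt.eventually (lt_mem_nhds ?_)
    simp only [zero_add, φ.map_zero_apply, dist_self, sub_zero]
    exact half_lt_self (dist_pos.2 ha)
  rw [nhds_prod_eq] at hev
  obtain ⟨P, hP, Q, hQ, hPQ⟩ := Filter.eventually_prod_iff.1 hev
  obtain ⟨r, hr, hrQ⟩ := Metric.eventually_nhds_iff.1 hQ
  refine ⟨r / 2, half_pos hr, hP.mono fun x hx s s' h1 h2 h3 => ?_⟩
  have hg : Continuous fun v => dist (φ v x) z := by fun_prop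
  have hg' : Continuous fun v => dist (φ (v + a) x) z := by fun_prop
  have e : ∀ s : ℝ, (∫ v in (0:ℝ)..a, dist (φ v (φ s x)) z) = ∫ v in s..(s + a), dist (φ v x) z := by
    intro s
    simp only [← φ.map_add]
    rw [intervalIntegral.integral_comp_add_right (fun v => dist (φ v x) z)]
    congr 1 <;> ring
  have hi : ∀ p q : ℝ, IntervalIntegrable (fun v => dist (φ v x) z) MeasureTheory.volume p q :=
    fun p q => hg.intervalIntegrable p q
  have e2 : (∫ v in s..(s + a), dist (φ v x) z) - ∫ v in s'..(s' + a), dist (φ v x) z =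
      ∫ v in s'..s, (dist (φ (v + a) x) z - dist (φ v x) z) := by
    rw [intervalIntegral.integral_sub (hg'.intervalIntegrable _ _) (hi _ _),
      intervalIntegral.integral_comp_add_right (fun v => dist (φ v x) z)]
    have k1 := intervalIntegral.integral_add_adjacent_intervals (hi s' s) (hi s (s + a))
    have k2 := intervalIntegral.integral_add_adjacent_intervals (hi s' (s' + a)) (hi (s' + a) (s + a))
    linarith
  simp only [e]
  rw [e2]
  have := intervalIntegral.integral_mono_on (μ := MeasureTheory.volume) h2
    (f := fun _ => dist (φ a z) z / 2)
    (g := fun v => dist (φ (v + a) x) z - dist (φ v x) z)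
    (continuous_const.intervalIntegrable _ _) ((hg'.sub hg).intervalIntegrable _ _) (by
      intro v hv
      refine (hPQ hx (hrQ ?_)).le
      rw [Real.dist_eq, sub_zero, abs_lt]
      constructor <;> linarith [hv.1, hv.2])
  rw [intervalIntegral.integral_const, smul_eq_mul] at this
  linarith

theorem localLift {M : Type*} [MetricSpace M] (φ : Flow ℝ M) (y : M) (γ : ℝ → M)
    (hγ : Continuous γ) (horb : ∀ t, ∃ u, φ u y = γ t) (t₀ : ℝ) (hz : ∃ a, φ a (γ t₀) ≠ γ t₀) :
    ∃ η > 0, ∃ ℓ : ℝ → ℝ, ∃ q, ContinuousOn ℓ (ball t₀ η) ∧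
      ∀ t ∈ ball t₀ η, γ t = φ (ℓ t) q := by
  obtain ⟨F, hF, c, hc, R, hR, hV⟩ := crossSection φ (γ t₀) hz
  set z := γ t₀ with hzdef
  set r := R / 2 with hr
  have hr0 : 0 < r := half_pos hR
  have hV2 : ∀ᶠ x in nhds z, |F x - F z| < c * r := by
    have : ContinuousAt (fun x => |F x - F z|) z := by fun_prop
    refine this.eventually (gt_mem_nhds ?_)
    simp; positivity
  obtain ⟨η, hη, hηV⟩ := Metric.eventually_nhds_iff.1 (hγ.continuousAt.eventually (hV.and hV2))
  have hex : ∀ t ∈ ball t₀ η, ∃ s : ℝ, s ∈ Icc (-r) r ∧ F (φ s (γ t)) = F z := by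
    intro t ht
    obtain ⟨h1, h2⟩ := hηV ht
    have hcont : Continuous fun s : ℝ => F (φ s (γ t)) := by fun_prop
    have k1 := h1 r 0 (by linarith) hr0.le (by linarith)
    have k2 := h1 0 (-r) (by linarith) (by linarith) (by linarith)
    rw [φ.map_zero_apply] at k1 k2
    rw [abs_lt] at h2
    obtain ⟨s, hs, hs'⟩ := intermediate_value_Icc (by linarith : -r ≤ r) hcont.continuousOn
      (show F z ∈ Icc (F (φ (-r) (γ t))) (F (φ r (γ t))) from ⟨by nlinarith, by nlinarith⟩)
    exact ⟨s, hs, hs'⟩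
  choose! s hs hsF using hex
  -- strict monotonicity as an absolute value bound
  have habs : ∀ t ∈ ball t₀ η, ∀ u v : ℝ, u ∈ Icc (-R) R → v ∈ Icc (-R) R →
      c * |u - v| ≤ |F (φ u (γ t)) - F (φ v (γ t))| := by
    intro t ht u v hu hv
    obtain ⟨h1, -⟩ := hηV ht
    rcases le_total u v with h | h
    · have := h1 v u hu.1 h hv.2
      rw [abs_sub_comm, abs_of_nonneg (by linarith : 0 ≤ v - u), abs_sub_comm]
      exact this.trans (le_abs_self _)
    · have := h1 u v hv.1 h hu.2
      rw [abs_of_nonneg (by linarith : 0 ≤ u - v)]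
      exact this.trans (le_abs_self _)
  have hsR : ∀ t ∈ ball t₀ η, s t ∈ Icc (-R) R := fun t ht =>
    ⟨by linarith [(hs t ht).1], by linarith [(hs t ht).2]⟩
  have hscont : ContinuousOn s (ball t₀ η) := by
    intro t ht
    rw [ContinuousWithinAt, tendsto_iff_dist_tendsto_zero]
    have hb : Filter.Tendsto (fun t' => |F (φ (s t) (γ t')) - F z| / c) (nhdsWithin t (ball t₀ η))
        (nhds 0) := by
      have hcc : Continuous (fun t' => |F (φ (s t) (γ t')) - F z| / c) := by fun_prop
      have := hcc.tendsto t
      rw [hsF t ht] at this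
      simp only [sub_self, abs_zero, zero_div] at this
      exact this.mono_left nhdsWithin_le_nhds
    refine squeeze_zero' (Filter.Eventually.of_forall fun _ => dist_nonneg) ?_ hb
    filter_upwards [self_mem_nhdsWithin] with t' ht'
    rw [le_div_iff₀ hc, Real.dist_eq, mul_comm]
    have := habs t' ht' (s t') (s t) (hsR _ ht') (hsR _ ht)
    rwa [hsF t' ht', abs_sub_comm (F z)] at this
  let U : Set ℝ := {u | ∃ t ∈ ball t₀ η, φ u y = φ (s t) (γ t)}
  have hUsep : ∀ u ∈ U, ∀ u' ∈ U, |u - u'| < r → u = u' := by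
    rintro u ⟨t, ht, hu⟩ u' ⟨t', ht', hu'⟩ huu
    have e1 : φ u' y = φ (u' - u + s t) (γ t) := by
      rw [φ.map_add, ← hu, ← φ.map_add]; congr 1; ring
    rw [abs_lt] at huu
    have := habs t ht (u' - u + s t) (s t)
      ⟨by linarith [(hs t ht).1], by linarith [(hs t ht).2]⟩ (hsR t ht)
    rw [← e1, hu', hsF t ht, hsF t' ht', sub_self, abs_zero] at this
    have h0 : |u' - u + s t - s t| ≤ 0 := by
      by_contra hh
      push Not at hh
      nlinarith
    have := abs_nonpos_iff.1 h0
    linarith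
  have hUc : U.Countable := by
    have hinj : InjOn (fun u : ℝ => ⌊u / r⌋) U := by
      intro u hu u' hu' hfl
      apply hUsep u hu u' hu'
      have := Int.abs_sub_lt_one_of_floor_eq_floor hfl
      rwa [← sub_div, abs_div, abs_of_pos hr0, div_lt_one hr0] at this
    exact Set.countable_of_injective_of_countable_image hinj (Set.to_countable _)
  have hP : ContinuousOn (fun t => φ (s t) (γ t)) (ball t₀ η) := by
    exact φ.cont'.comp_continuousOn (hscont.prodMk hγ.continuousOn)
  have hsub : ((fun t => φ (s t) (γ t)) '' ball t₀ η).Subsingleton := by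
    have hpre : IsPreconnected ((fun t => φ (s t) (γ t)) '' ball t₀ η) :=
      ((convex_ball t₀ η).isPreconnected).image _ hP
    refine (Set.Countable.isTotallyDisconnected (s := (fun t => φ (s t) (γ t)) '' ball t₀ η) ?_)
      _ subset_rfl hpre
    refine (hUc.image (fun u => φ u y)).mono ?_
    rintro _ ⟨t, ht, rfl⟩
    obtain ⟨u, hu⟩ := horb t
    refine ⟨s t + u, ⟨t, ht, ?_⟩, ?_⟩ <;> simp only [φ.map_add, hu]
  refine ⟨η, hη, fun t => - s t, φ (s t₀) (γ t₀), hscont.neg, fun t ht => ?_⟩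
  have : φ (s t₀) (γ t₀) = φ (s t) (γ t) :=
    hsub (mem_image_of_mem _ (mem_ball_self hη)) (mem_image_of_mem _ ht)
  rw [this, ← φ.map_add, neg_add_cancel, φ.map_zero_apply]

theorem stab_mul {M : Type*} [MetricSpace M] (φ : Flow ℝ M) (x : M) (v : ℝ)
    (hv : φ v x = x) (n : ℕ) : φ (n * v) x = x := by
  induction n with
  | zero => simp
  | succ n ih =>
    have : ((n + 1 : ℕ) : ℝ) * v = n * v + v := by push_cast; ring
    rw [this, φ.map_add, hv, ih]

theorem stab_neg {M : Type*} [MetricSpace M] (φ : Flow ℝ M) (x : M) (v : ℝ)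
    (hv : φ v x = x) : φ (-v) x = x := by
  nth_rw 1 [← hv]
  rw [← φ.map_add, neg_add_cancel, φ.map_zero_apply]

theorem stab_int {M : Type*} [MetricSpace M] (φ : Flow ℝ M) (x : M) (v : ℝ)
    (hv : φ v x = x) (n : ℤ) : φ (n * v) x = x := by
  obtain ⟨k, rfl | rfl⟩ := n.eq_nat_or_neg
  · exact_mod_cast stab_mul φ x v hv k
  · have := stab_neg φ x _ (stab_mul φ x v hv k)
    push_cast
    rwa [neg_mul]

theorem stab_const {M : Type*} [MetricSpace M] (φ : Flow ℝ M) (x : M) (hx : ∃ a, φ a x ≠ x)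
    (S : Set ℝ) (hS : IsPreconnected S) (f : ℝ → ℝ) (hf : ContinuousOn f S)
    (t₀ : ℝ) (ht₀ : t₀ ∈ S) (h0 : f t₀ = 0) (hst : ∀ t ∈ S, φ (f t) x = x) :
    ∀ t ∈ S, f t = 0 := by
  intro t ht
  by_contra hne
  obtain ⟨a, ha⟩ := hx
  have hoc : OrdConnected (f '' S) := (hS.image f hf).ordConnected
  have hsub : uIcc 0 (f t) ⊆ f '' S :=
    hoc.uIcc_subset (h0 ▸ mem_image_of_mem f ht₀) (mem_image_of_mem f ht)
  have hstab : ∀ v ∈ uIcc 0 (f t), φ v x = x := by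
    intro v hv
    obtain ⟨t', ht', rfl⟩ := hsub hv
    exact hst t' ht'
  have hpos : 0 < |f t| := abs_pos.2 hne
  have hstab2 : ∀ v : ℝ, |v| ≤ |f t| → φ v x = x := by
    intro v hv
    have : v ∈ uIcc 0 (f t) ∨ -v ∈ uIcc 0 (f t) := by
      rw [mem_uIcc, mem_uIcc]
      rcases abs_cases v with ⟨h1, h2⟩ | ⟨h1, h2⟩ <;> rcases abs_cases (f t) with ⟨h3, h4⟩ | ⟨h3, h4⟩
      · left; left; constructor <;> linarith
      · right; right; constructor <;> linarith
      · right; left; constructor <;> linarith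
      · left; right; constructor <;> linarith
    rcases this with h | h
    · exact hstab v h
    · simpa using stab_neg φ x _ (hstab _ h)
  obtain ⟨n, hn⟩ := exists_nat_gt (|a| / |f t|)
  have hn0 : (0:ℝ) < n := lt_of_le_of_lt (by positivity) hn
  have hv := hstab2 (a / n) (by
    rw [abs_div, abs_of_pos hn0, div_le_iff₀ hn0]
    rw [div_lt_iff₀ hpos] at hn
    linarith)
  apply ha
  have := stab_mul φ x _ hv n
  rwa [mul_div_cancel₀ _ hn0.ne'] at this

/-- there is a lift on `[a,b]` -/
def HasLift {M : Type*} [MetricSpace M] (φ : Flow ℝ M) (γ : ℝ → M) (a b : ℝ) : Prop :=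
  ∃ ℓ : ℝ → ℝ, ∃ q, ContinuousOn ℓ (Icc a b) ∧ ∀ t ∈ Icc a b, γ t = φ (ℓ t) q

theorem HasLift.glue {M : Type*} [MetricSpace M] {φ : Flow ℝ M} {γ : ℝ → M} {a b c : ℝ}
    (hab : a ≤ b) (hbc : b ≤ c) (h1 : HasLift φ γ a b) (h2 : HasLift φ γ b c) :
    HasLift φ γ a c := by
  obtain ⟨ℓ₁, q₁, hc₁, hℓ₁⟩ := h1
  obtain ⟨ℓ₂, q₂, hc₂, hℓ₂⟩ := h2
  have hq : φ (ℓ₁ b - ℓ₂ b) q₁ = q₂ := by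
    have e1 := hℓ₁ b ⟨hab, le_rfl⟩
    have e2 := hℓ₂ b ⟨le_rfl, hbc⟩
    have : φ (-ℓ₂ b) (φ (ℓ₁ b) q₁) = φ (-ℓ₂ b) (φ (ℓ₂ b) q₂) := by rw [← e1, ← e2]
    rw [← φ.map_add, ← φ.map_add, neg_add_cancel, φ.map_zero_apply] at this
    rw [← this]; congr 1; ring
  refine ⟨fun t => ℓ₁ (min t b) + ℓ₂ (max t b) - ℓ₂ b, q₁, ?_, ?_⟩
  · refine ContinuousOn.sub (ContinuousOn.add ?_ ?_) continuousOn_const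
    · exact hc₁.comp (by fun_prop) fun t ht => ⟨le_min ht.1 hab, min_le_right _ _⟩
    · exact hc₂.comp (by fun_prop) fun t ht => ⟨le_max_right _ _, max_le ht.2 hbc⟩
  · intro t ht
    rcases le_total t b with h | h
    · simp only [min_eq_left h, max_eq_right h]
      rw [hℓ₁ t ⟨ht.1, h⟩]; congr 1; ring
    · simp only [min_eq_right h, max_eq_left h]
      rw [hℓ₂ t ⟨h, ht.2⟩, ← hq, ← φ.map_add]; congr 1; ring

theorem nonfixed_orbit {M : Type*} [MetricSpace M] (φ : Flow ℝ M) (y : M) (hy : ∃ a, φ a y ≠ y)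
    (u : ℝ) : ∃ a, φ a (φ u y) ≠ φ u y := by
  obtain ⟨a, ha⟩ := hy
  refine ⟨a, fun h => ha ?_⟩
  have : φ (-u) (φ a (φ u y)) = φ (-u) (φ u y) := by rw [h]
  simp only [← φ.map_add] at this
  simpa using this

theorem hasLift_all {M : Type*} [MetricSpace M] (φ : Flow ℝ M) (y : M) (hy : ∃ a, φ a y ≠ y)
    (γ : ℝ → M) (hγ : Continuous γ) (horb : ∀ t, ∃ u, φ u y = γ t) (a b : ℝ) :
    HasLift φ γ a b := by
  have hloc : ∀ t₀, ∃ η > 0, ∃ ℓ : ℝ → ℝ, ∃ q, ContinuousOn ℓ (ball t₀ η) ∧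
      ∀ t ∈ ball t₀ η, γ t = φ (ℓ t) q := by
    intro t₀
    refine localLift φ y γ hγ horb t₀ ?_
    obtain ⟨u, hu⟩ := horb t₀
    rw [← hu]
    exact nonfixed_orbit φ y hy u
  choose η hη ℓ q hc hℓ using hloc
  obtain ⟨d, hd, hleb⟩ := lebesgue_number_lemma_of_metric (isCompact_Icc (a := a) (b := b))
    (c := fun t => ball t (η t)) (fun t => isOpen_ball)
    (fun t _ => mem_iUnion.2 ⟨t, mem_ball_self (hη t)⟩)
  have hstep : ∀ k : ℕ, a + k * (d / 2) ≤ b → HasLift φ γ a (a + (k + 1 : ℕ) * (d / 2)) := by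
    have one : ∀ t ∈ Icc a b, HasLift φ γ t (t + d / 2) := by
      intro t ht
      obtain ⟨i, hi⟩ := hleb t ht
      have hsub : Icc t (t + d / 2) ⊆ ball i (η i) := by
        refine Subset.trans ?_ hi
        intro v hv
        rw [mem_ball, Real.dist_eq, abs_lt]
        constructor <;> linarith [hv.1, hv.2]
      exact ⟨ℓ i, q i, (hc i).mono hsub, fun t ht => hℓ i t (hsub ht)⟩
    intro k
    induction k with
    | zero => intro h; simpa using one a ⟨le_rfl, by simpa using h⟩
    | succ k ih =>
      intro h
      push_cast at h ih ⊢
      have h1 := ih (by linarith)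
      have hk : (0:ℝ) ≤ k * (d / 2) := by positivity
      have h2 := one (a + (k + 1) * (d / 2)) ⟨by linarith, h⟩
      have := h1.glue (by linarith) (by linarith) h2
      convert this using 1
      ring
  rcases lt_or_ge b a with hab | hab
  · exact ⟨fun _ => 0, y, continuousOn_const, fun t ht => absurd (ht.1.trans ht.2) (not_le.2 hab)⟩
  obtain ⟨k, hk⟩ : ∃ k : ℕ, a + k * (d / 2) ≤ b ∧ b ≤ a + (k + 1 : ℕ) * (d / 2) := by
    refine ⟨⌊(b - a) / (d / 2)⌋₊, ?_, ?_⟩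
    · have := Nat.floor_le (show 0 ≤ (b - a) / (d / 2) from div_nonneg (by linarith) (by linarith))
      rw [le_div_iff₀ (by linarith)] at this
      linarith
    · have := Nat.lt_floor_add_one ((b - a) / (d / 2))
      rw [div_lt_iff₀ (by linarith)] at this
      push_cast
      linarith
  obtain ⟨ℓ', q', h1, h2⟩ := hstep k hk.1
  have hsub : Icc a b ⊆ Icc a (a + (k + 1 : ℕ) * (d / 2)) := Icc_subset_Icc_right hk.2
  exact ⟨ℓ', q', h1.mono hsub, fun t ht => h2 t (hsub ht)⟩

theorem globalLift {M : Type*} [MetricSpace M] (φ : Flow ℝ M) (y : M) (hy : ∃ a, φ a y ≠ y)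
    (γ : ℝ → M) (hγ : Continuous γ) (h0 : γ 0 = y) (horb : ∀ t, ∃ u, φ u y = γ t) :
    ∃ σ : ℝ → ℝ, Continuous σ ∧ σ 0 = 0 ∧ ∀ t, γ t = φ (σ t) y := by
  have hn : ∀ n : ℕ, ∃ ℓ : ℝ → ℝ, ContinuousOn ℓ (Icc (-(n:ℝ)) n) ∧ ℓ 0 = 0 ∧
      ∀ t ∈ Icc (-(n:ℝ)) n, γ t = φ (ℓ t) y := by
    intro n
    obtain ⟨ℓ, q, hc, hℓ⟩ := hasLift_all φ y hy γ hγ horb (-n) n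
    refine ⟨fun t => ℓ t - ℓ 0, hc.sub continuousOn_const, sub_self _, fun t ht => ?_⟩
    have hq : y = φ (ℓ 0) q := by rw [← h0]; exact hℓ 0 ⟨by simp, by simp⟩
    rw [hℓ t ht, hq, ← φ.map_add]; congr 1; ring
  choose ℓ hc hz hℓ using hn
  have huniq : ∀ m n : ℕ, m ≤ n → ∀ t ∈ Icc (-(m:ℝ)) m, ℓ n t = ℓ m t := by
    intro m n hmn t ht
    have hmn' : (m:ℝ) ≤ n := by exact_mod_cast hmn
    have hsub : Icc (-(m:ℝ)) m ⊆ Icc (-(n:ℝ)) n := Icc_subset_Icc (by linarith) hmn'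
    have := stab_const φ y hy (Icc (-(m:ℝ)) m) isPreconnected_Icc (fun t => ℓ n t - ℓ m t)
      (((hc n).mono hsub).sub (hc m)) 0 ⟨by simp, by simp⟩ (by simp [hz]) (by
        intro t ht
        have e1 := hℓ n t (hsub ht)
        have e2 := hℓ m t ht
        have : φ (-ℓ m t) (φ (ℓ n t) y) = φ (-ℓ m t) (φ (ℓ m t) y) := by rw [← e1, ← e2]
        rw [← φ.map_add, ← φ.map_add, neg_add_cancel, φ.map_zero_apply] at this
        have e : ℓ n t - ℓ m t = -ℓ m t + ℓ n t := by ring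
        show φ (ℓ n t - ℓ m t) y = y
        rw [e]; exact this) t ht
    linarith
  have hmem : ∀ t : ℝ, t ∈ Icc (-(⌈|t|⌉₊:ℝ)) ⌈|t|⌉₊ := fun t => abs_le.1 (Nat.le_ceil _)
  have heq : ∀ n : ℕ, ∀ t ∈ Icc (-(n:ℝ)) n, ℓ ⌈|t|⌉₊ t = ℓ n t := by
    intro n t ht
    exact (huniq _ n (Nat.ceil_le.2 (abs_le.2 ht)) t (hmem t)).symm
  refine ⟨fun t => ℓ ⌈|t|⌉₊ t, ?_, hz _, fun t => hℓ _ t (hmem t)⟩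
  rw [continuous_iff_continuousAt]
  intro t
  obtain ⟨n, hn⟩ := exists_nat_gt |t|
  have hnb : Icc (-(n:ℝ)) n ∈ nhds t := Icc_mem_nhds (abs_lt.1 hn).1 (abs_lt.1 hn).2
  refine ((hc n).continuousAt hnb).congr ?_
  filter_upwards [hnb] with v hv
  exact (heq n v hv).symm

theorem exists_tau {M₁ M₂ : Type*} [MetricSpace M₁] [MetricSpace M₂]
    (φ : Flow ℝ M₁) (ψ : Flow ℝ M₂) (h : M₁ ≃ₜ M₂)
    (hconj : ∀ x : M₁, h '' {y : M₁ | ∃ t : ℝ, φ t x = y} = {z : M₂ | ∃ t : ℝ, ψ t (h x) = z})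
    (x : M₁) : ∃ τ : ℝ ≃ₜ ℝ, τ 0 = 0 ∧ ∀ t, h (φ t x) = ψ (τ t) (h x) := by
  have h1 : ∀ t, ∃ u, ψ u (h x) = h (φ t x) := by
    intro t
    have : h (φ t x) ∈ h '' {y : M₁ | ∃ t : ℝ, φ t x = y} := mem_image_of_mem _ ⟨t, rfl⟩
    rw [hconj x] at this
    exact this
  have h2 : ∀ t, ∃ u, φ u x = h.symm (ψ t (h x)) := by
    intro t
    have : ψ t (h x) ∈ {z : M₂ | ∃ t : ℝ, ψ t (h x) = z} := ⟨t, rfl⟩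
    rw [← hconj x] at this
    obtain ⟨_, ⟨u, rfl⟩, hu⟩ := this
    exact ⟨u, by rw [← hu, h.symm_apply_apply]⟩
  by_cases hx : ∃ a, φ a x ≠ x
  · have hy : ∃ a, ψ a (h x) ≠ h x := by
      by_contra! hcon
      obtain ⟨a, ha⟩ := hx
      obtain ⟨u, hu⟩ := h1 a
      rw [hcon] at hu
      exact ha (h.injective hu.symm)
    obtain ⟨τ, hτc, hτ0, hτ⟩ := globalLift ψ (h x) hy (fun t => h (φ t x))
      (by fun_prop) (by simp) h1
    obtain ⟨σ, hσc, hσ0, hσ⟩ := globalLift φ x hx (fun t => h.symm (ψ t (h x)))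
      (by fun_prop) (by simp) h2
    have hst : ∀ t, σ (τ t) = t := by
      intro t
      have := stab_const φ x hx univ isPreconnected_univ (fun t => -t + σ (τ t))
        (by fun_prop) 0 trivial (by simp [hτ0, hσ0]) (by
          intro t _
          rw [φ.map_add, ← hσ, ← hτ, h.symm_apply_apply, ← φ.map_add, neg_add_cancel,
            φ.map_zero_apply]) t trivial
      linarith
    have hts : ∀ t, τ (σ t) = t := by
      intro t
      have := stab_const ψ (h x) hy univ isPreconnected_univ (fun t => -t + τ (σ t))
        (by fun_prop) 0 trivial (by simp [hτ0, hσ0]) (by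
          intro t _
          rw [ψ.map_add, ← hτ, ← hσ, h.apply_symm_apply, ← ψ.map_add, neg_add_cancel,
            ψ.map_zero_apply]) t trivial
      linarith
    exact ⟨⟨⟨τ, σ, hst, hts⟩, hτc, hσc⟩, hτ0, hτ⟩
  · push Not at hx
    refine ⟨Homeomorph.refl ℝ, rfl, fun t => ?_⟩
    obtain ⟨u, hu⟩ := h2 t
    rw [hx] at hu
    rw [hx]
    exact (h.symm_apply_eq.1 hu.symm).symm

theorem exists_spread (T s : ℝ) (hs : 0 ≤ s) (hsT : s < T) :
    ∃ e : ℝ ≃ₜ ℝ, ∀ t, e t = t - s * min (|t| / T) 1 := by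
  have hT : 0 < T := by linarith
  let f : ℝ → ℝ := fun t => t - s * min (|t| / T) 1
  have hf : Continuous f := by fun_prop
  have hm : ∀ t : ℝ, 0 ≤ min (|t| / T) 1 := fun t => le_min (by positivity) zero_le_one
  have hm1 : ∀ t : ℝ, min (|t| / T) 1 ≤ 1 := fun t => min_le_right _ _
  have hmono : StrictMono f := by
    intro a b hab
    have h1 : min (|b| / T) 1 ≤ min (|a| / T) 1 + (b - a) / T := by
      have hb : |b| ≤ |a| + (b - a) := by
        have := abs_add_le a (b - a)
        rw [abs_of_pos (by linarith : 0 < b - a)] at this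
        simpa using this
      have h2 : |b| / T ≤ |a| / T + (b - a) / T := by
        rw [← add_div]; gcongr
      have h3 : 0 ≤ (b - a) / T := div_nonneg (by linarith) hT.le
      rcases le_total (|a| / T) 1 with h | h
      · rw [min_eq_left h]; exact (min_le_left _ _).trans h2
      · rw [min_eq_right h]; linarith [hm1 b]
    have h4 : s * ((b - a) / T) < b - a := by
      rw [mul_div_assoc', div_lt_iff₀ hT]
      nlinarith
    have h5 := mul_le_mul_of_nonneg_left h1 hs
    show a - s * min (|a| / T) 1 < b - s * min (|b| / T) 1
    linarith
  have hsurj : Function.Surjective f := by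
    apply hf.surjective
    · refine Filter.tendsto_atTop_mono (f := fun t : ℝ => t + (-s)) (fun t => ?_)
        (Filter.tendsto_atTop_add_const_right _ _ Filter.tendsto_id)
      have := mul_le_mul_of_nonneg_left (hm1 t) hs
      show t + -s ≤ t - s * min (|t| / T) 1
      linarith
    · refine Filter.tendsto_atBot_mono (f := fun t : ℝ => t) (fun t => ?_) Filter.tendsto_id
      have := mul_nonneg hs (hm t)
      show t - s * min (|t| / T) 1 ≤ t
      linarith
  exact ⟨(hmono.orderIsoOfSurjective f hsurj).toHomeomorph, fun t => rfl⟩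

theorem isolated_fixed {M : Type*} [MetricSpace M] (φ : Flow ℝ M) (N : ℕ) (H : FinExp φ N)
    (p : M) (hp : ∀ t, φ t p = p) : ∀ᶠ y in nhds p, y = p := by
  obtain ⟨δ, hδ, H⟩ := H 1 one_pos
  set T : ℝ := N + 2 with hT
  have hT0 : 0 < T := by positivity
  let W : Set M := {y | ∀ t ∈ Icc (-T) T, dist (φ t y) p < δ / 2}
  have hW : ∀ᶠ y in nhds p, y ∈ W := by
    refine IsCompact.eventually_forall_of_forall_eventually isCompact_Icc
      (P := fun y t => dist (φ t y) p < δ / 2) fun t _ => ?_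
    have hc : Continuous fun z : M × ℝ => dist (φ z.2 z.1) p := by fun_prop
    refine hc.continuousAt.eventually (gt_mem_nhds ?_)
    simp only [hp, dist_self]
    linarith
  have hper : ∀ y ∈ W, ∃ u : ℝ, u ≠ 0 ∧ |u| ≤ T ∧ φ u y = y := by
    intro y hy
    have hiN : ∀ i : Fin (N + 1), ((i : ℕ) : ℝ) ≤ N := fun i => by
      exact_mod_cast Nat.lt_succ_iff.1 i.2
    choose e he using fun i : Fin (N + 1) =>
      exists_spread T (i : ℕ) (Nat.cast_nonneg _) (by linarith [hiN i])
    obtain ⟨i, j, hij, s, hs, hφ⟩ := H (fun i => φ (i : ℕ) y) e (fun i => by simp [he]) (by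
      intro t i j
      simp only [← φ.map_add]
      rcases le_or_gt T |t| with h | h
      · have h1 : min (|t| / T) 1 = 1 := min_eq_right (by rwa [one_le_div hT0])
        have : ∀ i : Fin (N + 1), e i t + (i : ℕ) = t := by
          intro i; rw [he, h1]; ring
        rw [this, this, dist_self]; exact hδ
      · have h1 : min (|t| / T) 1 = |t| / T := min_eq_left (by rw [div_le_one hT0]; exact h.le)
        have hin : ∀ i : Fin (N + 1), e i t + (i : ℕ) ∈ Icc (-T) T := by
          intro i
          rw [he, h1]
          have h2 : |t| / T ≤ 1 := by rw [div_le_one hT0]; exact h.le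
          have h3 : 0 ≤ ((i : ℕ) : ℝ) := Nat.cast_nonneg _
          have h4 : T * (|t| / T) = |t| := by field_simp
          have h5 := hiN i
          have := abs_le.1 (le_refl |t|)
          have h6 := mul_nonneg h3 (sub_nonneg.2 h2)
          have h7 := mul_nonneg (by linarith : 0 ≤ T - ((i : ℕ) : ℝ)) (sub_nonneg.2 h2)
          constructor <;> nlinarith
        have k1 := hy _ (hin i)
        have k2 := hy _ (hin j)
        have := dist_triangle_right (φ (e i t + (i : ℕ)) y) (φ (e j t + (j : ℕ)) y) p
        linarith)
    refine ⟨s + (i : ℕ) - (j : ℕ), ?_, ?_, ?_⟩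
    · intro h0
      have hs' : s = (((j : ℕ) : ℤ) - ((i : ℕ) : ℤ) : ℤ) := by push_cast; linarith
      rw [hs'] at hs
      have h1 : |(((j : ℕ) : ℤ) - ((i : ℕ) : ℤ))| < 1 := by exact_mod_cast hs
      have h2 := Int.abs_lt_one_iff.1 h1
      exact hij (Fin.ext (by omega))
    · have h1 := hiN i
      have h2 := hiN j
      have h3 : 0 ≤ ((i : ℕ) : ℝ) := Nat.cast_nonneg _
      have h4 : 0 ≤ ((j : ℕ) : ℝ) := Nat.cast_nonneg _
      rw [abs_lt] at hs
      rw [abs_le]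
      constructor <;> linarith
    · simp only [← φ.map_add] at hφ
      have : φ (-(j : ℕ)) (φ (s + (i : ℕ)) y) = φ (-(j : ℕ)) (φ (j : ℕ) y) := by rw [hφ]
      simp only [← φ.map_add] at this
      rw [neg_add_cancel, φ.map_zero_apply] at this
      have e : s + (i : ℕ) - (j : ℕ) = -(j : ℕ) + (s + (i : ℕ)) := by ring
      rw [e]; exact this
  have hred : ∀ y ∈ W, ∀ t, ∃ t' ∈ Icc (-T) T, φ t y = φ t' y := by
    intro y hy t
    obtain ⟨u, hu0, huT, hu⟩ := hper y hy
    refine ⟨t - ⌊t / u⌋ * u, ?_, ?_⟩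
    · have e : t - ⌊t / u⌋ * u = Int.fract (t / u) * u := by
        rw [Int.fract, sub_mul, div_mul_cancel₀ _ hu0]
      rw [e, mem_Icc, ← abs_le, abs_mul, abs_of_nonneg (Int.fract_nonneg _)]
      nlinarith [(Int.fract_lt_one (t / u)).le, abs_nonneg u, Int.fract_nonneg (t / u)]
    · have h1 := stab_int φ y u hu ⌊t / u⌋
      nth_rw 2 [← h1]
      rw [← φ.map_add]; congr 1; ring
  by_contra hno
  have hfreq : ∃ᶠ y in nhds p, y ≠ p := Filter.not_eventually.1 hno
  have key : ∀ k : ℕ, ∃ S : Finset M, S.card = k ∧ (∀ x ∈ S, x ∈ W ∧ x ≠ p) ∧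
      ∀ a ∈ S, ∀ b ∈ S, a ≠ b → ∀ s : ℝ, φ s a ≠ b := by
    intro k
    induction k with
    | zero => exact ⟨∅, by simp⟩
    | succ k ih =>
      obtain ⟨S, hSc, hSW, hS⟩ := ih
      have hev : ∀ᶠ y in nhds p, ∀ x ∈ S, ∀ t ∈ Icc (-T) T, φ t x ≠ y := by
        rw [Filter.eventually_all_finset]
        intro x hx
        have hcl : IsClosed ((fun t => φ t x) '' Icc (-T) T) :=
          (isCompact_Icc.image (by fun_prop)).isClosed
        have hpn : p ∉ (fun t => φ t x) '' Icc (-T) T := by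
          rintro ⟨t, -, ht⟩
          apply (hSW x hx).2
          have : φ (-t) (φ t x) = φ (-t) p := congrArg _ ht
          rwa [hp, ← φ.map_add, neg_add_cancel, φ.map_zero_apply] at this
        filter_upwards [hcl.isOpen_compl.mem_nhds hpn] with y hy t ht h
        exact hy ⟨t, ht, h⟩
      obtain ⟨a, hap, haW, ha'⟩ := (hfreq.and_eventually (hW.and hev)).exists
      have ha : ∀ b ∈ S, ∀ s : ℝ, φ s b ≠ a := by
        intro b hb s
        obtain ⟨t', ht', he⟩ := hred b (hSW b hb).1 s
        rw [he]
        exact ha' b hb t' ht'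
      classical
      have haS : a ∉ S := fun h => ha a h 0 (φ.map_zero_apply a)
      refine ⟨insert a S, by rw [Finset.card_insert_of_notMem haS, hSc], ?_, ?_⟩
      · intro x hx
        rw [Finset.mem_insert] at hx
        rcases hx with rfl | hx
        · exact ⟨haW, hap⟩
        · exact hSW x hx
      · intro x hx y hy hxy s
        rw [Finset.mem_insert] at hx hy
        rcases hx with rfl | hx <;> rcases hy with rfl | hy
        · exact absurd rfl hxy
        · intro h
          refine ha y hy (-s) ?_
          rw [← h, ← φ.map_add, neg_add_cancel, φ.map_zero_apply]
        · exact ha x hx s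
        · exact hS x hx y hy hxy s
  obtain ⟨S, hSc, hSW, hS⟩ := key (N + 1)
  let e := (Finset.equivFinOfCardEq hSc).symm
  obtain ⟨i, j, hij, s, hs, hφ⟩ := H (fun i => e i) (fun i => Homeomorph.refl ℝ)
    (fun i => rfl) (fun t i j => by
      obtain ⟨t1, ht1, h1⟩ := hred _ (hSW _ (e i).2).1 t
      obtain ⟨t2, ht2, h2⟩ := hred _ (hSW _ (e j).2).1 t
      have k1 := (hSW _ (e i).2).1 t1 ht1
      have k2 := (hSW _ (e j).2).1 t2 ht2
      rw [← h1] at k1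
      rw [← h2] at k2
      have := dist_triangle_right (φ t (e i)) (φ t (e j)) p
      show dist (φ t (e i)) (φ t (e j)) < δ
      linarith)
  exact hS _ (e i).2 _ (e j).2 (fun h => hij (e.injective (Subtype.ext h))) s hφ

theorem timeConv {M₁ M₂ : Type*} [MetricSpace M₁] [MetricSpace M₂]
    [CompactSpace M₁]
    (φ : Flow ℝ M₁) (ψ : Flow ℝ M₂) (h : M₁ ≃ₜ M₂)
    (hconj : ∀ x : M₁, h '' {y : M₁ | ∃ t : ℝ, φ t x = y} = {z : M₂ | ∃ t : ℝ, ψ t (h x) = z})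
    (hiso : ∀ p, (∀ t, ψ t p = p) → ∀ᶠ y in nhds p, y = p) (ε : ℝ) (hε : 0 < ε) :
    ∃ ε' > 0, ∀ s : ℝ, |s| < ε' → ∀ x, ∃ u : ℝ, |u| < ε ∧ φ u x = h.symm (ψ s (h x)) := by
  have main : ∀ᶠ s : ℝ in nhds 0, ∀ x ∈ (univ : Set M₁),
      ∃ u : ℝ, |u| < ε ∧ φ u x = h.symm (ψ s (h x)) := by
    refine IsCompact.eventually_forall_of_forall_eventually isCompact_univ
      (P := fun s x => ∃ u : ℝ, |u| < ε ∧ φ u x = h.symm (ψ s (h x))) fun z _ => ?_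
    rw [nhds_prod_eq]
    by_cases hz : ∃ a, φ a z ≠ z
    · obtain ⟨F, hF, c, hc, r, hr, hV⟩ := crossSection φ z hz
      set e := min ε r with he
      have he0 : 0 < e := lt_min hε hr
      have hcont : Continuous fun q : ℝ × M₁ => |F (h.symm (ψ q.1 (h q.2))) - F q.2| := by
        fun_prop
      have hev : ∀ᶠ q : ℝ × M₁ in nhds (0, z), |F (h.symm (ψ q.1 (h q.2))) - F q.2| < c * e := by
        refine hcont.continuousAt.eventually (gt_mem_nhds ?_)
        simp only [ψ.map_zero_apply, h.symm_apply_apply, sub_self, abs_zero]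
        positivity
      rw [nhds_prod_eq] at hev
      obtain ⟨P, hP, Q, hQ, hPQ⟩ := Filter.eventually_prod_iff.1 hev
      obtain ⟨ρ, hρ, hρP⟩ := Metric.eventually_nhds_iff.1 hP
      have hb : ∀ᶠ s : ℝ in nhds 0, |s| < ρ := by
        filter_upwards [ball_mem_nhds (0:ℝ) hρ] with s hs
        simpa using hs
      refine Filter.eventually_prod_iff.2 ⟨_, hb, _, hQ.and hV, ?_⟩
      rintro s hs x ⟨hx, hxV⟩
      obtain ⟨τ, hτ0, hτ⟩ := exists_tau φ ψ h hconj x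
      have hτs : ∀ s, φ (τ.symm s) x = h.symm (ψ s (h x)) := by
        intro s
        rw [eq_comm, h.symm_apply_eq, hτ, τ.apply_symm_apply]
      refine ⟨τ.symm s, ?_, hτs s⟩
      by_contra hcon
      push Not at hcon
      have hcont2 : ContinuousOn (fun v => |τ.symm v|) (uIcc 0 s) := by fun_prop
      have h00 : τ.symm 0 = 0 := by rw [τ.symm_apply_eq, hτ0]
      have hmem : e ∈ uIcc (|τ.symm 0|) (|τ.symm s|) := by
        rw [h00, abs_zero, mem_uIcc]
        exact Or.inl ⟨he0.le, (min_le_left _ _).trans hcon⟩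
      obtain ⟨v, hv, hve⟩ := intermediate_value_uIcc hcont2 hmem
      have hvs : |v| ≤ |s| := by
        have := abs_sub_left_of_mem_uIcc hv
        simpa using this
      have hsmall := hPQ (hρP (y := v) (by simpa using lt_of_le_of_lt hvs hs)) hx
      simp only at hsmall hve
      rw [← hτs v] at hsmall
      have her : e ≤ r := min_le_right _ _
      rw [abs_lt] at hsmall
      rcases abs_cases (τ.symm v) with ⟨h1, h2⟩ | ⟨h1, h2⟩
      · have := hxV (τ.symm v) 0 (by linarith) h2 (by linarith)
        rw [φ.map_zero_apply, ← h1, hve, sub_zero] at this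
        rw [← h1, hve] at hsmall
        linarith
      · have := hxV 0 (τ.symm v) (by linarith) h2.le (by linarith)
        have h3 : τ.symm v = -e := by linarith
        rw [φ.map_zero_apply, h3] at this
        rw [h3] at hsmall
        linarith
    · push Not at hz
      have hfix : ∀ t, ψ t (h z) = h z := by
        intro t
        have : ψ t (h z) ∈ {w : M₂ | ∃ t : ℝ, ψ t (h z) = w} := ⟨t, rfl⟩
        rw [← hconj z] at this
        obtain ⟨_, ⟨u, rfl⟩, hu⟩ := this
        rw [← hu, hz]
      have hQ : ∀ᶠ x in nhds z, h x = h z := h.continuous.continuousAt.eventually (hiso _ hfix)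
      refine Filter.eventually_prod_iff.2 ⟨fun _ => True, Filter.Eventually.of_forall fun _ => trivial, _, hQ, ?_⟩
      intro s _ x hx
      refine ⟨0, by simpa using hε, ?_⟩
      rw [hx, hfix, h.symm_apply_apply, φ.map_zero_apply]
      exact h.injective hx
  obtain ⟨ε', hε', H⟩ := Metric.eventually_nhds_iff.1 main
  exact ⟨ε', hε', fun s hs x => H (by simpa using hs) x trivial⟩

/-- N-expansiveness is a conjugacy invariant: if `h : M₁ ≃ₜ M₂` maps each orbit of the
flow `φ` onto an orbit of the flow `ψ`, and `ψ` is `N`-expansive, then so is `φ`. -/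
theorem nexpansive_of_conjugate
    {M₁ M₂ : Type*} [MetricSpace M₁] [MetricSpace M₂]
    [CompactSpace M₁] [CompactSpace M₂]
    (φ : Flow ℝ M₁) (ψ : Flow ℝ M₂) (h : M₁ ≃ₜ M₂)
    (hconj : ∀ x : M₁, h '' {y : M₁ | ∃ t : ℝ, φ t x = y} = {z : M₂ | ∃ t : ℝ, ψ t (h x) = z})
    (N : ℕ) (hN : 0 < N) (hψ : NExpansive ψ N) :
    NExpansive φ N := by
  have hfin := finExp_of_nexp ψ N hψ
  apply nexp_of_finExp
  intro ε hε
  obtain ⟨ε', hε', hconv⟩ := timeConv φ ψ h hconj (isolated_fixed ψ N hfin) ε hε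
  obtain ⟨δ', hδ', H⟩ := hfin ε' hε'
  obtain ⟨δ, hδ, huc⟩ := Metric.uniformContinuous_iff.1
    (CompactSpace.uniformContinuous_of_continuous h.continuous) δ' hδ'
  refine ⟨δ, hδ, fun p α h0 hd => ?_⟩
  choose τ hτ0 hτ using exists_tau φ ψ h hconj
  obtain ⟨i, j, hij, s, hs, hψs⟩ := H (fun i => h (p i)) (fun i => (α i).trans (τ (p i)))
    (fun i => by simp [h0, hτ0]) (fun t i j => by
      simp only [Homeomorph.trans_apply]
      rw [← hτ, ← hτ]
      exact huc (hd t i j))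
  obtain ⟨u, hu, huφ⟩ := hconv s hs (p i)
  refine ⟨i, j, hij, u, hu, ?_⟩
  rw [huφ, hψs, h.symm_apply_apply]
end

section
/- Let (M,d) be a compact metric space and let X^t be an N-expansive flow on M for some integer N > 0. Then no fixed point of X^t is an accumulation point of the set of fixed points of X^t; that is, for every fixed point p there is a neighborhood of p containing no other fixed point. -/
open Set Metric

/-- If a flow on a compact metric space is N-expansive, then no fixed point is an
accumulation point of the set of fixed points: every fixed point has a neighborhood
containing no other fixed point. -/
theorem fixedPoint_not_accumulated
    {M : Type*} [MetricSpace M] [CompactSpace M]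
    (φ : Flow ℝ M) (N : ℕ) (hN : 0 < N) (hexp : NExpansive φ N)
    (p : M) (hp : ∀ t : ℝ, φ t p = p) :
    ∃ ε : ℝ, 0 < ε ∧ ∀ q : M, (∀ t : ℝ, φ t q = q) → dist q p < ε → q = p := by
  obtain ⟨δ, hδ, h⟩ := hexp 1 one_pos
  let A : Set M := {q | (∀ t : ℝ, φ t q = q) ∧ dist q p < δ / 3}
  have hpA : p ∈ A := ⟨hp, by simpa using by linarith⟩
  have hA : A.Finite := by
    obtain ⟨B, hBA, hBf, -, hB⟩ := h A (fun _ => Homeomorph.refl ℝ) p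
      ⟨hpA, fun _ => rfl, fun _ _ => rfl, fun _ => continuousOn_const⟩ (by
        intro t
        have hle : Metric.diam ((fun x => φ ((Homeomorph.refl ℝ) t) x) '' A) ≤ 2 * (δ / 3) := by
          apply Metric.diam_le_of_forall_dist_le (by linarith)
          rintro _ ⟨x, hx, rfl⟩ _ ⟨y, hy, rfl⟩
          simp only [hx.1, hy.1]
          have h1 := hx.2
          have h2 := hy.2
          have h3 := dist_triangle_right x y p
          linarith
        linarith)
    refine hBf.subset fun a ha => ?_
    obtain ⟨b, hb, s, -, hs⟩ := hB a ha
    rw [(hBA hb).1 s] at hs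
    exact hs ▸ hb
  have hopen : IsOpen (A \ {p})ᶜ := (hA.subset diff_subset).isClosed.isOpen_compl
  obtain ⟨r, hr, hball⟩ := Metric.isOpen_iff.1 hopen p (by simp)
  refine ⟨min r (δ / 3), lt_min hr (by linarith), fun q hq hd => ?_⟩
  by_contra hne
  exact hball (Metric.mem_ball.2 (hd.trans_le (min_le_left _ _)))
    ⟨⟨hq, hd.trans_le (min_le_right _ _)⟩, hne⟩
end

section
/- Let (M,d) be a compact metric space and let X^t be an N-expansive flow on M for some integer N > 0. Then each fixed point of X^t is an isolated point of the space M. -/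
open Set Metric

open Filter Topology

/-- A small invariant neighbourhood of the fixed point contains only the fixed point. -/
lemma aux_isolated_invariant {M : Type*} [MetricSpace M]
    (φ : Flow ℝ M) (N : ℕ) (hexp : NExpansive φ N)
    (p : M) (hp : ∀ t : ℝ, φ t p = p) :
    ∃ r : ℝ, 0 < r ∧ ∀ x, (∀ t : ℝ, dist (φ t x) p ≤ r) → x = p := by
  obtain ⟨δ, hδ, h⟩ := hexp 1 one_pos
  obtain ⟨B, hBA, hBf, -, hB⟩ := h {x | ∀ t : ℝ, dist (φ t x) p ≤ δ / 3}
    (fun _ => Homeomorph.refl ℝ) p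
    ⟨fun t => by rw [hp, dist_self]; positivity, fun t => rfl, fun x _ => rfl,
      fun t => continuousOn_const⟩ (by
      intro t
      refine lt_of_le_of_lt (Metric.diam_le_of_subset_closedBall (x := p) (r := δ / 3)
        (by positivity) ?_) (by linarith)
      rintro _ ⟨x, hx, rfl⟩
      exact hx t)
  have hev : ∀ᶠ r in 𝓝[>] (0 : ℝ), ∀ b ∈ B, b ≠ p → r < dist b p := by
    rw [eventually_all_finite hBf]
    intro b _
    by_cases hb : b = p
    · simp [hb]
    · have : ∀ᶠ r in 𝓝[>] (0 : ℝ), r < dist b p :=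
        nhdsWithin_le_nhds (Iio_mem_nhds (dist_pos.2 hb))
      filter_upwards [this] with r hr _ using hr
  have hev2 : ∀ᶠ r in 𝓝[>] (0 : ℝ), r < δ / 3 :=
    nhdsWithin_le_nhds (Iio_mem_nhds (by positivity))
  obtain ⟨r, hr1, hr2, hr0⟩ := (hev.and (hev2.and self_mem_nhdsWithin)).exists
  refine ⟨r, hr0, fun x hx => ?_⟩
  obtain ⟨b, hb, s, -, hs⟩ := hB x (fun t => (hx t).trans hr2.le)
  by_cases hbp : b = p
  · rw [← hs, hbp, hp]
  · have h1 : φ (-s) x = b := by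
      rw [← hs, ← Flow.map_add]; simp
    have := hx (-s)
    rw [h1] at this
    exact absurd (hr1 b hb hbp) (not_lt.2 this)

/-- The reparametrizing homeomorphisms. -/
lemma aux_homeo (T κ s : ℝ) (hT : 0 < T) (hs : s ∈ Icc 0 T) :
    ∃ e : ℝ ≃ₜ ℝ, ∀ t, e t = t + s * (max κ (1 - |t| / (2 * T)) - 1) := by
  set g : ℝ → ℝ := fun t => max κ (1 - |t| / (2 * T)) with hg
  have hlip : ∀ a b, a ≤ b → g a - g b ≤ (b - a) / (2 * T) := by
    intro a b hab
    have h1 : |b| / (2 * T) ≤ |a| / (2 * T) + (b - a) / (2 * T) := by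
      rw [← add_div]
      gcongr
      have := abs_sub_abs_le_abs_sub b a
      rw [abs_of_nonneg (sub_nonneg.2 hab)] at this
      linarith
    have h2 : 0 ≤ (b - a) / (2 * T) := div_nonneg (sub_nonneg.2 hab) (by positivity)
    have h3 : κ ≤ g b := le_max_left _ _
    have h4 : 1 - |b| / (2 * T) ≤ g b := le_max_right _ _
    have : g a ≤ g b + (b - a) / (2 * T) := max_le (by linarith) (by linarith)
    linarith
  have hkey : ∀ a b, a ≤ b → (b - a) / 2 ≤ (b + s * (g b - 1)) - (a + s * (g a - 1)) := by
    intro a b hab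
    have h1 := hlip a b hab
    have h2 : s * (g a - g b) ≤ s * ((b - a) / (2 * T)) := mul_le_mul_of_nonneg_left h1 hs.1
    have h3 : s * ((b - a) / (2 * T)) ≤ T * ((b - a) / (2 * T)) :=
      mul_le_mul_of_nonneg_right hs.2 (div_nonneg (sub_nonneg.2 hab) (by positivity))
    have h4 : T * ((b - a) / (2 * T)) = (b - a) / 2 := by field_simp
    linarith
  have hgc : Continuous g := by rw [hg]; fun_prop
  set f : ℝ → ℝ := fun t => t + s * (g t - 1) with hf
  have hfc : Continuous f := by rw [hf]; fun_prop
  have hmono : StrictMono f := by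
    intro a b hab
    have := hkey a b hab.le
    simp only [hf]; linarith
  have htop : Tendsto f atTop atTop := by
    refine tendsto_atTop_mono' (f₁ := fun t => t / 2 + f 0) atTop ?_ ?_
    · filter_upwards [eventually_ge_atTop 0] with t ht
      have := hkey 0 t ht
      simp only [hf]; linarith
    · exact tendsto_atTop_add_const_right _ _ (tendsto_id.atTop_div_const two_pos)
  have hbot : Tendsto f atBot atBot := by
    refine tendsto_atBot_mono' (f₁ := fun t => t / 2 + f 0) atBot ?_ ?_
    · filter_upwards [eventually_le_atBot 0] with t ht
      have := hkey t 0 ht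
      simp only [hf]; linarith
    · exact tendsto_atBot_add_const_right _ _ (tendsto_id.atBot_div_const two_pos)
  exact ⟨(hmono.orderIsoOfSurjective f (hfc.surjective htop hbot)).toHomeomorph, fun t => rfl⟩

/-- Continuous left inverse of an injective continuous map on a compact space. -/
lemma aux_inverse {K M : Type*} [TopologicalSpace K] [CompactSpace K] [Nonempty K] [MetricSpace M]
    (f : K → M) (hf : Continuous f) (hi : Function.Injective f) :
    ∃ σ : M → K, (∀ s, σ (f s) = s) ∧ ContinuousOn σ (range f) := by
  have he := (hf.isClosedEmbedding hi).isEmbedding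
  refine ⟨Function.invFun f, Function.leftInverse_invFun hi, ?_⟩
  rw [continuousOn_iff_continuous_domRestrict]
  have : (range f).domRestrict (Function.invFun f) = he.toHomeomorph.symm := by
    funext x
    obtain ⟨s, hs⟩ := he.toHomeomorph.surjective x
    rw [← hs, Homeomorph.symm_apply_apply]
    exact Function.leftInverse_invFun hi s
  rw [this]
  exact Homeomorph.continuous _

/-- If a flow on a compact metric space is N-expansive, then each fixed point of the flow
is an isolated point of the space. -/
theorem fixedPoint_isolated
    {M : Type*} [MetricSpace M] [CompactSpace M]
    (φ : Flow ℝ M) (N : ℕ) (hN : 0 < N) (hexp : NExpansive φ N)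
    (p : M) (hp : ∀ t : ℝ, φ t p = p) :
    IsOpen ({p} : Set M) := by
  obtain ⟨r, hr, hiso⟩ := aux_isolated_invariant φ N hexp p hp
  obtain ⟨δ, hδ, h⟩ := hexp 1 one_pos
  have hφ : Continuous (fun q : ℝ × M => φ q.1 q.2) := φ.cont'
  obtain ⟨T, hTdef⟩ : ∃ T : ℝ, T = 2 * N + 2 := ⟨_, rfl⟩
  have hT : 0 < T := by rw [hTdef]; positivity
  -- uniform continuity in time
  have hη : ∀ᶠ a in 𝓝 (0 : ℝ), ∀ z ∈ (univ : Set M), dist (φ a z) z < δ / 3 := by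
    apply isCompact_univ.eventually_forall_of_forall_eventually
    intro z _
    have hc : Continuous (fun q : ℝ × M => dist (φ q.1 q.2) q.2) := hφ.dist continuous_snd
    apply hc.continuousAt.eventually_lt continuousAt_const
    simp [hδ]
  obtain ⟨η, hη0, hη⟩ := Metric.eventually_nhds_iff.1 hη
  -- long orbit segments stay near p
  have hnear : ∀ᶠ y in 𝓝 p, ∀ t ∈ Icc (-(3 * T)) (3 * T), dist (φ t y) p < min r (δ / 3) := by
    apply isCompact_Icc.eventually_forall_of_forall_eventually
    intro t _
    have hc : Continuous (fun q : M × ℝ => dist (φ q.2 q.1) p) :=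
      (hφ.comp continuous_swap).dist continuous_const
    apply hc.continuousAt.eventually_lt continuousAt_const
    simp [hp, hr, hδ]
  rw [isOpen_iff_mem_nhds]
  rintro _ rfl
  filter_upwards [hnear] with y hy
  by_contra hyp
  have hinj : ∀ a ∈ Icc 0 T, ∀ b ∈ Icc 0 T, φ a y = φ b y → a = b := by
    have hlt : ∀ a ∈ Icc 0 T, ∀ b ∈ Icc 0 T, φ a y = φ b y → ¬ a < b := by
      intro a ha b hb hab hlt
      have hP : φ (b - a) y = y := by
        have h1 : φ (-a) (φ a y) = φ (-a) (φ b y) := by rw [hab]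
        rw [← Flow.map_add, ← Flow.map_add] at h1
        rw [sub_eq_neg_add, ← h1]; simp
      have hper : Function.Periodic (fun t => φ t y) (b - a) := by
        intro t
        simp only [Flow.map_add, hP]
      apply hyp
      apply hiso
      intro t
      obtain ⟨u, hu, htu⟩ := hper.exists_mem_Ico₀ (sub_pos.2 hlt) t
      rw [htu]
      refine ((hy u ⟨?_, ?_⟩).trans_le (min_le_left _ _)).le
      · linarith [hu.1]
      · linarith [hu.2, ha.1, hb.2]
    intro a ha b hb hab
    rcases lt_trichotomy a b with h1 | h1 | h1
    · exact absurd h1 (hlt a ha b hb hab)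
    · exact h1
    · exact absurd h1 (hlt b hb a ha hab.symm)
  haveI : Nonempty (Icc 0 T) := ⟨⟨0, le_rfl, hT.le⟩⟩
  obtain ⟨σ, hσ, hσc⟩ := aux_inverse (fun s : Icc 0 T => φ s.1 y)
    (hφ.comp (continuous_subtype_val.prodMk continuous_const))
    (fun a b hab => Subtype.ext (hinj _ a.2 _ b.2 hab))
  obtain ⟨κ, hκ⟩ : ∃ κ, κ = min 1 (η / (2 * T)) := ⟨_, rfl⟩
  have hκ0 : 0 < κ := by rw [hκ]; positivity
  have hκ1 : κ ≤ 1 := by rw [hκ]; exact min_le_left _ _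
  have hκη : κ * T < η := by
    have : κ ≤ η / (2 * T) := by rw [hκ]; exact min_le_right _ _
    have h2 : κ * T ≤ η / (2 * T) * T := mul_le_mul_of_nonneg_right this hT.le
    have h3 : η / (2 * T) * T = η / 2 := by field_simp
    linarith
  choose e he using fun s : Icc 0 T => aux_homeo T κ s.1 hT s.2
  obtain ⟨B, hBA, hBf, hBN, hB⟩ := h (range (fun s : Icc 0 T => φ s.1 y)) (fun x => e (σ x))
    y ⟨⟨⟨0, le_rfl, hT.le⟩, by simp⟩, (by
      intro t
      have h0 : σ y = ⟨0, le_rfl, hT.le⟩ := by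
        have := hσ ⟨0, le_rfl, hT.le⟩
        simpa using this
      simp [he, h0]), (by
      intro x _
      simp [he, hκ1]), (by
      intro t
      simp only [he]
      have : ContinuousOn (fun x => (σ x).1) (range (fun s : Icc 0 T => φ s.1 y)) :=
        continuous_subtype_val.comp_continuousOn hσc
      fun_prop)⟩ (by
      intro t
      have hform : ∀ s : Icc 0 T, φ (e (σ (φ s.1 y)) t) (φ s.1 y)
          = φ (s.1 * max κ (1 - |t| / (2 * T)) + t) y := by
        intro s
        rw [hσ s, he, ← Flow.map_add]
        congr 1
        ring
      suffices hc : ∃ c, ∀ s : Icc 0 T,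
          dist (φ (s.1 * max κ (1 - |t| / (2 * T)) + t) y) c ≤ δ / 3 by
        obtain ⟨c, hc⟩ := hc
        refine lt_of_le_of_lt (Metric.diam_le_of_subset_closedBall (x := c) (r := δ / 3)
          (by positivity) ?_) (by linarith)
        rintro _ ⟨_, ⟨s, rfl⟩, rfl⟩
        simp only [mem_closedBall, hform]
        exact hc s
      rcases le_total |t| (2 * T) with ht | ht
      · refine ⟨_, fun s => ((hy _ ?_).trans_le (min_le_right _ _)).le⟩
        have hg0 : 0 ≤ max κ (1 - |t| / (2 * T)) := hκ0.le.trans (le_max_left _ _)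
        have hg1 : max κ (1 - |t| / (2 * T)) ≤ 1 :=
          max_le hκ1 (by have : 0 ≤ |t| / (2 * T) := by positivity
                         linarith)
        have h1 := mul_nonneg s.2.1 hg0
        have h2 := mul_le_mul_of_nonneg_left hg1 s.2.1
        have h3 := abs_le.1 ht
        have h4 := s.2.2
        constructor <;> linarith
      · refine ⟨φ t y, fun s => ?_⟩
        have hg : max κ (1 - |t| / (2 * T)) = κ := by
          apply max_eq_left
          have : 1 ≤ |t| / (2 * T) := by rwa [le_div_iff₀ (by positivity), one_mul]
          linarith
        rw [hg, Flow.map_add]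
        refine (hη ?_ _ (mem_univ _)).le
        have h1 := mul_nonneg s.2.1 hκ0.le
        have h2 := mul_le_mul_of_nonneg_right s.2.2 hκ0.le
        rw [Real.dist_eq, sub_zero, abs_of_nonneg h1]
        linarith)
  -- counting
  have hcount : ∀ k : Fin (N + 1), ∃ b ∈ B, ∃ w ∈ Icc 0 T, |w - (2 * (k : ℕ) + 1)| < 1 ∧
      φ w y = b := by
    intro k
    have hk : ((k : ℕ) : ℝ) ≤ N := by exact_mod_cast Nat.lt_succ_iff.1 k.2
    have hk0 : (0 : ℝ) ≤ ((k : ℕ) : ℝ) := Nat.cast_nonneg _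
    obtain ⟨b, hb, u, hu, hub⟩ := hB (φ (2 * (k : ℕ) + 1) y)
      ⟨⟨2 * (k : ℕ) + 1, by linarith, by linarith⟩, rfl⟩
    have hu' := abs_lt.1 hu
    refine ⟨b, hb, -u + (2 * (k : ℕ) + 1), ⟨by linarith, by linarith⟩, ?_, ?_⟩
    · simpa using hu
    · rw [Flow.map_add, ← hub, ← Flow.map_add]; simp
  choose b hb w hw hwk hwb using hcount
  have hbi : Function.Injective b := by
    intro k j hkj
    have h1 : w k = w j := hinj _ (hw k) _ (hw j) (by rw [hwb, hwb, hkj])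
    have h2 := abs_lt.1 (hwk k)
    have h3 := abs_lt.1 (hwk j)
    rw [h1] at h2
    have h4 : ((k : ℕ) : ℝ) < (j : ℕ) + 1 := by linarith
    have h5 : ((j : ℕ) : ℝ) < (k : ℕ) + 1 := by linarith
    have h6 : (k : ℕ) < (j : ℕ) + 1 := by exact_mod_cast h4
    have h7 : (j : ℕ) < (k : ℕ) + 1 := by exact_mod_cast h5
    exact Fin.ext (by omega)
  have hle : (range b).ncard ≤ B.ncard :=
    Set.ncard_le_ncard (by rintro _ ⟨k, rfl⟩; exact hb k) hBf
  rw [← Set.image_univ, Set.ncard_image_of_injective _ hbi, Set.ncard_univ, Nat.card_fin] at hle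
  omega
end

section
/- Let (M,d) be a compact metric space and let X^t be an N-expansive flow on M for some integer N > 0. Then X^t is cw-expansive: for every ε > 0 there is δ > 0 such that whenever C ⊆ M is a continuum and α ∈ ℋ(C) satisfies diam(𝒳^t_α(C)) < δ for all t ∈ ℝ, there exists a point x ∈ C such that C ⊆ X^{(-ε,ε)}({x}) = {X^s(x) : |s| < ε}. -/
open Set Metric

/-- A flow is cw-expansive if for every ε > 0 there is δ > 0 such that every continuum
C (nonempty compact connected set) with α ∈ ℋ(C) and diam(𝒳ᵗ_α(C)) < δ for all t is
contained in a local orbit segment X^{(-ε,ε)}(x) of one of its points. -/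
def CWExpansive {M : Type*} [MetricSpace M] (φ : Flow ℝ M) : Prop :=
  ∀ ε : ℝ, 0 < ε → ∃ δ : ℝ, 0 < δ ∧
    ∀ (C : Set M) (α : M → ℝ ≃ₜ ℝ) (xα : M),
      IsCompact C → IsConnected C → MemH C α xα →
      (∀ t : ℝ, Metric.diam ((fun x => φ (α x t) x) '' C) < δ) →
      ∃ x ∈ C, ∀ y ∈ C, ∃ s : ℝ, |s| < ε ∧ φ s x = y

/-- The points of a connected set covered by finitely many short orbit arcs can be reached
from any given one of them by a chain of arcs. -/
lemma chain_aux {M : Type*} [MetricSpace M] (φ : Flow ℝ M) (C : Set M) (hC : IsConnected C)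
    (B : Finset M) (r : ℝ) (hr : 0 < r)
    (hcov : ∀ a ∈ C, ∃ b ∈ B, ∃ s : ℝ, |s| ≤ r ∧ φ s b = a) (x : M) (hx : x ∈ C) (k : ℕ) :
    ∃ D ⊆ B, (∀ b ∈ B, b ∈ D ↔ ∃ z ∈ C, (∃ s : ℝ, |s| ≤ k * (2 * r) ∧ φ s x = z) ∧
        ∃ s : ℝ, |s| ≤ r ∧ φ s b = z) ∧
      ((∀ y ∈ C, ∃ s : ℝ, |s| ≤ (k + 1) * (2 * r) ∧ φ s x = y) ∨ k + 1 ≤ D.card) := by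
  classical
  induction k with
  | zero =>
    refine ⟨B.filter (fun b => ∃ z ∈ C, (∃ s : ℝ, |s| ≤ ((0 : ℕ) : ℝ) * (2 * r) ∧ φ s x = z) ∧
        ∃ s : ℝ, |s| ≤ r ∧ φ s b = z), Finset.filter_subset _ _, ?_, Or.inr ?_⟩
    · intro b hb
      rw [Finset.mem_filter]
      exact ⟨fun h => h.2, fun h => ⟨hb, h⟩⟩
    · obtain ⟨b, hb, hs⟩ := hcov x hx
      have : 0 < (B.filter (fun b => ∃ z ∈ C,
        (∃ s : ℝ, |s| ≤ ((0 : ℕ) : ℝ) * (2 * r) ∧ φ s x = z) ∧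
        ∃ s : ℝ, |s| ≤ r ∧ φ s b = z)).card := by
        refine Finset.card_pos.2 ⟨b, ?_⟩
        rw [Finset.mem_filter]
        exact ⟨hb, x, hx, ⟨0, by simp, by simp⟩, hs⟩
      omega
  | succ k ih =>
    obtain ⟨D, hDB, hD, hor⟩ := ih
    set E := B.filter (fun b => ∃ z ∈ C, (∃ s : ℝ, |s| ≤ ((k + 1 : ℕ) : ℝ) * (2 * r) ∧ φ s x = z) ∧
        ∃ s : ℝ, |s| ≤ r ∧ φ s b = z) with hEdef
    have hE : ∀ b ∈ B, b ∈ E ↔ ∃ z ∈ C, (∃ s : ℝ, |s| ≤ ((k + 1 : ℕ) : ℝ) * (2 * r) ∧ φ s x = z) ∧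
        ∃ s : ℝ, |s| ≤ r ∧ φ s b = z := by
      intro b hb
      rw [hEdef, Finset.mem_filter]
      exact ⟨fun h => h.2, fun h => ⟨hb, h⟩⟩
    have hEB : E ⊆ B := Finset.filter_subset _ _
    refine ⟨E, hEB, hE, ?_⟩
    have hmono : (∀ y ∈ C, ∃ s : ℝ, |s| ≤ (k + 1) * (2 * r) ∧ φ s x = y) →
        (∀ y ∈ C, ∃ s : ℝ, |s| ≤ (((k + 1 : ℕ) : ℝ) + 1) * (2 * r) ∧ φ s x = y) := by
      intro h y hy
      obtain ⟨s, hs, h⟩ := h y hy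
      refine ⟨s, hs.trans ?_, h⟩
      push_cast
      nlinarith
    rcases hor with h | hcard
    · exact Or.inl (hmono h)
    by_cases hc : k + 1 + 1 ≤ E.card
    · exact Or.inr hc
    left
    apply hmono
    -- points of arcs in `D` are reached in `k+1` steps
    have hreach : ∀ b ∈ D, ∀ y, (∃ s : ℝ, |s| ≤ r ∧ φ s b = y) →
        ∃ s : ℝ, |s| ≤ (k + 1) * (2 * r) ∧ φ s x = y := by
      rintro b hb y ⟨u, hu, rfl⟩
      obtain ⟨z, hz, ⟨s, hs, rfl⟩, v, hv, hvz⟩ := (hD b (hDB hb)).1 hb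
      refine ⟨u + (-v + s), ?_, ?_⟩
      · rw [abs_le] at *
        constructor <;> nlinarith
      · rw [φ.map_add, φ.map_add, ← hvz, ← φ.map_add (-v) v]
        simp
    have hDE : D ⊆ E := by
      intro b hb
      rw [hE b (hDB hb)]
      obtain ⟨z, hz, ⟨s, hs, h⟩, hv⟩ := (hD b (hDB hb)).1 hb
      refine ⟨z, hz, ⟨s, hs.trans ?_, h⟩, hv⟩
      push_cast
      nlinarith
    have hEq : D = E := Finset.eq_of_subset_of_card_le hDE (by omega)
    have hclosed : ∀ F : Finset M,
        IsClosed (⋃ b ∈ F, (fun s : ℝ => φ s b) '' Icc (-r) r) := by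
      intro F
      refine F.finite_toSet.isClosed_biUnion (fun b _ => ?_)
      refine (isCompact_Icc.image ?_).isClosed
      exact φ.continuous continuous_id continuous_const
    have hmem : ∀ (F : Finset M) (y : M),
        y ∈ (⋃ b ∈ F, (fun s : ℝ => φ s b) '' Icc (-r) r) ↔
          ∃ b ∈ F, ∃ s : ℝ, |s| ≤ r ∧ φ s b = y := by
      intro F y
      simp [abs_le]
    intro y hy
    by_contra hny
    have hDcov : ∀ a ∈ C, ∀ b ∈ B, (∃ s : ℝ, |s| ≤ r ∧ φ s b = a) → b ∈ D ∨ b ∈ B \ D := by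
      intro a _ b hb _
      by_cases h : b ∈ D
      · exact Or.inl h
      · exact Or.inr (Finset.mem_sdiff.2 ⟨hb, h⟩)
    obtain ⟨w, hwC, hw1, hw2⟩ := (isPreconnected_closed_iff.1 hC.isPreconnected) _ _
      (hclosed D) (hclosed (B \ D))
      (by
        intro a ha
        obtain ⟨b, hb, hs⟩ := hcov a ha
        rcases hDcov a ha b hb hs with h | h
        · exact Or.inl ((hmem _ _).2 ⟨b, h, hs⟩)
        · exact Or.inr ((hmem _ _).2 ⟨b, h, hs⟩))
      (by
        obtain ⟨b, hb, hs⟩ := hcov x hx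
        refine ⟨x, hx, (hmem _ _).2 ⟨b, ?_, hs⟩⟩
        rw [hD b hb]
        exact ⟨x, hx, ⟨0, by rw [abs_zero]; positivity, by simp⟩, hs⟩)
      (by
        obtain ⟨b, hb, hs⟩ := hcov y hy
        refine ⟨y, hy, (hmem _ _).2 ⟨b, ?_, hs⟩⟩
        rcases hDcov y hy b hb hs with h | h
        · exact absurd (hreach b h y hs) hny
        · exact h)
    obtain ⟨b, hb, hbs⟩ := (hmem _ _).1 hw1
    obtain ⟨c, hc, hcs⟩ := (hmem _ _).1 hw2
    rw [Finset.mem_sdiff] at hc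
    apply hc.2
    rw [hEq, hE c hc.1]
    refine ⟨w, hwC, ?_, hcs⟩
    push_cast
    exact hreach b hb w hbs

/-- Every N-expansive flow on a compact metric space is cw-expansive. -/
theorem cwExpansive_of_nExpansive
    {M : Type*} [MetricSpace M] [CompactSpace M]
    (φ : Flow ℝ M) (N : ℕ) (hN : 0 < N) (hexp : NExpansive φ N) :
    CWExpansive φ := by
  intro ε hε
  have hr : 0 < ε / (2 * (N + 2)) := by positivity
  obtain ⟨δ, hδ, H⟩ := hexp (ε / (2 * (N + 2))) hr
  refine ⟨δ, hδ, fun C α xα _ hconn hα hdiam => ?_⟩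
  obtain ⟨B, hBC, hfin, hcard, hcov⟩ := H C α xα hα hdiam
  refine ⟨xα, hα.1, ?_⟩
  have hcov' : ∀ a ∈ C, ∃ b ∈ hfin.toFinset, ∃ s : ℝ, |s| ≤ ε / (2 * (N + 2)) ∧ φ s b = a := by
    intro a ha
    obtain ⟨b, hb, s, hs, h⟩ := hcov a ha
    exact ⟨b, by simpa using hb, s, hs.le, h⟩
  obtain ⟨D, hD, -, h | h⟩ := chain_aux φ C hconn hfin.toFinset _ hr hcov' xα hα.1 N
  · intro y hy
    obtain ⟨s, hs, h⟩ := h y hy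
    refine ⟨s, hs.trans_lt ?_, h⟩
    have : ((N : ℝ) + 2) * (2 * (ε / (2 * (N + 2)))) = ε := by field_simp
    nlinarith
  · have h1 := Finset.card_le_card hD
    rw [Set.ncard_eq_toFinset_card B hfin] at hcard
    omega
end

section
/- Let (M,d) be a compact metric space, let X^t be a flow on M without fixed points, and let N > 0 be an integer. The following are equivalent: (1) X^t is N-expansive; (2) for every η > 0 there is δ > 0 such that whenever A ⊆ M and α ∈ ℋ(A) satisfy diam(𝒳^t_α(A)) < δ for all t ∈ ℝ, the set A is contained in the union of at most N orbit segments (sets of the form X^{[a,b]}(z) = {X^s(z) : a ≤ s ≤ b}), each contained in the open ball B_η(x_α); (3) for every ε > 0 there exist δ > 0 and η > 0 such that whenever A ⊆ M and β ∈ SQ*(A) satisfy β(x_β)_{i+1} − β(x_β)_i ≤ η for all i ∈ ℤ, sup_{a∈A} |β(a)_{i+1} − β(a)_i| ≤ δ for all i ∈ ℤ, and diam(𝒳^i_β(A)) < δ for all i ∈ ℤ, there is a subset B ⊆ A with at most N elements such that A ⊆ X^{(-ε,ε)}(B). -/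
open Set Metric

/-- `β` belongs to `SQ*(A)`: a family of bisequences of reals with zeroth term `0`,
indexed by points of `A`, such that `β x_β` tends to `±∞` at `±∞` for some `x_β ∈ A`,
and for each fixed `i ∈ ℤ` the map `a ↦ β a i` is continuous on `A`. -/
def MemSQ {M : Type*} [MetricSpace M] (A : Set M) (β : M → ℤ → ℝ) (xβ : M) : Prop :=
  xβ ∈ A ∧ (∀ x ∈ A, β x 0 = 0) ∧
    Filter.Tendsto (β xβ) Filter.atTop Filter.atTop ∧
    Filter.Tendsto (β xβ) Filter.atBot Filter.atBot ∧
    ∀ i : ℤ, ContinuousOn (fun a => β a i) A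

/-- Condition (2): for every `η > 0` there is `δ > 0` such that every set `A` with
`α ∈ ℋ(A)` and `diam(𝒳ᵗ_α(A)) < δ` for all `t` is contained in the union of at most `N`
orbit segments, each contained in the open ball `B_η(x_α)`. -/
def OrbitSegmentsCond {M : Type*} [MetricSpace M] (φ : Flow ℝ M) (N : ℕ) : Prop :=
  ∀ η : ℝ, 0 < η → ∃ δ : ℝ, 0 < δ ∧
    ∀ (A : Set M) (α : M → ℝ ≃ₜ ℝ) (xα : M), MemH A α xα →
      (∀ t : ℝ, Metric.diam ((fun x => φ (α x t) x) '' A) < δ) →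
      ∃ (z : Fin N → M) (a b : Fin N → ℝ),
        A ⊆ ⋃ i : Fin N, (fun s => φ s (z i)) '' Set.Icc (a i) (b i) ∧
        ∀ i : Fin N, (fun s => φ s (z i)) '' Set.Icc (a i) (b i) ⊆ Metric.ball xα η

/-- Condition (3): the discrete-sequence characterization of N-expansivity. -/
def SQCond {M : Type*} [MetricSpace M] (φ : Flow ℝ M) (N : ℕ) : Prop :=
  ∀ ε : ℝ, 0 < ε → ∃ δ : ℝ, 0 < δ ∧ ∃ η : ℝ, 0 < η ∧
    ∀ (A : Set M) (β : M → ℤ → ℝ) (xβ : M), MemSQ A β xβ →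
      (∀ i : ℤ, β xβ (i + 1) - β xβ i ≤ η) →
      (∀ i : ℤ, ∀ a ∈ A, |β a (i + 1) - β a i| ≤ δ) →
      (∀ i : ℤ, Metric.diam ((fun x => φ (β x i) x) '' A) < δ) →
      ∃ B ⊆ A, B.Finite ∧ B.ncard ≤ N ∧
        ∀ a ∈ A, ∃ b ∈ B, ∃ s : ℝ, |s| < ε ∧ φ s b = a

section Helpers

variable {M : Type*} [MetricSpace M] [CompactSpace M] (φ : Flow ℝ M)

/-- Uniform continuity of the flow on bounded times. -/
lemma aux_uc (ε : ℝ) (hε : 0 < ε) : ∃ δ : ℝ, 0 < δ ∧ ∀ (p q : M) (s r : ℝ), dist p q ≤ δ →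
    |s| ≤ 1 → |r| ≤ δ → dist (φ (s + r) p) (φ s q) < ε := by
  have hK : IsCompact (Icc (-2 : ℝ) 2 ×ˢ (univ : Set M)) := isCompact_Icc.prod isCompact_univ
  have hc : Continuous (fun z : ℝ × M => φ z.1 z.2) := φ.continuous continuous_fst continuous_snd
  have hu := hK.uniformContinuousOn_of_continuous hc.continuousOn
  rw [Metric.uniformContinuousOn_iff] at hu
  obtain ⟨δ, hδ, H⟩ := hu ε hε
  refine ⟨min (δ / 2) 1, by positivity, fun p q s r hpq hs hr => ?_⟩
  have h1 := hpq.trans (min_le_left _ _)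
  have h2 := hr.trans (min_le_left _ _)
  have h3 := hr.trans (min_le_right _ _)
  rw [abs_le] at hs h3
  refine H (s + r, p) ⟨⟨by simp only; linarith [hs.1, h3.1], by simp only; linarith [hs.2, h3.2]⟩, mem_univ _⟩ (s, q)
    ⟨⟨by simp only; linarith [hs.1], by simp only; linarith [hs.2]⟩, mem_univ _⟩ ?_
  rw [Prod.dist_eq, max_lt_iff]
  refine ⟨?_, by simp only; linarith⟩
  simp only [Real.dist_eq, add_sub_cancel_left]
  linarith

/-- No short periods. -/
lemma aux_T0 (hfix : ∀ p : M, ∃ t : ℝ, φ t p ≠ p) :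
    ∃ T : ℝ, 0 < T ∧ T ≤ 1 ∧ ∀ (s : ℝ) (q : M), s ≠ 0 → |s| ≤ T → φ s q ≠ q := by
  by_contra hcon
  push Not at hcon
  have hc : Continuous (fun z : ℝ × M => φ z.1 z.2) := φ.continuous continuous_fst continuous_snd
  have hseq : ∀ n : ℕ, ∃ s : ℝ, ∃ q : M, s ≠ 0 ∧ |s| ≤ 1 / ((n : ℝ) + 1) ∧ φ s q = q := by
    intro n
    have hn : (0:ℝ) < (n : ℝ) + 1 := by positivity
    refine hcon _ (by positivity) ?_
    rw [div_le_one hn]; linarith [(Nat.cast_nonneg n : (0:ℝ) ≤ n)]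
  choose s q hs0 hs hq using hseq
  obtain ⟨p, -, ψ, hψ, hlim⟩ := isCompact_univ.tendsto_subseq (x := q) (fun _ => mem_univ _)
  obtain ⟨t, ht⟩ := hfix p
  apply ht
  have hs' : Filter.Tendsto s Filter.atTop (nhds 0) :=
    squeeze_zero_norm hs tendsto_one_div_add_atTop_nhds_zero_nat
  -- integer multiples
  have hmul : ∀ n (m : ℕ), φ ((m : ℝ) * s n) (q n) = q n := by
    intro n m
    induction m with
    | zero => simp
    | succ m ih =>
      have : ((m + 1 : ℕ) : ℝ) * s n = (m : ℝ) * s n + s n := by push_cast; ring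
      rw [this, φ.map_add, hq, ih]
  have hmulz : ∀ n (m : ℤ), φ ((m : ℝ) * s n) (q n) = q n := by
    intro n m
    rcases Int.eq_nat_or_neg m with ⟨k, rfl | rfl⟩
    · exact_mod_cast hmul n k
    · have h := hmul n k
      conv_lhs => rw [← h]
      rw [← φ.map_add]
      have : ((-(k : ℤ) : ℤ) : ℝ) * s n + (k : ℝ) * s n = 0 := by push_cast; ring
      rw [this, φ.map_zero_apply]
  -- approximate t
  set r : ℕ → ℝ := fun n => (⌊t / s n⌋ : ℝ) * s n with hr
  have hrt : ∀ n, |r n - t| ≤ |s n| := by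
    intro n
    have h1 : r n - t = -(Int.fract (t / s n) * s n) := by
      rw [Int.fract]
      simp only [hr]
      have := hs0 n
      field_simp
      ring
    rw [h1, abs_neg, abs_mul, abs_of_nonneg (Int.fract_nonneg _)]
    have := (Int.fract_lt_one (t / s n)).le
    nlinarith [abs_nonneg (s n)]
  have hrlim : Filter.Tendsto r Filter.atTop (nhds t) := by
    rw [tendsto_iff_norm_sub_tendsto_zero]
    refine squeeze_zero (fun _ => norm_nonneg _) hrt ?_
    simpa using hs'.abs
  have hlim2 : Filter.Tendsto (fun n => φ (r (ψ n)) (q (ψ n))) Filter.atTop (nhds (φ t p)) :=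
    (hc.tendsto (t, p)).comp ((hrlim.comp hψ.tendsto_atTop).prodMk_nhds hlim)
  have heq : (fun n => φ (r (ψ n)) (q (ψ n))) = q ∘ ψ := by
    funext n; exact hmulz _ _
  rw [heq] at hlim2
  exact tendsto_nhds_unique hlim2 hlim

/-- Small displacement forces small time. -/
lemma aux_gamma (T : ℝ) (hT : ∀ (s : ℝ) (q : M), s ≠ 0 → |s| ≤ T → φ s q ≠ q)
    (τ : ℝ) (hτ : 0 < τ) :
    ∃ γ : ℝ, 0 < γ ∧ ∀ (s : ℝ) (q : M), |s| ≤ T → dist (φ s q) q ≤ γ → |s| < τ := by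
  have hc : Continuous (fun z : ℝ × M => dist (φ z.1 z.2) z.2) :=
    (φ.continuous continuous_fst continuous_snd).dist continuous_snd
  have hK : IsCompact ((Icc (-T) T ∩ {s : ℝ | τ ≤ |s|}) ×ˢ (univ : Set M)) :=
    (isCompact_Icc.inter_right (isClosed_le continuous_const continuous_abs)).prod isCompact_univ
  rcases Set.eq_empty_or_nonempty ((Icc (-T) T ∩ {s : ℝ | τ ≤ |s|}) ×ˢ (univ : Set M)) with he | hne
  · refine ⟨1, one_pos, fun s q hs _ => ?_⟩
    by_contra h
    have : (s, q) ∈ ((Icc (-T) T ∩ {s : ℝ | τ ≤ |s|}) ×ˢ (univ : Set M)) :=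
      ⟨⟨abs_le.1 hs, not_lt.1 h⟩, mem_univ _⟩
    rw [he] at this
    exact this
  · obtain ⟨⟨s0, q0⟩, hz, hmin⟩ := hK.exists_isMinOn hne hc.continuousOn
    have hs0 : s0 ≠ 0 := by
      rintro rfl
      have := hz.1.2
      simp at this
      linarith
    have hpos : 0 < dist (φ s0 q0) q0 := dist_pos.2 (hT s0 q0 hs0 (abs_le.2 hz.1.1))
    refine ⟨dist (φ s0 q0) q0 / 2, by positivity, fun s q hs hd => ?_⟩
    by_contra h
    have := hmin (show (s, q) ∈ _ from ⟨⟨abs_le.1 hs, not_lt.1 h⟩, mem_univ _⟩)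
    simp only [mem_ofPred_eq] at this
    linarith

/-- Rigidity of time matching. -/
lemma aux_rigid (T : ℝ) (hT1 : T ≤ 1)
    (hT : ∀ (s : ℝ) (q : M), s ≠ 0 → |s| ≤ T → φ s q ≠ q) (τ : ℝ) (hτ : 0 < τ) :
    ∃ δ : ℝ, 0 < δ ∧ ∀ (p q : M) (u v : ℝ), |u| ≤ T / 2 → |v| ≤ T / 2 → dist p q ≤ δ →
      dist (φ u p) (φ v q) ≤ δ → |v - u| < τ := by
  obtain ⟨γ, hγ, H⟩ := aux_gamma φ T hT τ hτ
  obtain ⟨δ, hδ, H2⟩ := aux_uc φ (γ / 2) (by positivity)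
  refine ⟨min δ (γ / 2), by positivity, fun p q u v hu hv hpq hd => ?_⟩
  have h1 := H2 p q u 0 (hpq.trans (min_le_left _ _)) (by linarith [abs_nonneg u]) (by simpa using hδ.le)
  rw [add_zero] at h1
  have h2 := hd.trans (min_le_right _ _)
  refine H (v - u) (φ u q) ?_ ?_
  · have := abs_sub v u
    linarith
  · rw [← φ.map_add, sub_add_cancel]
    have := dist_triangle (φ v q) (φ u p) (φ u q)
    rw [dist_comm (φ v q) (φ u p)] at this
    linarith

/-- Combinatorial backtracking argument. -/
lemma aux_back (u v : ℤ → ℝ) (C D E : ℝ) (hDE : D ≤ E)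
    (hu : ∀ i, |u (i + 1) - u i| ≤ C) (hv : ∀ i, |v (i + 1) - v i| ≤ D)
    (hR : ∀ i j, |u j - u i| ≤ C → |v j - v i| ≤ E → |v j - v i| ≤ D) (h3 : 3 * D ≤ E) :
    ∀ (n : ℕ) (i : ℤ), |u (i + n) - u i| ≤ C → |v (i + n) - v i| ≤ D := by
  intro n
  induction n using Nat.strong_induction_on with
  | _ n ih =>
    intro i hin
    have hD : 0 ≤ D := (abs_nonneg _).trans (hv 0)
    rcases Nat.lt_or_ge n 2 with hn | hn
    · interval_cases n
      · simpa using hD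
      · simpa using hv i
    obtain ⟨m, rfl⟩ : ∃ m, n = m + 2 := ⟨n - 2, by omega⟩
    by_cases hex : ∃ k : ℕ, 0 < k ∧ k < m + 2 ∧ |u (i + k) - u i| ≤ C ∧
        |u (i + (m + 2 : ℕ)) - u (i + k)| ≤ C
    · obtain ⟨k, hk0, hk, h1, h2⟩ := hex
      have e1 := ih k hk i h1
      have e : (i + k : ℤ) + ((m + 2 - k : ℕ) : ℤ) = i + (m + 2 : ℕ) := by
        push_cast [Nat.cast_sub hk.le]; ring
      have e2 := ih (m + 2 - k) (by omega) (i + k) (by rw [e]; exact h2)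
      rw [e] at e2
      apply hR _ _ hin
      have := abs_sub_le (v (i + (m + 2 : ℕ))) (v (i + k)) (v i)
      linarith
    · push Not at hex
      set j : ℤ := i + (m + 2 : ℕ) with hj
      -- inner endpoints
      have hu0 := hu i
      have hu1 := hu (i + ((m + 1 : ℕ) : ℤ))
      have ej : i + ((m + 1 : ℕ) : ℤ) + 1 = j := by rw [hj]; push_cast; ring
      rw [ej] at hu1
      have hv0 := hv i
      have hv1 := hv (i + ((m + 1 : ℕ) : ℤ))
      rw [ej] at hv1
      have key : |u (i + 1 + (m : ℕ)) - u (i + 1)| ≤ C := by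
        have hout : ∀ k : ℕ, 0 < k → k < m + 2 →
            (u i + C < u (i + k) ∨ u j + C < u (i + k)) ∨
            (u (i + k) < u i - C ∨ u (i + k) < u j - C) := by
          intro k hk0 hk
          by_contra hno
          push Not at hno
          obtain ⟨⟨a1, a2⟩, a3, a4⟩ := hno
          have := hex k hk0 hk (abs_le.2 ⟨by linarith, by linarith⟩)
          rw [lt_abs] at this
          rcases this with h | h <;> linarith
        rw [abs_le] at hin hu0 hu1
        have e1 : i + 1 + (m : ℤ) = i + ((m + 1 : ℕ) : ℤ) := by push_cast; ring
        rw [e1]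
        have up : (u i + C < u (i + 1) ∨ u j + C < u (i + 1)) → ∀ k : ℕ, k < m + 1 →
            (u i + C < u (i + ((k + 1 : ℕ) : ℤ)) ∨ u j + C < u (i + ((k + 1 : ℕ) : ℤ))) := by
          intro h0 k
          induction k with
          | zero => intro _; simpa using h0
          | succ k ihk =>
            intro hk
            have h1 := ihk (by omega)
            have h2 := hu (i + ((k + 1 : ℕ) : ℤ))
            have e2 : i + ((k + 1 : ℕ) : ℤ) + 1 = i + ((k + 1 + 1 : ℕ) : ℤ) := by push_cast; ring
            rw [e2, abs_le] at h2
            rcases hout (k + 1 + 1) (by omega) (by omega) with h | h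
            · exact h
            · exfalso
              rcases h with h | h <;> rcases h1 with h1 | h1 <;> linarith [hin.1, hin.2, h2.1, h2.2]
        have dn : (u (i + 1) < u i - C ∨ u (i + 1) < u j - C) → ∀ k : ℕ, k < m + 1 →
            (u (i + ((k + 1 : ℕ) : ℤ)) < u i - C ∨ u (i + ((k + 1 : ℕ) : ℤ)) < u j - C) := by
          intro h0 k
          induction k with
          | zero => intro _; simpa using h0
          | succ k ihk =>
            intro hk
            have h1 := ihk (by omega)
            have h2 := hu (i + ((k + 1 : ℕ) : ℤ))
            have e2 : i + ((k + 1 : ℕ) : ℤ) + 1 = i + ((k + 1 + 1 : ℕ) : ℤ) := by push_cast; ring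
            rw [e2, abs_le] at h2
            rcases hout (k + 1 + 1) (by omega) (by omega) with h | h
            · exfalso
              rcases h with h | h <;> rcases h1 with h1 | h1 <;> linarith [hin.1, hin.2, h2.1, h2.2]
            · exact h
        have h0 := hout 1 one_pos (by omega)
        simp only [Nat.cast_one] at h0
        rw [abs_le]
        rcases h0 with h0 | h0
        · have h1 := up h0 m (by omega)
          rcases h0 with h0 | h0 <;> rcases h1 with h1 | h1 <;>
            exact ⟨by linarith [hin.1, hin.2, hu0.1, hu0.2, hu1.1, hu1.2],
              by linarith [hin.1, hin.2, hu0.1, hu0.2, hu1.1, hu1.2]⟩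
        · have h1 := dn h0 m (by omega)
          rcases h0 with h0 | h0 <;> rcases h1 with h1 | h1 <;>
            exact ⟨by linarith [hin.1, hin.2, hu0.1, hu0.2, hu1.1, hu1.2],
              by linarith [hin.1, hin.2, hu0.1, hu0.2, hu1.1, hu1.2]⟩
      have e3 := ih m (by omega) (i + 1) key
      have e1 : i + 1 + (m : ℤ) = i + ((m + 1 : ℕ) : ℤ) := by push_cast; ring
      rw [e1] at e3
      apply hR _ _ hin
      have t1 := abs_sub_le (v j) (v (i + ((m + 1 : ℕ) : ℤ))) (v i)
      have t2 := abs_sub_le (v (i + ((m + 1 : ℕ) : ℤ))) (v (i + 1)) (v i)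
      linarith

lemma aux_back' (u v : ℤ → ℝ) (C D E : ℝ) (hDE : D ≤ E)
    (hu : ∀ i, |u (i + 1) - u i| ≤ C) (hv : ∀ i, |v (i + 1) - v i| ≤ D)
    (hR : ∀ i j, |u j - u i| ≤ C → |v j - v i| ≤ E → |v j - v i| ≤ D) (h3 : 3 * D ≤ E)
    (i j : ℤ) (hij : |u j - u i| ≤ C) : |v j - v i| ≤ D := by
  rcases le_total i j with h | h
  · obtain ⟨n, rfl⟩ := Int.le.dest h
    exact aux_back u v C D E hDE hu hv hR h3 n i hij
  · obtain ⟨n, rfl⟩ := Int.le.dest h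
    rw [abs_sub_comm] at hij ⊢
    exact aux_back u v C D E hDE hu hv hR h3 n j hij

/-- Discrete intermediate value. -/
lemma aux_ivt (u : ℤ → ℝ) (c : ℝ) (hu : ∀ i, |u (i + 1) - u i| ≤ c)
    (ht : Filter.Tendsto u Filter.atTop Filter.atTop)
    (hb : Filter.Tendsto u Filter.atBot Filter.atBot) (y : ℝ) : ∃ i, |u i - y| ≤ c := by
  obtain ⟨n, hn⟩ := (hb.eventually (Filter.eventually_lt_atBot y)).exists
  obtain ⟨m, hm, hnm⟩ := ((ht.eventually (Filter.eventually_ge_atTop y)).and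
    (Filter.eventually_ge_atTop n)).exists
  obtain ⟨k, rfl⟩ := Int.le.dest hnm
  have hex : ∃ k : ℕ, y ≤ u (n + k) := ⟨k, hm⟩
  classical
  have h1 := Nat.find_spec hex
  have h2 : Nat.find hex ≠ 0 := by
    intro h0
    rw [h0] at h1
    simp at h1
    linarith
  obtain ⟨l, hl⟩ := Nat.exists_eq_succ_of_ne_zero h2
  have h3 := Nat.find_min hex (m := l) (by omega)
  rw [hl] at h1
  have h4 := hu (n + l)
  have e : n + (l : ℤ) + 1 = n + ((l.succ : ℕ) : ℤ) := by push_cast; ring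
  rw [e, abs_le] at h4
  refine ⟨n + ((l.succ : ℕ) : ℤ), abs_le.2 ⟨?_, ?_⟩⟩ <;> linarith [h4.1, h4.2]

/-- Piecewise linear interpolation. -/
noncomputable def pl (h : ℝ) (w : ℤ → ℝ) (t : ℝ) : ℝ :=
  w ⌊t / h⌋ + Int.fract (t / h) * (w (⌊t / h⌋ + 1) - w ⌊t / h⌋)

lemma pl_strictMono (h : ℝ) (hh : 0 < h) (w : ℤ → ℝ) (hw : ∀ k, w k < w (k + 1)) :
    StrictMono (pl h w) := by
  have hm : StrictMono w := strictMono_int_of_lt_succ hw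
  intro x y hxy
  have hd : x / h < y / h := div_lt_div_of_pos_right hxy hh
  unfold pl
  rcases (Int.floor_mono hd.le).eq_or_lt with he | hl
  · have hf : Int.fract (x / h) < Int.fract (y / h) := by
      unfold Int.fract; rw [he]; linarith
    rw [← he]
    have := hw ⌊x / h⌋
    nlinarith
  · have h1 : w (⌊x / h⌋ + 1) ≤ w ⌊y / h⌋ := hm.monotone (by omega)
    have h2 := hw ⌊x / h⌋
    have h3 := hw ⌊y / h⌋
    nlinarith [Int.fract_lt_one (x / h), Int.fract_nonneg (y / h)]

lemma pl_surj (h : ℝ) (hh : 0 < h) (w : ℤ → ℝ) (hw : ∀ k, w k + h / 2 ≤ w (k + 1)) :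
    Function.Surjective (pl h w) := by
  intro y
  have hup : ∀ n : ℕ, w 0 + n * (h / 2) ≤ w n := by
    intro n
    induction n with
    | zero => simp
    | succ n ih => have := hw n; push_cast; linarith
  have hdn : ∀ n : ℕ, w (-n) ≤ w 0 - n * (h / 2) := by
    intro n
    induction n with
    | zero => simp
    | succ n ih =>
      have := hw (-((n + 1 : ℕ) : ℤ))
      have e : -((n + 1 : ℕ) : ℤ) + 1 = -(n : ℤ) := by push_cast; ring
      rw [e] at this; push_cast at this ⊢; linarith
  obtain ⟨n, hn⟩ := exists_nat_gt ((w 0 - y) / (h / 2))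
  obtain ⟨m, hm⟩ := exists_nat_gt ((y - w 0) / (h / 2))
  rw [div_lt_iff₀ (by positivity)] at hn hm
  have hex : ∃ k : ℤ, w k ≤ y := ⟨-n, by linarith [hdn n]⟩
  have hmono : StrictMono w := strictMono_int_of_lt_succ (fun k => by linarith [hw k])
  obtain ⟨k, hk, hmax⟩ := Int.exists_greatest_of_bdd (P := fun k => w k ≤ y)
    ⟨m, fun z hz => by
      by_contra hlt
      have := hmono (not_le.1 hlt)
      linarith [hup m]⟩ hex
  have hk1 : y < w (k + 1) := by
    by_contra hle
    have := hmax (k + 1) (not_lt.1 hle)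
    omega
  have hpos : 0 < w (k + 1) - w k := by linarith
  set θ := (y - w k) / (w (k + 1) - w k) with hθ
  have hθ0 : 0 ≤ θ := div_nonneg (by linarith) hpos.le
  have hθ1 : θ < 1 := by rw [hθ, div_lt_one hpos]; linarith
  refine ⟨(k + θ) * h, ?_⟩
  have e1 : (k + θ) * h / h = k + θ := by field_simp
  have e2 : ⌊(k : ℝ) + θ⌋ = k := by
    rw [Int.floor_eq_iff]; constructor <;> linarith
  unfold pl
  rw [e1, Int.fract, e2, hθ]
  field_simp
  ring

lemma pl_homeo (h : ℝ) (hh : 0 < h) (w : ℤ → ℝ) (hw : ∀ k, w k + h / 2 ≤ w (k + 1)) :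
    ∃ f : ℝ ≃ₜ ℝ, ∀ t, f t = pl h w t :=
  ⟨(StrictMono.orderIsoOfSurjective (pl h w)
    (pl_strictMono h hh w (fun k => by linarith [hw k])) (pl_surj h hh w hw)).toHomeomorph,
    fun _ => rfl⟩

lemma aux_dist {A : Set M} (f : M → M) {x y : M} (hx : x ∈ A) (hy : y ∈ A) {δ : ℝ}
    (h : Metric.diam (f '' A) < δ) : dist (f x) (f y) < δ :=
  (Metric.dist_le_diam_of_mem (Metric.isBounded_of_compactSpace)
    (mem_image_of_mem f hx) (mem_image_of_mem f hy)).trans_lt h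

lemma aux_12 (N : ℕ) (hN : 0 < N) (H : NExpansive φ N) : OrbitSegmentsCond φ N := by
  intro η hη
  obtain ⟨ε, hε, Hε⟩ := aux_uc φ (η / 2) (by positivity)
  obtain ⟨δ, hδ, Hδ⟩ := H ε hε
  refine ⟨min δ (η / 2), by positivity, fun A α xα hα hd => ?_⟩
  obtain ⟨B, hBA, hBf, hBc, hB⟩ := Hδ A α xα hα (fun t => (hd t).trans_le (min_le_left _ _))
  obtain ⟨b0, hb0, -⟩ := hB xα hα.1
  have : Nonempty B := ⟨⟨b0, hb0⟩⟩
  have : Finite B := hBf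
  have hcard : Nat.card B ≤ Nat.card (Fin N) := by
    rw [Nat.card_fin]; exact hBc
  obtain ⟨e⟩ : Nonempty (B ↪ Fin N) := by
    have := Fintype.ofFinite B
    apply Function.Embedding.nonempty_of_card_le
    rwa [← Nat.card_eq_fintype_card, ← Nat.card_eq_fintype_card]
  have hsurj : Function.Surjective (Function.invFun e) := Function.invFun_surjective e.injective
  refine ⟨fun i => (Function.invFun e i : B), fun _ => -ε, fun _ => ε, ?_, ?_⟩
  · intro a ha
    obtain ⟨b, hb, s, hs, rfl⟩ := hB a ha
    obtain ⟨i, hi⟩ := hsurj ⟨b, hb⟩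
    refine mem_iUnion.2 ⟨i, s, ⟨(abs_lt.1 hs).1.le, (abs_lt.1 hs).2.le⟩, ?_⟩
    simp [hi]
  · rintro i _ ⟨s, hs, rfl⟩
    set b := Function.invFun e i
    have h1 := Hε b b 0 s (by simpa using hε.le) (by simp) (abs_le.2 hs)
    rw [zero_add, φ.map_zero_apply] at h1
    have h2 := aux_dist (fun x => φ (α x 0) x) (hBA b.2) hα.1 (hd 0)
    simp only [hα.2.2.1 _ (hBA b.2), hα.2.2.1 _ hα.1, φ.map_zero_apply] at h2
    have h3 := h2.trans_le (min_le_right _ _)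
    have := dist_triangle (φ s b) b xα
    simp only [mem_ball]
    linarith

lemma aux_21 (hfix : ∀ p : M, ∃ t : ℝ, φ t p ≠ p) (N : ℕ) (H : OrbitSegmentsCond φ N) :
    NExpansive φ N := by
  intro ε hε
  obtain ⟨T, hT0, hT1, hT⟩ := aux_T0 φ hfix
  obtain ⟨γ, hγ, Hγ⟩ := aux_gamma φ T hT (min ε T) (by positivity)
  obtain ⟨δ, hδ, Hδ⟩ := H (γ / 2) (by positivity)
  refine ⟨δ, hδ, fun A α xα hα hd => ?_⟩
  obtain ⟨z, a, b, hA, hball⟩ := Hδ A α xα hα hd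
  have hlen : ∀ i, b i - a i < ε := by
    intro i
    by_contra hle
    push Not at hle
    set τ := min ε T
    have hτ : 0 < τ := by positivity
    have hτε : τ ≤ ε := min_le_left _ _
    have hτT : τ ≤ T := min_le_right _ _
    have h1 := hball i ⟨a i, ⟨le_rfl, by linarith⟩, rfl⟩
    have h2 := hball i ⟨τ + a i, ⟨by linarith, by linarith⟩, rfl⟩
    simp only [mem_ball, φ.map_add] at h1 h2
    have h3 := dist_triangle_right (φ τ (φ (a i) (z i))) (φ (a i) (z i)) xα
    have := Hγ τ (φ (a i) (z i)) (by rwa [abs_of_pos hτ]) (by linarith)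
    rw [abs_of_pos hτ] at this
    exact lt_irrefl _ this
  classical
  let S : Fin N → Set M := fun i => (fun s => φ s (z i)) '' Set.Icc (a i) (b i)
  let g : Fin N → M := fun i => if h : (A ∩ S i).Nonempty then h.some else xα
  refine ⟨range g, ?_, finite_range g, ?_, ?_⟩
  · rintro _ ⟨i, rfl⟩
    simp only [g]
    split_ifs with h
    · exact h.some_mem.1
    · exact hα.1
  · have := Set.ncard_image_le (f := g) (finite_univ (α := Fin N))
    rw [image_univ, ncard_univ, Nat.card_fin] at this
    exact this
  · intro x hx
    obtain ⟨i, hi⟩ := mem_iUnion.1 (hA hx)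
    have hne : (A ∩ S i).Nonempty := ⟨x, hx, hi⟩
    refine ⟨g i, ⟨i, rfl⟩, ?_⟩
    have hg : g i = hne.some := by simp only [g]; rw [dif_pos hne]
    obtain ⟨s', hs', he'⟩ := hne.some_mem.2
    obtain ⟨s, hs, rfl⟩ := hi
    refine ⟨s - s', ?_, ?_⟩
    · have := hlen i
      rw [abs_lt]
      constructor <;> linarith [hs.1, hs.2, hs'.1, hs'.2]
    · rw [hg, ← he']
      simp only
      rw [← φ.map_add, sub_add_cancel]

lemma aux_31 (hfix : ∀ p : M, ∃ t : ℝ, φ t p ≠ p) (N : ℕ) (H : SQCond φ N) :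
    NExpansive φ N := by
  intro ε hε
  obtain ⟨T, hT0, hT1, hT⟩ := aux_T0 φ hfix
  obtain ⟨δ, hδ, η, hη, Hδ⟩ := H ε hε
  set τ := min δ T with hτdef
  have hτ : 0 < τ := by positivity
  obtain ⟨γ, hγ, Hγ⟩ := aux_gamma φ T hT τ hτ
  obtain ⟨κ, hκ, Hκ⟩ := aux_uc φ (γ / 4) (by positivity)
  set h := min η κ with hh
  have hpos : 0 < h := by positivity
  refine ⟨min δ (γ / 4), by positivity, fun A α xα hα hd => ?_⟩
  have hstep : ∀ a ∈ A, ∀ t : ℝ, |α a (t + h) - α a t| ≤ δ := by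
    intro a ha t
    by_contra hcon
    push Not at hcon
    have hτδ : τ ≤ δ := min_le_left _ _
    have hcont : ContinuousOn (fun s => |α a (t + s) - α a t|) (Icc 0 h) := by
      have := (α a).continuous
      fun_prop
    obtain ⟨s, hs, hse⟩ := intermediate_value_Icc hpos.le hcont
      (show τ ∈ Icc _ _ from ⟨by simpa using hτ.le, by linarith⟩)
    simp only at hse
    set r := α a (t + s) - α a t with hr
    have h1 := (aux_dist (fun x => φ (α x t) x) ha hα.1 (hd t)).trans_le (min_le_right _ _)
    have h2 := (aux_dist (fun x => φ (α x (t + s)) x) ha hα.1 (hd (t + s))).trans_le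
      (min_le_right _ _)
    simp only [hα.2.1] at h1 h2
    have h3 := Hκ (φ t xα) (φ t xα) 0 s (by simpa using hκ.le) (by simp)
      (by rw [abs_of_nonneg hs.1]; exact hs.2.trans (min_le_right _ _))
    rw [zero_add, φ.map_zero_apply, ← φ.map_add, add_comm s t] at h3
    have e : φ (α a (t + s)) a = φ r (φ (α a t) a) := by
      rw [← φ.map_add, hr, sub_add_cancel]
    rw [e] at h2
    have h4 := dist_triangle4 (φ r (φ (α a t) a)) (φ (t + s) xα) (φ t xα) (φ (α a t) a)
    rw [dist_comm (φ t xα) (φ (α a t) a)] at h4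
    have := Hγ r (φ (α a t) a) (by rw [hse]; exact min_le_right _ _) (by linarith)
    rw [hse] at this
    exact lt_irrefl _ this
  refine Hδ A (fun a i => α a (i * h)) xα ⟨hα.1, ?_, ?_, ?_, ?_⟩ ?_ ?_ ?_
  · intro x hx
    simp [hα.2.2.1 x hx]
  · simp only [hα.2.1]
    exact (tendsto_intCast_atTop_atTop (R := ℝ)).atTop_mul_const hpos
  · simp only [hα.2.1]
    exact (tendsto_intCast_atBot_iff.2 Filter.tendsto_id : Filter.Tendsto (fun n : ℤ => (n : ℝ)) Filter.atBot Filter.atBot).atBot_mul_const hpos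
  · intro i
    exact hα.2.2.2 _
  · intro i
    simp only [hα.2.1]
    push_cast
    have : h ≤ η := min_le_left _ _
    linarith
  · intro i a ha
    have := hstep a ha (i * h)
    have e : ((i + 1 : ℤ) : ℝ) * h = i * h + h := by push_cast; ring
    simp only [e]
    exact this
  · intro i
    exact (hd _).trans_le (min_le_left _ _)

lemma aux_13 (hfix : ∀ p : M, ∃ t : ℝ, φ t p ≠ p) (N : ℕ) (H : NExpansive φ N) :
    SQCond φ N := by
  intro ε hε
  obtain ⟨T, hT0, hT1, hT⟩ := aux_T0 φ hfix
  obtain ⟨δ₁, hδ₁, Hδ₁⟩ := H ε hε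
  obtain ⟨κ, hκ, Hκ⟩ := aux_uc φ (δ₁ / 4) (by positivity)
  set h := T / 100 with hh
  have hpos : 0 < h := by positivity
  set τ := min κ (h / 2) with hτdef
  have hτ : 0 < τ := by positivity
  have hτκ : τ ≤ κ := min_le_left _ _
  have hτh : τ ≤ h / 2 := min_le_right _ _
  obtain ⟨ρ, hρ, Hρ⟩ := aux_rigid φ T hT1 hT τ hτ
  set δ := min (min ρ κ) h with hδdef
  have hδ : 0 < δ := by positivity
  have hδρ : δ ≤ ρ := (min_le_left _ _).trans (min_le_left _ _)
  have hδκ : δ ≤ κ := (min_le_left _ _).trans (min_le_right _ _)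
  have hδh : δ ≤ h := min_le_right _ _
  refine ⟨δ, hδ, 1, one_pos, fun A β xβ hβ _ hstep hd => ?_⟩
  obtain ⟨hxA, h0, htop, hbot, hcont⟩ := hβ
  -- closeness
  have hclose : ∀ a ∈ A, ∀ i, dist (φ (β xβ i) xβ) (φ (β a i) a) ≤ δ := fun a ha i =>
    (aux_dist (fun x => φ (β x i) x) hxA ha (hd i)).le
  -- rigidity along index pairs
  have hrig : ∀ a ∈ A, ∀ i j, |β xβ j - β xβ i| ≤ T / 2 → |β a j - β a i| ≤ T / 2 →
      |(β a j - β a i) - (β xβ j - β xβ i)| < τ := by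
    intro a ha i j hu hv
    refine Hρ (φ (β xβ i) xβ) (φ (β a i) a) _ _ hu hv ((hclose a ha i).trans hδρ) ?_
    rw [← φ.map_add, ← φ.map_add, sub_add_cancel, sub_add_cancel]
    exact (hclose a ha j).trans hδρ
  have hback : ∀ a ∈ A, ∀ i j, |β xβ j - β xβ i| ≤ 3 * h → 
      |(β a j - β a i) - (β xβ j - β xβ i)| < τ := by
    intro a ha i j hij
    have hb := aux_back' (β xβ) (β a) (3 * h) (4 * h) (T / 2) (by linarith)
      (fun i => (hstep i xβ hxA).trans (by linarith)) (fun i => (hstep i a ha).trans (by linarith))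
      (fun i j hu hv => by
        have h1 := hrig a ha i j (by linarith) hv
        have h2 := abs_add_le ((β a j - β a i) - (β xβ j - β xβ i)) (β xβ j - β xβ i)
        rw [sub_add_cancel] at h2
        linarith) (by linarith) i j hij
    exact hrig a ha i j (by linarith) (by linarith)
  -- index selection
  have hidx : ∀ k : ℤ, ∃ i : ℤ, |β xβ i - k * h| ≤ h ∧ (k = 0 → i = 0) := by
    intro k
    by_cases hk : k = 0
    · subst hk
      refine ⟨0, ?_, fun _ => rfl⟩
      simp [h0 xβ hxA, hpos.le]
    · obtain ⟨i, hi⟩ := aux_ivt (β xβ) h (fun i => (hstep i xβ hxA).trans hδh) htop hbot (k * h)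
      exact ⟨i, hi, fun h => absurd h hk⟩
  choose I hI hI0 using hidx
  let w : M → ℤ → ℝ := fun a k => β a (I k) - β xβ (I k) + k * h
  have hw : ∀ a ∈ A, ∀ k, |w a (k + 1) - w a k - h| < τ := by
    intro a ha k
    have h1 := hI k
    have h2 := hI (k + 1)
    have h3 : |β xβ (I (k + 1)) - β xβ (I k)| ≤ 3 * h := by
      push_cast at h2
      rw [abs_le] at h1 h2 ⊢
      constructor <;> linarith [h1.1, h1.2, h2.1, h2.2]
    have h4 := hback a ha (I k) (I (k + 1)) h3
    have e : w a (k + 1) - w a k - h =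
        (β a (I (k + 1)) - β a (I k)) - (β xβ (I (k + 1)) - β xβ (I k)) := by
      simp only [w]; push_cast; ring
    rw [e]; exact h4
  have hwm : ∀ a ∈ A, ∀ k, w a k + h / 2 ≤ w a (k + 1) := by
    intro a ha k
    have := (abs_lt.1 (hw a ha k)).1
    linarith
  have hα : ∀ a, ∃ f : ℝ ≃ₜ ℝ, a ∈ A → ∀ t, f t = pl h (w a) t := by
    intro a
    by_cases ha : a ∈ A
    · obtain ⟨f, hf⟩ := pl_homeo h hpos (w a) (hwm a ha)
      exact ⟨f, fun _ => hf⟩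
    · exact ⟨Homeomorph.refl ℝ, fun h => absurd h ha⟩
  choose α hα using hα
  have hfl : ∀ t : ℝ, (⌊t / h⌋ : ℝ) * h + Int.fract (t / h) * h = t := by
    intro t
    rw [← add_mul, Int.floor_add_fract]
    field_simp
  refine Hδ₁ A α xβ ⟨hxA, ?_, ?_, ?_⟩ ?_
  · intro t
    rw [hα xβ hxA]
    have := hfl t
    simp only [pl, w]
    push_cast
    linarith
  · intro a ha
    rw [hα a ha]
    simp [pl, w, hI0 0 rfl, h0 a ha, h0 xβ hxA]
  · intro t
    have : ContinuousOn (fun x => pl h (w x) t) A := by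
      have h1 := hcont (I ⌊t / h⌋)
      have h2 := hcont (I (⌊t / h⌋ + 1))
      simp only [pl, w]
      fun_prop
    exact this.congr (fun x hx => hα x hx t)
  · intro t
    have hd' : ∀ a ∈ A, dist (φ (α a t) a) (φ t xβ) ≤ δ₁ / 4 := by
      intro a ha
      set k := ⌊t / h⌋ with hk
      set θ := Int.fract (t / h) with hθ
      have hθ0 : 0 ≤ θ := Int.fract_nonneg _
      have hθ1 : θ ≤ 1 := (Int.fract_lt_one _).le
      have ht := hfl t
      have hIk := hI k
      have hwk := hw a ha k
      have e1 : α a t = ((t - β xβ (I k)) + θ * (w a (k + 1) - w a k - h)) + β a (I k) := by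
        rw [hα a ha]
        simp only [pl, ← hk, ← hθ]
        have : w a k = β a (I k) - β xβ (I k) + k * h := rfl
        linarith
      have e2 : φ t xβ = φ (t - β xβ (I k)) (φ (β xβ (I k)) xβ) := by
        rw [← φ.map_add, sub_add_cancel]
      rw [e1, e2, φ.map_add]
      refine (Hκ _ _ _ _ ?_ ?_ ?_).le
      · rw [dist_comm]
        exact (hclose a ha _).trans hδκ
      · have : θ * h ≤ h := by nlinarith
        have : 0 ≤ θ * h := by positivity
        rw [abs_le] at hIk ⊢
        constructor <;> linarith [hIk.1, hIk.2]
      · rw [abs_mul, abs_of_nonneg hθ0]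
        nlinarith [abs_nonneg (w a (k + 1) - w a k - h)]
    have : Metric.diam ((fun x => φ (α x t) x) '' A) ≤ δ₁ / 2 := by
      refine Metric.diam_le_of_forall_dist_le (by positivity) ?_
      rintro _ ⟨x, hx, rfl⟩ _ ⟨y, hy, rfl⟩
      have := dist_triangle_right (φ (α x t) x) (φ (α y t) y) (φ t xβ)
      have := hd' x hx
      have := hd' y hy
      simp only
      linarith
    linarith

end Helpers

/-- For a fixed-point-free flow on a compact metric space, N-expansivity, the orbit-segment
condition and the discrete-sequence condition are all equivalent. -/
theorem nExpansive_tfae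
    {M : Type*} [MetricSpace M] [CompactSpace M]
    (φ : Flow ℝ M) (hfix : ∀ p : M, ∃ t : ℝ, φ t p ≠ p)
    (N : ℕ) (hN : 0 < N) :
    (NExpansive φ N ↔ OrbitSegmentsCond φ N) ∧ (NExpansive φ N ↔ SQCond φ N) := by
  exact ⟨⟨aux_12 φ N hN, aux_21 φ hfix N⟩, ⟨aux_13 φ hfix N, aux_31 φ hfix N⟩⟩
end

section
/- Let (M,d) be a compact metric space, let X^t be a flow on M without fixed points, and let N > 0 be an integer. If X^t is N-expansive, then for every ε > 0 there exist δ > 0 and η > 0 such that whenever A ⊆ M and β ∈ SQ*(A) satisfy β(x_β)_{i+1} − β(x_β)_i ≤ η for all i ∈ ℤ, sup_{a∈A} |β(a)_{i+1} − β(a)_i| ≤ δ for all i ∈ ℤ, and diam(𝒳^i_β(A)) < η for all i ∈ ℤ, there is a subset B ⊆ A with at most N elements such that A ⊆ X^{(-ε,ε)}(B). -/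
open Set Metric

open Filter Topology

/-- Discrete intermediate value: the last index at level at most `c`. -/
lemma sq_cross (l : ℤ → ℤ) (hl : ∀ i, |l (i + 1) - l i| ≤ 1)
    (ht : Tendsto l atTop atTop) (hb : Tendsto l atBot atBot) (c : ℤ) :
    ∃ j, l j = c ∧ l (j + 1) = c + 1 := by
  obtain ⟨b, hb'⟩ := (hb.eventually (eventually_le_atBot c)).exists
  obtain ⟨K, hK⟩ := (eventually_atTop.1 (ht.eventually (eventually_gt_atTop c)))
  obtain ⟨j, hj, hj'⟩ := Int.exists_greatest_of_bdd (P := fun z => l z ≤ c)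
    ⟨K, fun z hz => by
      by_contra h
      have := hK z (by omega)
      omega⟩ ⟨b, hb'⟩
  have h1 : ¬ l (j + 1) ≤ c := fun h => by
    have := hj' _ h
    omega
  have h2 := abs_le.1 (hl j)
  refine ⟨j, ?_, ?_⟩ <;> omega

lemma sq_ivt (l : ℤ → ℤ) (hl : ∀ i, |l (i + 1) - l i| ≤ 1) (c : ℤ) (i : ℤ) (n : ℕ)
    (h1 : l i ≤ c) (h2 : c ≤ l (i + n)) : ∃ m, i ≤ m ∧ m ≤ i + n ∧ l m = c := by
  induction n with
  | zero => exact ⟨i, le_rfl, by simp, by simp at h2; omega⟩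
  | succ n ih =>
    by_cases h : c ≤ l (i + n)
    · obtain ⟨m, a, b, d⟩ := ih h
      exact ⟨m, a, by push_cast; omega, d⟩
    · have h3 := abs_le.1 (hl (i + n))
      have e : i + ((n + 1 : ℕ) : ℤ) = i + n + 1 := by push_cast; ring
      rw [e] at h2
      exact ⟨i + n + 1, by omega, by push_cast; omega, by omega⟩

lemma sq_ivt' (l : ℤ → ℤ) (hl : ∀ i, |l (i + 1) - l i| ≤ 1) (c : ℤ) (i : ℤ) (n : ℕ)
    (h1 : c ≤ l i) (h2 : l (i + n) ≤ c) : ∃ m, i ≤ m ∧ m ≤ i + n ∧ l m = c := by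
  obtain ⟨m, a, b, d⟩ := sq_ivt (fun i => - l i) (fun i => by
    have := abs_le.1 (hl i)
    exact abs_le.2 ⟨by omega, by omega⟩) (-c) i n (by simpa using h1) (by simpa using h2)
  exact ⟨m, a, b, by simpa using d⟩

lemma sq_comb (l : ℤ → ℤ) (hl : ∀ i, |l (i + 1) - l i| ≤ 1) (g : ℤ → ℝ) (κ : ℝ) (hκ : 0 < κ)
    (ha : ∀ i, |g (i + 1) - g i| ≤ κ)
    (hb : ∀ i k, l i = l k → |g k - g i| ≤ 3 * κ → |g k - g i| ≤ κ) (n : ℕ) :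
    ∀ i, l i = l (i + n) → |g (i + n) - g i| ≤ κ := by
  induction n using Nat.strong_induction_on with
  | _ n ih =>
    intro i h
    rcases Nat.lt_or_ge n 2 with hn | hn
    · interval_cases n
      · simp [hκ.le]
      · simpa using ha i
    · by_cases hj : ∃ j, i < j ∧ j < i + n ∧ l j = l i
      · obtain ⟨j, h1, h2, h3⟩ := hj
        obtain ⟨a, rfl⟩ : ∃ a : ℕ, j = i + a := ⟨(j - i).toNat, by omega⟩
        obtain ⟨b, rfl⟩ : ∃ b : ℕ, n = a + b := ⟨n - a, by omega⟩
        have e : i + ((a + b : ℕ) : ℤ) = i + a + b := by push_cast; ring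
        rw [e] at h ⊢
        have A := abs_le.1 (ih a (by omega) i h3.symm)
        have B := abs_le.1 (ih b (by omega) (i + a) (by omega))
        refine hb _ _ h (abs_le.2 ⟨?_, ?_⟩) <;> linarith [A.1, A.2, B.1, B.2]
      · obtain ⟨b, rfl⟩ : ∃ b : ℕ, n = b + 2 := ⟨n - 2, by omega⟩
        have e : i + ((b + 2 : ℕ) : ℤ) = i + 1 + b + 1 := by push_cast; ring
        rw [e] at h hj ⊢
        push Not at hj
        have s1 := abs_le.1 (hl i)
        have s2 := abs_le.1 (hl (i + 1 + b))
        have n1 := hj (i + 1) (by omega) (by omega)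
        have n2 := hj (i + 1 + b) (by omega) (by omega)
        have key : l (i + 1) = l (i + 1 + b) := by
          by_contra hne
          rcases lt_or_gt_of_ne n1 with h4 | h4
          · obtain ⟨m, a1, a2, a3⟩ := sq_ivt l hl (l i) (i + 1) b (by omega) (by omega)
            exact hj m (by omega) (by omega) a3
          · obtain ⟨m, a1, a2, a3⟩ := sq_ivt' l hl (l i) (i + 1) b (by omega) (by omega)
            exact hj m (by omega) (by omega) a3
        have A := abs_le.1 (ih b (by omega) (i + 1) key)
        have B := abs_le.1 (ha i)
        have C := abs_le.1 (ha (i + 1 + b))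
        refine hb _ _ h (abs_le.2 ⟨?_, ?_⟩) <;> linarith [A.1, A.2, B.1, B.2, C.1, C.2]

lemma sq_comb' (l : ℤ → ℤ) (hl : ∀ i, |l (i + 1) - l i| ≤ 1) (g : ℤ → ℝ) (κ : ℝ) (hκ : 0 < κ)
    (ha : ∀ i, |g (i + 1) - g i| ≤ κ)
    (hb : ∀ i k, l i = l k → |g k - g i| ≤ 3 * κ → |g k - g i| ≤ κ) (i k : ℤ) (h : l i = l k) :
    |g k - g i| ≤ κ := by
  rcases le_total i k with hik | hik
  · obtain ⟨a, rfl⟩ : ∃ a : ℕ, k = i + a := ⟨(k - i).toNat, by omega⟩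
    exact sq_comb l hl g κ hκ ha hb a i h
  · obtain ⟨a, rfl⟩ : ∃ a : ℕ, i = k + a := ⟨(i - k).toNat, by omega⟩
    rw [abs_sub_comm]
    exact sq_comb l hl g κ hκ ha hb a k h.symm

/-- Piecewise linear interpolation of a bisequence. -/
noncomputable def sqInterp (U : ℤ → ℝ) (x : ℝ) : ℝ :=
  U ⌊x⌋ + Int.fract x * (U (⌊x⌋ + 1) - U ⌊x⌋)

lemma sqInterp_strictMono (U : ℤ → ℝ) (hU : ∀ i, U i < U (i + 1)) : StrictMono (sqInterp U) := by
  have hm : StrictMono U := strictMono_int_of_lt_succ hU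
  intro x y hxy
  unfold sqInterp
  rcases (Int.floor_mono hxy.le).eq_or_lt with h | h
  · have : Int.fract x < Int.fract y := by
      rw [Int.fract, Int.fract, h]; linarith
    rw [h]
    have := mul_lt_mul_of_pos_right this (sub_pos.2 (hU ⌊y⌋))
    linarith
  · have h1 := hm.monotone (show ⌊x⌋ + 1 ≤ ⌊y⌋ by omega)
    have h2 := mul_lt_mul_of_pos_right (Int.fract_lt_one x) (sub_pos.2 (hU ⌊x⌋))
    have h3 := mul_nonneg (Int.fract_nonneg y) (sub_pos.2 (hU ⌊y⌋)).le
    linarith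

lemma sqInterp_surj (U : ℤ → ℝ) (σ : ℝ) (hσ : 0 < σ) (hU : ∀ i, U i + σ ≤ U (i + 1)) :
    Function.Surjective (sqInterp U) := by
  have hm : StrictMono U := strictMono_int_of_lt_succ (fun i => by linarith [hU i])
  have hup : ∀ n : ℕ, U 0 + n * σ ≤ U n := by
    intro n
    induction n with
    | zero => simp
    | succ n ih => have := hU n; push_cast; linarith
  have hdn : ∀ n : ℕ, U (-n) ≤ U 0 - n * σ := by
    intro n
    induction n with
    | zero => simp
    | succ n ih =>
      have := hU (-(n + 1))
      rw [show -((n : ℤ) + 1) + 1 = -n by ring] at this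
      push_cast; linarith
  intro t
  obtain ⟨a, ha⟩ := exists_nat_gt ((t - U 0) / σ)
  obtain ⟨b, hb⟩ := exists_nat_gt ((U 0 - t) / σ)
  rw [div_lt_iff₀ hσ] at ha hb
  obtain ⟨j, hj, hj'⟩ := Int.exists_greatest_of_bdd (P := fun z => U z ≤ t)
    ⟨a, fun z hz => by
      by_contra h
      have := hm.monotone (show (a : ℤ) ≤ z by omega)
      linarith [hup a]⟩ ⟨-b, by linarith [hdn b]⟩
  have h1 : t < U (j + 1) := by
    by_contra h
    have := hj' (j + 1) (not_lt.1 h)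
    omega
  have hpos : 0 < U (j + 1) - U j := by linarith [hU j]
  have f0 : 0 ≤ (t - U j) / (U (j + 1) - U j) := div_nonneg (by linarith) hpos.le
  have f1 : (t - U j) / (U (j + 1) - U j) < 1 := by rw [div_lt_one hpos]; linarith
  refine ⟨j + (t - U j) / (U (j + 1) - U j), ?_⟩
  have hf : ⌊(j : ℝ) + (t - U j) / (U (j + 1) - U j)⌋ = j := by
    rw [Int.floor_eq_iff]; constructor <;> linarith
  rw [sqInterp, Int.fract, hf]
  field_simp
  ring

noncomputable def sqHomeo (U : ℤ → ℝ) (σ : ℝ) (hσ : 0 < σ) (hU : ∀ i, U i + σ ≤ U (i + 1)) :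
    ℝ ≃ₜ ℝ :=
  ((sqInterp_strictMono U (fun i => by linarith [hU i])).orderIsoOfSurjective _
    (sqInterp_surj U σ hσ hU)).toHomeomorph

lemma sqHomeo_apply (U : ℤ → ℝ) (σ : ℝ) (hσ : 0 < σ) (hU : ∀ i, U i + σ ≤ U (i + 1)) (x : ℝ) :
    sqHomeo U σ hσ hU x = sqInterp U x := rfl

section
variable {M : Type*} [MetricSpace M] [CompactSpace M] (φ : Flow ℝ M)

lemma sq_period_int {x : M} {s : ℝ} (h : φ s x = x) (k : ℤ) : φ (k * s) x = x := by
  have hn : ∀ n : ℕ, φ (n * s) x = x := by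
    intro n
    induction n with
    | zero => simp
    | succ n ih =>
      rw [show ((n + 1 : ℕ) : ℝ) * s = n * s + s by push_cast; ring, φ.map_add, h, ih]
  rcases Int.eq_nat_or_neg k with ⟨n, rfl | rfl⟩
  · simpa using hn n
  · have : φ (-(n * s)) (φ (n * s) x) = x := by rw [← φ.map_add]; simp
    rw [hn n] at this
    simpa using this

lemma sq_noPeriod (hfix : ∀ p : M, ∃ t : ℝ, φ t p ≠ p) :
    ∃ T : ℝ, 0 < T ∧ ∀ s : ℝ, s ≠ 0 → |s| ≤ T → ∀ x, φ s x ≠ x := by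
  have key : ∀ᶠ s : ℝ in 𝓝 0, ∀ x ∈ (univ : Set M), s ≠ 0 → φ s x ≠ x := by
    apply isCompact_univ.eventually_forall_of_forall_eventually
    intro p _
    obtain ⟨t, ht⟩ := hfix p
    have hc : ContinuousAt (fun z : ℝ × M => (φ t z.2, φ z.1 z.2)) (0, p) := by
      apply Continuous.continuousAt
      exact (φ.continuous continuous_const continuous_snd).prodMk
        (φ.continuous continuous_fst continuous_snd)
    have ho : {w : M × M | w.1 ≠ w.2} ∈ 𝓝 (φ t p, φ 0 p) :=
      (isOpen_ne_fun continuous_fst continuous_snd).mem_nhds (by simpa using ht)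
    have h1 := hc.eventually ho
    rw [nhds_prod_eq, eventually_prod_iff] at h1
    obtain ⟨pa, hpa, pb, hpb, hab⟩ := h1
    obtain ⟨r, hr, hr'⟩ := Metric.eventually_nhds_iff.1 hpa
    rw [nhds_prod_eq, eventually_prod_iff]
    refine ⟨fun s => |s| < r, Metric.eventually_nhds_iff.2 ⟨r, hr, fun y hy => by
      simpa [Real.dist_eq] using hy⟩, pb, hpb, ?_⟩
    intro s hs x hx h0 hper
    have hrem : pa (Int.fract (t / s) * s) := by
      apply hr'
      rw [Real.dist_eq, sub_zero, abs_mul, abs_of_nonneg (Int.fract_nonneg _)]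
      have := mul_le_mul_of_nonneg_right (Int.fract_lt_one (t / s)).le (abs_nonneg s)
      linarith
    apply hab hrem hx
    have e : t = Int.fract (t / s) * s + ⌊t / s⌋ * s := by
      rw [← add_mul, Int.fract_add_floor, div_mul_cancel₀ _ h0]
    show φ t x = φ (Int.fract (t / s) * s) x
    conv_lhs => rw [e, φ.map_add, sq_period_int φ hper]
  obtain ⟨r, hr, h⟩ := Metric.eventually_nhds_iff.1 key
  refine ⟨r / 2, by linarith, fun s hs hs' x => h ?_ x (mem_univ _) hs⟩
  rw [Real.dist_eq, sub_zero]; linarith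

lemma sq_displace (T : ℝ) (hT : ∀ s : ℝ, s ≠ 0 → |s| ≤ T → ∀ x : M, φ s x ≠ x)
    (κ : ℝ) (hκ : 0 < κ) :
    ∃ ρ : ℝ, 0 < ρ ∧ ∀ s : ℝ, |s| ≤ T → ∀ x, dist (φ s x) x < ρ → |s| < κ := by
  have hc : Continuous (fun z : ℝ × M => dist (φ z.1 z.2) z.2) :=
    (φ.continuous continuous_fst continuous_snd).dist continuous_snd
  have hcomp : IsCompact ((Icc (-T) T ∩ {s : ℝ | κ ≤ |s|}) ×ˢ (univ : Set M)) :=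
    (isCompact_Icc.inter_right (isClosed_le continuous_const continuous_abs)).prod isCompact_univ
  rcases ((Icc (-T) T ∩ {s : ℝ | κ ≤ |s|}) ×ˢ (univ : Set M)).eq_empty_or_nonempty with he | hne
  · refine ⟨1, one_pos, fun s hs x _ => ?_⟩
    by_contra h
    have : (s, x) ∈ ((Icc (-T) T ∩ {s : ℝ | κ ≤ |s|}) ×ˢ (univ : Set M)) :=
      ⟨⟨abs_le.1 hs, not_lt.1 h⟩, mem_univ _⟩
    rw [he] at this
    exact this
  · obtain ⟨z, hz, hmin⟩ := hcomp.exists_isMinOn hne hc.continuousOn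
    refine ⟨dist (φ z.1 z.2) z.2, dist_pos.2 (hT _ ?_ (abs_le.2 hz.1.1) _), fun s hs x hx => ?_⟩
    · intro h0
      have : κ ≤ |z.1| := hz.1.2
      rw [h0, abs_zero] at this
      linarith
    · by_contra h
      have := hmin (show (s, x) ∈ _ from ⟨⟨abs_le.1 hs, not_lt.1 h⟩, mem_univ _⟩)
      simp only [mem_setOf_eq] at this
      linarith

lemma sq_smallTime (e : ℝ) (he : 0 < e) :
    ∃ τ : ℝ, 0 < τ ∧ ∀ s : ℝ, |s| ≤ τ → ∀ x : M, dist (φ s x) x ≤ e := by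
  have hc : Continuous (fun z : ℝ × M => dist (φ z.1 z.2) z.2) :=
    (φ.continuous continuous_fst continuous_snd).dist continuous_snd
  have key : ∀ᶠ s : ℝ in 𝓝 0, ∀ x ∈ (univ : Set M), dist (φ s x) x < e := by
    apply isCompact_univ.eventually_forall_of_forall_eventually
    intro p _
    exact (hc.tendsto (0, p)).eventually (gt_mem_nhds (by simpa using he))
  obtain ⟨r, hr, h⟩ := Metric.eventually_nhds_iff.1 key
  refine ⟨r / 2, by linarith, fun s hs x => (h ?_ x (mem_univ _)).le⟩
  rw [Real.dist_eq, sub_zero]; linarith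

lemma sq_unif (σ e : ℝ) (he : 0 < e) :
    ∃ η : ℝ, 0 < η ∧ ∀ s : ℝ, |s| ≤ σ → ∀ x y : M, dist x y < η →
      dist (φ s x) (φ s y) < e := by
  have hc : Continuous (fun z : ℝ × M => φ z.1 z.2) := φ.continuous continuous_fst continuous_snd
  have hu := (isCompact_Icc (a := -σ) (b := σ)).prod (isCompact_univ (X := M))
    |>.uniformContinuousOn_of_continuous hc.continuousOn
  obtain ⟨η, h0, h⟩ := Metric.uniformContinuousOn_iff.1 hu e he
  refine ⟨η, h0, fun s hs x y hxy => ?_⟩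
  exact h (s, x) ⟨abs_le.1 hs, mem_univ _⟩ (s, y) ⟨abs_le.1 hs, mem_univ _⟩
    (by simpa [Prod.dist_eq, h0] using hxy)

end

/-- If a fixed-point-free flow on a compact metric space is N-expansive, then for every
`ε > 0` there are `δ > 0` and `η > 0` such that every set `A` with `β ∈ SQ*(A)` whose
steps `β(x_β)_{i+1} − β(x_β)_i` are at most `η`, whose steps over `A` are uniformly at
most `δ`, and with `diam(𝒳ⁱ_β(A)) < η` for all `i ∈ ℤ`, is contained in `X^{(-ε,ε)}(B)`
for some `B ⊆ A` with at most `N` points. -/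
theorem sqCond_of_nExpansive
    {M : Type*} [MetricSpace M] [CompactSpace M]
    (φ : Flow ℝ M) (hfix : ∀ p : M, ∃ t : ℝ, φ t p ≠ p)
    (N : ℕ) (hN : 0 < N) (hexp : NExpansive φ N) :
    ∀ ε : ℝ, 0 < ε → ∃ δ : ℝ, 0 < δ ∧ ∃ η : ℝ, 0 < η ∧
      ∀ (A : Set M) (β : M → ℤ → ℝ) (xβ : M), MemSQ A β xβ →
        (∀ i : ℤ, β xβ (i + 1) - β xβ i ≤ η) →
        (∀ i : ℤ, ∀ a ∈ A, |β a (i + 1) - β a i| ≤ δ) →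
        (∀ i : ℤ, Metric.diam ((fun x => φ (β x i) x) '' A) < η) →
        ∃ B ⊆ A, B.Finite ∧ B.ncard ≤ N ∧
          ∀ a ∈ A, ∃ b ∈ B, ∃ s : ℝ, |s| < ε ∧ φ s b = a := by
  classical
  intro ε hε
  obtain ⟨e, he, hE⟩ := hexp ε hε
  obtain ⟨T, hT0, hT⟩ := sq_noPeriod φ hfix
  obtain ⟨τ, hτ0, hτ⟩ := sq_smallTime φ (e / 6) (by positivity)
  obtain ⟨σ, hσ, hσT, hστ⟩ : ∃ σ : ℝ, 0 < σ ∧ 2 * σ ≤ T ∧ 5 * σ ≤ τ :=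
    ⟨min (T / 2) (τ / 5), by positivity, by linarith [min_le_left (T / 2) (τ / 5)],
      by linarith [min_le_right (T / 2) (τ / 5)]⟩
  obtain ⟨κ, hκ, hκσ⟩ : ∃ κ : ℝ, 0 < κ ∧ 9 * κ = σ := ⟨σ / 9, by positivity, by ring⟩
  obtain ⟨ρ, hρ, hρ'⟩ := sq_displace φ T hT κ hκ
  obtain ⟨η₁, hη₁, hu⟩ := sq_unif φ σ (ρ / 2) (by positivity)
  refine ⟨σ, hσ, min η₁ (min (ρ / 2) (e / 6)), by positivity, ?_⟩
  rintro A β xβ ⟨hxA, h0, htop, hbot, hcont⟩ - hstep hdiam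
  have hd : ∀ i, ∀ a ∈ A, ∀ b ∈ A, dist (φ (β a i) a) (φ (β b i) b) <
      min η₁ (min (ρ / 2) (e / 6)) := fun i a ha b hb =>
    (Metric.dist_le_diam_of_mem (Bornology.IsBounded.subset isCompact_univ.isBounded (subset_univ _))
      (mem_image_of_mem (fun x => φ (β x i) x) ha)
      (mem_image_of_mem (fun x => φ (β x i) x) hb)).trans_lt (hdiam i)
  have hd1 : ∀ i, ∀ a ∈ A, ∀ b ∈ A, dist (φ (β a i) a) (φ (β b i) b) < η₁ :=
    fun i a ha b hb => (hd i a ha b hb).trans_le (min_le_left _ _)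
  have hd2 : ∀ i, ∀ a ∈ A, ∀ b ∈ A, dist (φ (β a i) a) (φ (β b i) b) < ρ / 2 :=
    fun i a ha b hb => (hd i a ha b hb).trans_le ((min_le_right _ _).trans (min_le_left _ _))
  have hd3 : ∀ i, ∀ a ∈ A, ∀ b ∈ A, dist (φ (β a i) a) (φ (β b i) b) < e / 6 :=
    fun i a ha b hb => (hd i a ha b hb).trans_le ((min_le_right _ _).trans (min_le_right _ _))
  -- improvement step
  have himp : ∀ a ∈ A, ∀ i k, |β xβ k - β xβ i| ≤ σ →
      |(β a k - β xβ k) - (β a i - β xβ i)| ≤ T →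
      |(β a k - β xβ k) - (β a i - β xβ i)| ≤ κ := by
    intro a ha i k h1 h2
    refine (hρ' _ h2 (φ (β xβ k - β xβ i) (φ (β a i) a)) ?_).le
    have e1 : φ ((β a k - β xβ k) - (β a i - β xβ i)) (φ (β xβ k - β xβ i) (φ (β a i) a))
        = φ (β a k) a := by
      rw [← φ.map_add, ← φ.map_add]; congr 1; ring
    have e2 : φ (β xβ k - β xβ i) (φ (β xβ i) xβ) = φ (β xβ k) xβ := by
      rw [← φ.map_add]; congr 1; ring
    have h3 := hu _ h1 _ _ (hd1 i xβ hxA a ha)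
    rw [e2] at h3
    rw [e1]
    linarith [dist_triangle (φ (β a k) a) (φ (β xβ k) xβ) (φ (β xβ k - β xβ i) (φ (β a i) a)),
      hd2 k a ha xβ hxA]
  -- levels
  let l : ℤ → ℤ := fun i => ⌊β xβ i / σ⌋
  have hl1 : ∀ i, (l i : ℝ) * σ ≤ β xβ i := fun i => by
    have := Int.floor_le (β xβ i / σ)
    rwa [le_div_iff₀ hσ] at this
  have hl2 : ∀ i, β xβ i < (l i : ℝ) * σ + σ := fun i => by
    have := Int.lt_floor_add_one (β xβ i / σ)
    rw [div_lt_iff₀ hσ] at this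
    linarith
  have hl : ∀ i, |l (i + 1) - l i| ≤ 1 := by
    intro i
    have hs := abs_le.1 (hstep i xβ hxA)
    have a1 : l (i + 1) < l i + 2 := by
      have : (l (i + 1) : ℝ) < l i + 2 := by
        by_contra h
        have := mul_le_mul_of_nonneg_right (not_lt.1 h) hσ.le
        linarith [hl1 (i + 1), hl2 i]
      exact_mod_cast this
    have a2 : l i < l (i + 1) + 2 := by
      have : (l i : ℝ) < l (i + 1) + 2 := by
        by_contra h
        have := mul_le_mul_of_nonneg_right (not_lt.1 h) hσ.le
        linarith [hl1 i, hl2 (i + 1)]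
      exact_mod_cast this
    exact abs_le.2 ⟨by omega, by omega⟩
  have hltop : Tendsto l atTop atTop :=
    tendsto_floor_atTop.comp (htop.atTop_div_const hσ)
  have hlbot : Tendsto l atBot atBot :=
    tendsto_floor_atBot.comp (hbot.atBot_div_const hσ)
  choose c hc1 hc2 using sq_cross l hl hltop hlbot
  -- drift
  have hga : ∀ a ∈ A, ∀ i, |(β a (i + 1) - β xβ (i + 1)) - (β a i - β xβ i)| ≤ κ := by
    intro a ha i
    have s1 := abs_le.1 (hstep i a ha)
    have s2 := abs_le.1 (hstep i xβ hxA)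
    exact himp a ha i (i + 1) (hstep i xβ hxA) (abs_le.2 ⟨by linarith, by linarith⟩)
  have hg : ∀ a ∈ A, ∀ i k, l i = l k → |(β a k - β xβ k) - (β a i - β xβ i)| ≤ κ := by
    intro a ha i k hik
    refine sq_comb' l hl (fun i => β a i - β xβ i) κ hκ (hga a ha) ?_ i k hik
    intro i k hik h3
    refine himp a ha i k ?_ (h3.trans (by linarith))
    have := hl1 i
    have := hl2 i
    have := hl1 k
    have := hl2 k
    rw [hik] at *
    exact abs_le.2 ⟨by linarith, by linarith⟩
  obtain ⟨n, hn0, hn⟩ : ∃ n : ℤ → ℤ, n 0 = 0 ∧ ∀ j, l (n j) = j := by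
    refine ⟨fun j => if j = 0 then 0 else c j, by simp, fun j => ?_⟩
    by_cases hj : j = 0
    · simp [hj, l, h0 xβ hxA]
    · simp [hj, hc1]
  have hnstep : ∀ a ∈ A, ∀ j,
      |(β a (n (j + 1)) - β xβ (n (j + 1))) - (β a (n j) - β xβ (n j))| ≤ 3 * κ := by
    intro a ha j
    have s1 := abs_le.1 (hg a ha (n j) (c j) (by rw [hn, hc1]))
    have s2 := abs_le.1 (hga a ha (c j))
    have s3 := abs_le.1 (hg a ha (c j + 1) (n (j + 1)) (by rw [hn, hc2]))
    exact abs_le.2 ⟨by linarith [s1.1, s2.1, s3.1], by linarith [s1.2, s2.2, s3.2]⟩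
  let V : M → ℤ → ℝ := fun a j => β a (n (3 * j))
  have hV : ∀ a ∈ A, ∀ j, V a j + σ ≤ V a (j + 1) ∧ V a (j + 1) ≤ V a j + 5 * σ := by
    intro a ha j
    have s1 := abs_le.1 (hnstep a ha (3 * j))
    have s2 := abs_le.1 (hnstep a ha (3 * j + 1))
    have s3 := abs_le.1 (hnstep a ha (3 * j + 1 + 1))
    have t1 := hl1 (n (3 * j))
    have t2 := hl2 (n (3 * j))
    have t3 := hl1 (n (3 * j + 1 + 1 + 1))
    have t4 := hl2 (n (3 * j + 1 + 1 + 1))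
    rw [hn] at t1 t2 t3 t4
    push_cast at t1 t2 t3 t4
    simp only [V]
    rw [show 3 * (j + 1) = 3 * j + 1 + 1 + 1 by ring]
    constructor
    · linarith [s1.1, s2.1, s3.1]
    · linarith [s1.2, s2.2, s3.2]
  let H : ℝ ≃ₜ ℝ := sqHomeo (V xβ) σ hσ (fun j => (hV xβ hxA j).1)
  let α : M → ℝ ≃ₜ ℝ := fun a =>
    if ha : a ∈ A then H.symm.trans (sqHomeo (V a) σ hσ (fun j => (hV a ha j).1))
    else Homeomorph.refl ℝ
  have hα : ∀ a ∈ A, ∀ t, α a t = sqInterp (V a) (H.symm t) := by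
    intro a ha t
    simp only [α, dif_pos ha]
    rfl
  have hV0 : ∀ a ∈ A, sqInterp (V a) 0 = 0 := by
    intro a ha
    simp [sqInterp, V, hn0, h0 a ha]
  apply hE A α xβ
  · refine ⟨hxA, ?_, ?_, ?_⟩
    · intro t
      rw [hα _ hxA]
      exact H.apply_symm_apply t
    · intro a ha
      have : H.symm 0 = 0 := by
        rw [Homeomorph.symm_apply_eq]
        exact (hV0 xβ hxA).symm
      rw [hα a ha, this, hV0 a ha]
    · intro t
      refine ContinuousOn.congr (f := fun a => sqInterp (V a) (H.symm t)) ?_ (fun a ha => hα a ha t)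
      unfold sqInterp
      exact (hcont _).add (continuousOn_const.mul ((hcont _).sub (hcont _)))
  · intro t
    have hmove : ∀ a ∈ A, dist (φ (α a t) a) (φ (V a ⌊H.symm t⌋) a) ≤ e / 6 := by
      intro a ha
      have hv := hV a ha ⌊H.symm t⌋
      have f0 := Int.fract_nonneg (H.symm t)
      have f1 := (Int.fract_lt_one (H.symm t)).le
      have e1 : φ (α a t) a = φ (Int.fract (H.symm t) * (V a (⌊H.symm t⌋ + 1) - V a ⌊H.symm t⌋))
          (φ (V a ⌊H.symm t⌋) a) := by
        rw [hα a ha, ← φ.map_add, sqInterp, add_comm]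
      rw [e1]
      apply hτ
      have hp : 0 ≤ V a (⌊H.symm t⌋ + 1) - V a ⌊H.symm t⌋ := by linarith
      rw [abs_of_nonneg (mul_nonneg f0 hp)]
      have := mul_le_mul_of_nonneg_right f1 hp
      linarith
    refine (Metric.diam_le_of_forall_dist_le (C := e / 2) (by positivity) ?_).trans_lt (by linarith)
    rintro _ ⟨a, ha, rfl⟩ _ ⟨b, hb, rfl⟩
    have m1 := hmove a ha
    have m2 := hmove b hb
    have m3 : dist (φ (V a ⌊H.symm t⌋) a) (φ (V b ⌊H.symm t⌋) b) < e / 6 := hd3 _ a ha b hb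
    rw [dist_comm] at m2
    show dist (φ (α a t) a) (φ (α b t) b) ≤ e / 2
    linarith [dist_triangle4 (φ (α a t) a) (φ (V a ⌊H.symm t⌋) a) (φ (V b ⌊H.symm t⌋) b)
      (φ (α b t) b)]
end

section
/- Let (M,d) be a compact metric space, let X^t be a flow on M without fixed points, and let N > 0 be an integer. Suppose that for every ε > 0 there exist δ > 0 and η > 0 such that whenever A ⊆ M is compact and β ∈ SQ*(A) satisfies β(x_β)_{i+1} − β(x_β)_i ≤ η for all i ∈ ℤ, sup_{a∈A} |β(a)_{i+1} − β(a)_i| ≤ δ for all i ∈ ℤ, and diam(𝒳^i_β(A)) < δ for all i ∈ ℤ, there is a subset B ⊆ A with at most N elements such that A ⊆ X^{(-ε,ε)}(B). Then X^t is N-expansive. -/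
open Set Metric

open Filter Topology

lemma flow_contPair {M : Type*} [MetricSpace M] (φ : Flow ℝ M) :
    Continuous (fun z : ℝ × M => φ z.1 z.2) :=
  φ.continuous continuous_fst continuous_snd

/-- Some arbitrarily small time is not a period of any point. -/
lemma exists_small_nonperiod {M : Type*} [MetricSpace M] [CompactSpace M]
    (φ : Flow ℝ M) (hfix : ∀ p : M, ∃ t : ℝ, φ t p ≠ p) (δ : ℝ) (hδ : 0 < δ) :
    ∃ r : ℝ, 0 < r ∧ r ≤ δ ∧ ∀ x : M, φ r x ≠ x := by
  by_contra! hcon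
  have h1 : ∀ n : ℕ, ∃ x : M, φ (δ / ((n : ℝ) + 1)) x = x := by
    intro n
    have hn : (0 : ℝ) < (n : ℝ) + 1 := by positivity
    apply hcon _ (by positivity)
    rw [div_le_iff₀ hn]
    nlinarith [(Nat.cast_nonneg n : (0 : ℝ) ≤ n)]
  choose x hx using h1
  obtain ⟨p, k, hk, hlim⟩ := CompactSpace.tendsto_subseq x
  obtain ⟨t, ht⟩ := hfix p
  apply ht
  set s : ℕ → ℝ := fun n => δ / ((k n : ℝ) + 1) with hs
  have hspos : ∀ n, 0 < s n := fun n => by simp only [hs]; positivity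
  have hs0 : Tendsto s atTop (𝓝 0) := by
    have h : Tendsto (fun n : ℕ => δ / ((n : ℝ) + 1)) atTop (𝓝 0) :=
      tendsto_const_nhds.div_atTop
        (tendsto_atTop_add_const_right _ _ tendsto_natCast_atTop_atTop)
    exact h.comp hk.tendsto_atTop
  have hnat : ∀ (n m : ℕ), φ ((m : ℝ) * s n) (x (k n)) = x (k n) := by
    intro n m
    induction m with
    | zero => simp
    | succ m ih =>
      have : ((m + 1 : ℕ) : ℝ) * s n = m * s n + s n := by push_cast; ring
      rw [this, φ.map_add, hx (k n), ih]
  have hint : ∀ (n : ℕ) (m : ℤ), φ ((m : ℝ) * s n) (x (k n)) = x (k n) := by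
    intro n m
    obtain ⟨j, rfl | rfl⟩ := m.eq_nat_or_neg
    · simpa using hnat n j
    · have h := congrArg (φ (-((j : ℝ) * s n))) (hnat n j)
      rw [← φ.map_add] at h
      simp only [neg_add_cancel, φ.map_zero_apply] at h
      push_cast
      rw [neg_mul]
      exact h.symm
  have hfl : Tendsto (fun n => (⌊t / s n⌋ : ℝ) * s n) atTop (𝓝 t) := by
    have hl : Tendsto (fun n => t - s n) atTop (𝓝 t) := by
      simpa using tendsto_const_nhds.sub hs0
    refine tendsto_of_tendsto_of_tendsto_of_le_of_le hl tendsto_const_nhds ?_ ?_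
    · intro n
      have h := Int.sub_one_lt_floor (t / s n)
      have h2 := mul_lt_mul_of_pos_right h (hspos n)
      have h3 : (t / s n - 1) * s n = t - s n := by
        have := (hspos n).ne'
        field_simp
      simp only
      linarith
    · intro n
      have h := mul_le_mul_of_nonneg_right (Int.floor_le (t / s n)) (hspos n).le
      rwa [div_mul_cancel₀ _ (hspos n).ne'] at h
  have hc := ((flow_contPair φ).tendsto (t, p)).comp (hfl.prodMk_nhds hlim)
  refine tendsto_nhds_unique hc ?_
  refine hlim.congr ?_
  intro n
  simp only [Function.comp]
  exact (hint n _).symm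

/-- Step control: `s` moves little along short time intervals. -/
lemma step_control {M : Type*} [MetricSpace M] [CompactSpace M]
    (φ : Flow ℝ M) (hfix : ∀ p : M, ∃ t : ℝ, φ t p ≠ p) (δ : ℝ) (hδ : 0 < δ) :
    ∃ δ' : ℝ, 0 < δ' ∧ ∃ η₀ : ℝ, 0 < η₀ ∧ ∀ (x y : M) (s : ℝ → ℝ) (u v : ℝ), Continuous s →
      u ≤ v → v - u ≤ η₀ → (∀ t, dist (φ t x) (φ (s t) y) < δ') → |s v - s u| ≤ δ := by
  obtain ⟨r, hr0, hrδ, hr⟩ := exists_small_nonperiod φ hfix δ hδ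
  have hcr : Continuous (fun x : M => dist (φ r x) x) :=
    (φ.continuous continuous_const continuous_id).dist continuous_id
  obtain ⟨c, hc0, hc⟩ := isCompact_univ.exists_forall_le' (a := (0 : ℝ)) hcr.continuousOn
    (fun b _ => dist_pos.2 (hr b))
  have hev : ∀ᶠ t : ℝ in 𝓝 0, ∀ x ∈ (univ : Set M), dist (φ t x) x < c / 3 := by
    apply isCompact_univ.eventually_forall_of_forall_eventually
    intro x _
    have hcont : Continuous (fun z : ℝ × M => dist (φ z.1 z.2) z.2) :=
      (flow_contPair φ).dist continuous_snd
    have := hcont.tendsto (0, x)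
    simp only [φ.map_zero_apply, dist_self] at this
    first
      | exact this.eventually_lt_const (by positivity)
      | (rw [nhds_prod_eq] at this; exact this.eventually_lt_const (by positivity))
  obtain ⟨e, he0, he⟩ := Metric.eventually_nhds_iff.1 hev
  refine ⟨c / 3, by positivity, e / 2, by positivity, ?_⟩
  intro x y s u v hs huv hvu hd
  by_contra! hlt
  have hf : ContinuousOn (fun t => |s t - s u|) (Icc u v) := by fun_prop
  have hmem : r ∈ Icc ((fun t => |s t - s u|) u) ((fun t => |s t - s u|) v) := by
    simp only [sub_self, abs_zero]
    exact ⟨hr0.le, by linarith⟩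
  obtain ⟨t, ⟨ht1, ht2⟩, ht⟩ := intermediate_value_Icc huv hf hmem
  have hxx : dist (φ t x) (φ u x) < c / 3 := by
    have := he (y := t - u) (by
      rw [Real.dist_eq, sub_zero, abs_of_nonneg (by linarith)]; linarith) (φ u x) (mem_univ _)
    rwa [← φ.map_add, sub_add_cancel] at this
  have hsmall : dist (φ (s t) y) (φ (s u) y) < c := by
    have h1 := hd t
    have h2 := hd u
    have h3 := dist_triangle4 (φ (s t) y) (φ t x) (φ u x) (φ (s u) y)
    rw [dist_comm (φ (s t) y) (φ t x)] at h3
    linarith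
  simp only at ht
  rcases (abs_eq hr0.le).1 ht with h | h
  · have := hc (φ (s u) y) (mem_univ _)
    rw [← φ.map_add, show r + s u = s t by linarith] at this
    linarith
  · have := hc (φ (s t) y) (mem_univ _)
    rw [← φ.map_add, show r + s t = s u by linarith, dist_comm] at this
    linarith

/-- If every finite subset is covered by `N` orbit pieces, so is the whole set (of double size). -/
lemma cover_of_finite {M : Type*} [MetricSpace M] (φ : Flow ℝ M) (N : ℕ) (A : Set M) (x₀ : M)
    (hx₀ : x₀ ∈ A) (ε : ℝ)
    (h : ∀ F : Set M, F ⊆ A → F.Finite → x₀ ∈ F → ∃ B ⊆ F, B.Finite ∧ B.ncard ≤ N ∧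
      ∀ a ∈ F, ∃ b ∈ B, ∃ s : ℝ, |s| < ε / 2 ∧ φ s b = a) :
    ∃ B ⊆ A, B.Finite ∧ B.ncard ≤ N ∧ ∀ a ∈ A, ∃ b ∈ B, ∃ s : ℝ, |s| < ε ∧ φ s b = a := by
  classical
  let P : Finset M → Prop := fun S => (S : Set M) ⊆ A ∧
    ∀ a ∈ S, ∀ b ∈ S, a ≠ b → ∀ s : ℝ, |s| < ε → φ s b ≠ a
  have hcard : ∀ S, P S → S.card ≤ N := by
    rintro S ⟨hSA, hS⟩
    obtain ⟨B, -, hBf, hBN, hB⟩ := h (insert x₀ (S : Set M))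
      (insert_subset hx₀ hSA) (S.finite_toSet.insert _) (mem_insert _ _)
    have hB' : ∀ a ∈ S, ∃ b ∈ B, ∃ s : ℝ, |s| < ε / 2 ∧ φ s b = a :=
      fun a ha => hB a (mem_insert_of_mem _ ha)
    choose! f hfB s hsε hs using hB'
    refine le_trans ?_ hBN
    rw [Set.ncard_eq_toFinset_card B hBf]
    apply Finset.card_le_card_of_injOn f
    · intro a ha
      simpa using hfB a ha
    · intro a ha b hb hab
      by_contra hne
      apply hS a ha b hb hne (s a - s b)
      · have h1 := hsε a ha
        have h2 := hsε b hb
        have := abs_sub (s a) (s b)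
        linarith
      · have e1 : φ (s a - s b) (φ (s b) (f b)) = a := by
          rw [← φ.map_add, sub_add_cancel, ← hab, hs a ha]
        rwa [hs b hb] at e1
  have hex : ∃ S, P S ∧ ∀ T, P T → T.card ≤ S.card := by
    have hne : ∃ n, ∃ S, P S ∧ S.card = n := ⟨0, ∅, by simp [P], rfl⟩
    have hle : ∀ n, (∃ S, P S ∧ S.card = n) → n ≤ N := by
      rintro n ⟨S, hS, rfl⟩; exact hcard S hS
    obtain ⟨n0, hn0⟩ := hne
    obtain ⟨S, hS, hSc⟩ := Nat.findGreatest_spec (P := fun n => ∃ S, P S ∧ S.card = n)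
      (hle n0 hn0) hn0
    refine ⟨S, hS, fun T hT => ?_⟩
    rw [hSc]
    exact Nat.le_findGreatest (hcard T hT) ⟨T, hT, rfl⟩
  obtain ⟨S, hS, hmax⟩ := hex
  have hεpos : 0 < ε := by
    obtain ⟨B, -, -, -, hB⟩ := h {x₀} (by simpa using hx₀) (finite_singleton _) rfl
    obtain ⟨b, -, s, hs, -⟩ := hB x₀ rfl
    linarith [abs_nonneg s]
  refine ⟨S, hS.1, S.finite_toSet, by simpa using hcard S hS, ?_⟩
  intro a ha
  by_contra! hcon
  have haS : a ∉ S := by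
    intro haS
    exact hcon a haS 0 (by simpa using hεpos) (φ.map_zero_apply a)
  have hP : P (insert a S) := by
    refine ⟨by simpa using insert_subset ha hS.1, ?_⟩
    intro x hx y hy hxy s hs hsx
    rcases Finset.mem_insert.1 hx with rfl | hx'
    · rcases Finset.mem_insert.1 hy with rfl | hy
      · exact hxy rfl
      · exact hcon y hy s hs hsx
    · rcases Finset.mem_insert.1 hy with rfl | hy
      · refine hcon x hx' (-s) (by rwa [abs_neg]) ?_
        rw [← hsx, ← φ.map_add, neg_add_cancel, φ.map_zero_apply]
      · exact hS.2 x hx' y hy hxy s hs hsx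
  have := hmax _ hP
  rw [Finset.card_insert_of_notMem haS] at this
  omega

theorem nExpansive_of_sqCond
    {M : Type*} [MetricSpace M] [CompactSpace M]
    (φ : Flow ℝ M) (hfix : ∀ p : M, ∃ t : ℝ, φ t p ≠ p)
    (N : ℕ) (hN : 0 < N)
    (hsq : ∀ ε : ℝ, 0 < ε → ∃ δ : ℝ, 0 < δ ∧ ∃ η : ℝ, 0 < η ∧
      ∀ (A : Set M) (β : M → ℤ → ℝ) (xβ : M), IsCompact A → MemSQ A β xβ →
        (∀ i : ℤ, β xβ (i + 1) - β xβ i ≤ η) →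
        (∀ i : ℤ, ∀ a ∈ A, |β a (i + 1) - β a i| ≤ δ) →
        (∀ i : ℤ, Metric.diam ((fun x => φ (β x i) x) '' A) < δ) →
        ∃ B ⊆ A, B.Finite ∧ B.ncard ≤ N ∧
          ∀ a ∈ A, ∃ b ∈ B, ∃ s : ℝ, |s| < ε ∧ φ s b = a) :
    NExpansive φ N := by
  intro ε hε
  obtain ⟨δ, hδ, η, hη, H⟩ := hsq (ε / 2) (by positivity)
  obtain ⟨δ', hδ', η₀, hη₀, hstep⟩ := step_control φ hfix δ hδ
  refine ⟨min δ δ', lt_min hδ hδ', ?_⟩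
  rintro A α xα ⟨hxA, hid, h0, hcont⟩ hdiam
  apply cover_of_finite φ N A xα hxA ε
  intro F hFA hFf hxF
  set τ := min η η₀ with hτ
  have hτ0 : 0 < τ := lt_min hη hη₀
  refine H F (fun x i => α x (i * τ)) xα hFf.isCompact ⟨hxF, ?_, ?_, ?_, ?_⟩ ?_ ?_ ?_
  · intro x hx
    simpa using h0 x (hFA hx)
  · simp only [hid]
    exact tendsto_intCast_atTop_atTop.atTop_mul_const hτ0
  · simp only [hid]
    exact (tendsto_intCast_atBot_iff.2 tendsto_id).atBot_mul_const hτ0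
  · intro i
    exact (hcont _).mono hFA
  · intro i
    simp only [hid]
    push_cast
    have : τ ≤ η := min_le_left _ _
    linarith
  · intro i a ha
    refine hstep xα a (α a) _ _ (α a).continuous ?_ ?_ ?_
    · push_cast; linarith
    · push_cast
      have : τ ≤ η₀ := min_le_right _ _
      linarith
    · intro t
      refine lt_of_le_of_lt ?_ (lt_of_lt_of_le (hdiam t) (min_le_right _ _))
      refine Metric.dist_le_diam_of_mem (isCompact_univ.isBounded.subset (subset_univ _)) ?_ ?_
      · exact ⟨xα, hxA, by simp only [hid]⟩
      · exact ⟨a, hFA ha, rfl⟩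
  · intro i
    refine lt_of_le_of_lt ?_ (lt_of_lt_of_le (hdiam (i * τ)) (min_le_left _ _))
    exact Metric.diam_mono (image_mono hFA) (isCompact_univ.isBounded.subset (subset_univ _))
end

section
/- Let (M,d) be a compact metric space, let X^t be a flow on M without fixed points, and let N > 0 be an integer. Then X^t is N-expansive if and only if for every η > 0 there is δ > 0 such that whenever A ⊆ M and α ∈ ℋ(A) satisfy diam(𝒳^t_α(A)) < δ for all t ∈ ℝ, the set A is contained in the union of at most N orbit segments (sets of the form X^{[a,b]}(z) = {X^s(z) : a ≤ s ≤ b}), each contained in the open ball B_η(x_α). -/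
open Set Metric

lemma aux_small {M : Type*} [MetricSpace M] [CompactSpace M] (φ : Flow ℝ M) (η : ℝ) (hη : 0 < η) :
    ∃ ε : ℝ, 0 < ε ∧ ∀ s : ℝ, |s| ≤ ε → ∀ x : M, dist (φ s x) x < η := by
  have h : ∀ᶠ s in nhds (0:ℝ), ∀ x ∈ (univ : Set M), dist (φ s x) x < η := by
    apply isCompact_univ.eventually_forall_of_forall_eventually
    intro y _
    have hc : Continuous (fun z : ℝ × M => dist (φ z.1 z.2) z.2) :=
      (φ.continuous continuous_fst continuous_snd).dist continuous_snd
    have := hc.tendsto (0, y)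
    exact this.eventually (gt_mem_nhds (by simpa using hη))
  obtain ⟨e, he, h⟩ := Metric.eventually_nhds_iff.1 h
  refine ⟨e / 2, by positivity, fun s hs x => h ?_ x (mem_univ x)⟩
  rw [Real.dist_eq, sub_zero]
  linarith

lemma aux_move {M : Type*} [MetricSpace M] (φ : Flow ℝ M)
    (hfix : ∀ p : M, ∃ t : ℝ, φ t p ≠ p) (ε : ℝ) (hε : 0 < ε) (p : M) :
    ∃ s ∈ Icc 0 ε, φ s p ≠ p := by
  by_contra! hcon
  obtain ⟨t, ht⟩ := hfix p
  apply ht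
  obtain ⟨n, hn⟩ := exists_nat_gt (|t| / ε)
  have hn0 : (0:ℝ) < n := lt_of_le_of_lt (by positivity) hn
  have habs : |t| / n ≤ ε := by
    rw [div_lt_iff₀ hε] at hn
    rw [div_le_iff₀ hn0]
    linarith
  have h1 : φ (|t| / n) p = p := hcon _ ⟨by positivity, habs⟩
  have h2 : ∀ k : ℕ, φ (k * (|t| / n)) p = p := by
    intro k
    induction k with
    | zero => simp
    | succ k ih =>
      have : ((k + 1 : ℕ) : ℝ) * (|t| / n) = k * (|t| / n) + |t| / n := by push_cast; ring
      rw [this, φ.map_add, h1, ih]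
  have h3 := h2 n
  rw [mul_div_cancel₀ _ hn0.ne'] at h3
  rcases abs_choice t with h | h
  · rwa [h] at h3
  · rw [h] at h3
    calc φ t p = φ t (φ (-t) p) := by rw [h3]
      _ = p := by rw [← φ.map_add]; simp

lemma aux_short {M : Type*} [MetricSpace M] [CompactSpace M] (φ : Flow ℝ M)
    (hfix : ∀ p : M, ∃ t : ℝ, φ t p ≠ p) (ε : ℝ) (hε : 0 < ε) :
    ∃ η : ℝ, 0 < η ∧ ∀ p : M, ∃ s ∈ Icc 0 ε, 2 * η < dist (φ s p) p := by
  have h : ∀ᶠ η in nhds (0:ℝ), ∀ p ∈ (univ : Set M), ∃ s ∈ Icc 0 ε, 2 * η < dist (φ s p) p := by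
    apply isCompact_univ.eventually_forall_of_forall_eventually
    intro y _
    obtain ⟨s, hs, hne⟩ := aux_move φ hfix ε hε y
    have hc : Continuous (fun z : ℝ × M => dist (φ s z.2) z.2 - 2 * z.1) :=
      ((φ.continuous continuous_const continuous_snd).dist continuous_snd).sub
        (continuous_const.mul continuous_fst)
    have := (hc.tendsto (0, y)).eventually (lt_mem_nhds (a := 0) (by simpa using hne))
    filter_upwards [this] with z hz
    exact ⟨s, hs, by linarith⟩
  obtain ⟨e, he, h⟩ := Metric.eventually_nhds_iff.1 h
  refine ⟨e / 2, by positivity, fun p => h ?_ p (mem_univ p)⟩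
  rw [Real.dist_eq, sub_zero, abs_of_pos (by positivity)]
  linarith

theorem nExpansive_iff_orbitSegments
    {M : Type*} [MetricSpace M] [CompactSpace M]
    (φ : Flow ℝ M) (hfix : ∀ p : M, ∃ t : ℝ, φ t p ≠ p)
    (N : ℕ) (hN : 0 < N) :
    NExpansive φ N ↔ OrbitSegmentsCond φ N := by
  constructor
  · intro H η hη
    obtain ⟨ε, hε, hs⟩ := aux_small φ (η / 2) (by positivity)
    obtain ⟨δ, hδ, H⟩ := H ε hε
    refine ⟨min δ (η / 2), by positivity, fun A α xα hA hd => ?_⟩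
    obtain ⟨B, hBA, hBf, hBc, hB⟩ := H A α xα hA (fun t => (hd t).trans_le (min_le_left _ _))
    have hdA : ∀ x ∈ A, dist x xα < η / 2 := by
      intro x hx
      have him : (fun x => φ (α x 0) x) '' A = A := by
        have : EqOn (fun x => φ (α x 0) x) id A := by
          intro x hx
          simp [hA.2.2.1 x hx]
        rw [this.image_eq, image_id]
      have h0 := hd 0
      rw [him] at h0
      exact (dist_le_diam_of_mem (isBounded_of_compactSpace) hx hA.1).trans_lt
        (h0.trans_le (min_le_right _ _))
    have hBne : B.Nonempty := by
      obtain ⟨b, hb, _⟩ := hB xα hA.1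
      exact ⟨b, hb⟩
    obtain ⟨z, hzB, hzs⟩ : ∃ z : Fin N → M, (∀ i, z i ∈ B) ∧ ∀ b ∈ B, ∃ i, z i = b := by
      haveI := hBf.fintype
      haveI : Nonempty B := hBne.to_subtype
      have hcard : Fintype.card B ≤ Fintype.card (Fin N) := by
        rw [Fintype.card_fin, ← Nat.card_eq_fintype_card]
        exact hBc
      obtain ⟨f⟩ := Function.Embedding.nonempty_of_card_le hcard
      refine ⟨fun i => (Function.invFun f i : B), fun i => Subtype.coe_prop _, fun b hb => ⟨f ⟨b, hb⟩, ?_⟩⟩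
      exact congrArg Subtype.val (Function.leftInverse_invFun f.injective ⟨b, hb⟩)
    refine ⟨z, fun _ => -ε, fun _ => ε, ?_, ?_⟩
    · intro x hx
      obtain ⟨b, hb, s, hsε, rfl⟩ := hB x hx
      obtain ⟨i, rfl⟩ := hzs b hb
      exact mem_iUnion.2 ⟨i, s, abs_le.1 hsε.le, rfl⟩
    · rintro i _ ⟨s, hsI, rfl⟩
      have h1 := hs s (abs_le.2 hsI) (z i)
      have h2 := hdA _ (hBA (hzB i))
      have h3 := dist_triangle (φ s (z i)) (z i) xα
      simp only [mem_ball]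
      linarith
  · intro H ε hε
    obtain ⟨η, hη, hs⟩ := aux_short φ hfix (ε / 2) (by positivity)
    obtain ⟨δ, hδ, H⟩ := H η hη
    refine ⟨δ, hδ, fun A α xα hA hd => ?_⟩
    obtain ⟨z, a, b, hcov, hball⟩ := H A α xα hA hd
    have hlen : ∀ i, b i - a i < ε / 2 := by
      intro i
      by_contra! hcon
      obtain ⟨s, hsI, hfar⟩ := hs (φ (a i) (z i))
      have h1 := hball i ⟨a i, ⟨le_rfl, by linarith⟩, rfl⟩
      have h2 := hball i ⟨s + a i, ⟨by linarith [hsI.1], by linarith [hsI.2]⟩, rfl⟩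
      simp only [mem_ball, φ.map_add] at h1 h2
      have h3 := dist_triangle_right (φ s (φ (a i) (z i))) (φ (a i) (z i)) xα
      linarith
    classical
    let S : Fin N → Set M := fun i => A ∩ (fun s => φ s (z i)) '' Set.Icc (a i) (b i)
    let c : Fin N → M := fun i => if h : (S i).Nonempty then h.some else xα
    have hc : ∀ i, (S i).Nonempty → c i ∈ S i := by
      intro i h
      simp only [c, dif_pos h]
      exact h.some_mem
    refine ⟨range c, ?_, finite_range c, ?_, ?_⟩
    · rintro _ ⟨i, rfl⟩
      by_cases h : (S i).Nonempty
      · exact (hc i h).1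
      · simp only [c, dif_neg h]
        exact hA.1
    · rw [← image_univ]
      refine (ncard_image_le finite_univ).trans ?_
      simp [ncard_univ]
    · intro x hx
      obtain ⟨i, hi⟩ := mem_iUnion.1 (hcov hx)
      obtain ⟨_, s', hs', hcs⟩ := hc i ⟨x, hx, hi⟩
      obtain ⟨s, hsI, rfl⟩ := hi
      refine ⟨c i, mem_range_self i, s - s', ?_, ?_⟩
      · have := hlen i
        rw [abs_lt]
        constructor <;> linarith [hsI.1, hsI.2, hs'.1, hs'.2]
      · rw [← hcs]
        simp only [← φ.map_add]
        simp
end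

section
/- For each integer N ≥ 2 there exist a compact metric space (M,d) and a flow X^t on M such that X^t is N-expansive but X^t is not expansive, i.e. not 1-expansive. -/
open Set Metric

noncomputable section

namespace NExpEx

open Topology Filter

instance ereal_metrizable : TopologicalSpace.MetrizableSpace EReal :=
  TopologicalSpace.metrizableSpace_of_t3_secondCountable EReal

instance ereal_metric : MetricSpace EReal := TopologicalSpace.metrizableSpaceMetric EReal

/-- The ambient space: a phase and two positions. -/
abbrev Amb := UnitAddCircle × EReal × EReal

def hh (p q : EReal) : ℝ := (EReal.exp p).toReal * Real.exp (-q.toReal) / 8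

def C0 : Set Amb := {x | x.2.1 = ⊥ ∨ x.2.1 = ⊤ ∨ ((x.2.1.toReal : ℝ) : UnitAddCircle) = x.1}

def F1 : Set Amb := {x | x.2.2 = ⊥ ∨ x.2.2 = ⊤ ∨ ((x.2.2.toReal : ℝ) : UnitAddCircle) = x.1}

def F2 : Set Amb := {x | x.2.2 = ⊥ ∨ x.2.2 = ⊤ ∨
  ((x.2.2.toReal - hh x.2.1 x.2.2 : ℝ) : UnitAddCircle) = x.1}

def MS : Set Amb := {x | x ∈ C0 ∧ x.2.1 ≤ x.2.2 ∧ (x ∈ F1 ∨ x ∈ F2)}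

def tr (t : ℝ) (x : Amb) : Amb := (x.1 + (t : UnitAddCircle), x.2.1 + (t : EReal), x.2.2 + (t : EReal))

lemma cont_addE : Continuous (fun z : ℝ × EReal => z.2 + (z.1 : EReal)) := by
  rw [continuous_iff_continuousAt]
  intro z
  have h1 : ContinuousAt (fun p : EReal × EReal => p.1 + p.2) (z.2, (z.1 : EReal)) :=
    EReal.continuousAt_add (Or.inr (EReal.coe_ne_bot _)) (Or.inr (EReal.coe_ne_top _))
  have h2 : ContinuousAt (fun z : ℝ × EReal => (z.2, (z.1 : EReal))) z :=
    (continuous_snd.prodMk (continuous_coe_real_ereal.comp continuous_fst)).continuousAt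
  exact ContinuousAt.comp (f := fun z : ℝ × EReal => (z.2, (z.1 : EReal))) h1 h2

lemma cont_tr : Continuous (fun z : ℝ × Amb => tr z.1 z.2) := by
  have c : Continuous (fun t : ℝ => (t : UnitAddCircle)) := AddCircle.continuous_mk' 1
  unfold tr
  refine Continuous.prodMk ?_ (Continuous.prodMk ?_ ?_)
  · exact (continuous_fst.comp continuous_snd).add (c.comp continuous_fst)
  · exact cont_addE.comp (continuous_fst.prodMk (continuous_fst.comp (continuous_snd.comp continuous_snd)))
  · exact cont_addE.comp (continuous_fst.prodMk (continuous_snd.comp (continuous_snd.comp continuous_snd)))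

lemma hh_tr (p : EReal) (q t : ℝ) (hp : p ≠ ⊤) :
    hh (p + (t : EReal)) ((q : EReal) + (t : EReal)) = hh p q := by
  unfold hh
  induction p with
  | bot => simp
  | top => exact absurd rfl hp
  | coe s =>
    rw [← EReal.coe_add, ← EReal.coe_add, EReal.exp_coe, EReal.exp_coe, EReal.toReal_coe,
      EReal.toReal_coe, ENNReal.toReal_ofReal (Real.exp_pos _).le,
      ENNReal.toReal_ofReal (Real.exp_pos _).le, ← Real.exp_add, ← Real.exp_add]
    congr 2; ring

lemma tr_mem {x : Amb} (t : ℝ) (hx : x ∈ MS) : tr t x ∈ MS := by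
  obtain ⟨θ, p, q⟩ := x
  obtain ⟨h0, h1, h2⟩ := hx
  refine ⟨?_, ?_, ?_⟩
  · simp only [C0, tr, mem_ofPred_eq] at h0 ⊢
    induction p with
    | bot => simp
    | top => simp
    | coe s =>
      right; right
      rw [← EReal.coe_add, EReal.toReal_coe]
      simpa using h0
  · exact add_le_add_left h1 _
  · refine h2.imp ?_ ?_
    · intro h0
      simp only [F1, tr, mem_ofPred_eq] at h0 ⊢
      induction q with
      | bot => simp
      | top => simp
      | coe s =>
        right; right
        rw [← EReal.coe_add, EReal.toReal_coe]
        simpa using h0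
    · intro h0
      simp only [F2, tr, mem_ofPred_eq] at h0 h1 ⊢
      induction q with
      | bot => simp
      | top => simp
      | coe s =>
        right; right
        have hp : p ≠ ⊤ := fun h => by simp [h] at h1
        rw [hh_tr _ _ _ hp, ← EReal.coe_add, EReal.toReal_coe]
        simp only [EReal.coe_ne_bot, EReal.coe_ne_top, false_or, EReal.toReal_coe] at h0
        rw [← h0, ← AddCircle.coe_add]
        congr 1; ring

lemma contAt_toReal {x : EReal} (h1 : x ≠ ⊥) (h2 : x ≠ ⊤) : ContinuousAt EReal.toReal x :=
  EReal.tendsto_toReal h2 h1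

lemma closed_aux (f : Amb → EReal) (hf : Continuous f) (k : Amb → ℝ) (U : Set Amb) (hU : IsOpen U)
    (hk : ∀ x ∈ U, f x ≠ ⊥ → f x ≠ ⊤ → ContinuousAt k x) :
    IsOpen {x : Amb | x ∈ U ∧ f x ≠ ⊥ ∧ f x ≠ ⊤ ∧ ((k x : ℝ) : UnitAddCircle) ≠ x.1} := by
  rw [isOpen_iff_mem_nhds]
  rintro x ⟨h1, h2, h3, h4⟩
  have c : Continuous (fun t : ℝ => (t : UnitAddCircle)) := AddCircle.continuous_mk' 1
  have e1 := hU.mem_nhds h1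
  have e2 := hf.continuousAt.eventually_ne h2
  have e3 := hf.continuousAt.eventually_ne h3
  have e4 : ∀ᶠ y in 𝓝 x, ((k y : ℝ) : UnitAddCircle) ≠ y.1 :=
    by
      have hc : ContinuousAt (fun y : Amb => (((k y : ℝ) : UnitAddCircle), y.1)) x :=
        ContinuousAt.prodMk (c.continuousAt.comp (hk x h1 h2 h3)) continuous_fst.continuousAt
      exact hc.eventually ((isOpen_ne_fun continuous_fst continuous_snd).mem_nhds h4)
  filter_upwards [e1, e2, e3, e4] with y a b c d using ⟨a, b, c, d⟩

lemma closed_MS : IsClosed MS := by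
  have cp : Continuous (fun x : Amb => x.2.1) := continuous_fst.comp continuous_snd
  have cq : Continuous (fun x : Amb => x.2.2) := continuous_snd.comp continuous_snd
  have A := closed_aux (fun x => x.2.1) cp (fun x => x.2.1.toReal) univ isOpen_univ
    (fun x _ h1 h2 => ContinuousAt.comp (f := fun x : Amb => x.2.1) (contAt_toReal h1 h2) cp.continuousAt)
  have B := closed_aux (fun x => x.2.2) cq (fun x => x.2.2.toReal) univ isOpen_univ
    (fun x _ h1 h2 => ContinuousAt.comp (f := fun x : Amb => x.2.2) (contAt_toReal h1 h2) cq.continuousAt)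
  have C := closed_aux (fun x => x.2.2) cq (fun x => x.2.2.toReal - hh x.2.1 x.2.2) {x | x.2.1 ≠ ⊤}
    (isOpen_ne_fun cp continuous_const)
    (fun x hx h1 h2 => by
      have a : ContinuousAt (fun x : Amb => x.2.2.toReal) x :=
        ContinuousAt.comp (f := fun x : Amb => x.2.2) (contAt_toReal h1 h2) cq.continuousAt
      have b : ContinuousAt (fun x : Amb => (EReal.exp x.2.1).toReal) x := by
        have hne : EReal.exp x.2.1 ≠ ⊤ := by
          simpa using hx
        exact ContinuousAt.comp (f := fun x : Amb => EReal.exp x.2.1) (ENNReal.tendsto_toReal hne)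
          ((ENNReal.continuous_exp.comp cp).continuousAt)
      unfold hh
      exact a.sub ((b.mul (Real.continuous_exp.continuousAt.comp a.neg)).div_const _))
  have D : IsClosed {x : Amb | x.2.1 ≤ x.2.2} := isClosed_le cp cq
  have : MS = {x : Amb | x ∈ univ ∧ x.2.1 ≠ ⊥ ∧ x.2.1 ≠ ⊤ ∧ ((x.2.1.toReal : ℝ) : UnitAddCircle) ≠ x.1}ᶜ
      ∩ ({x : Amb | x.2.1 ≤ x.2.2} ∩
      ({x : Amb | x ∈ univ ∧ x.2.2 ≠ ⊥ ∧ x.2.2 ≠ ⊤ ∧ ((x.2.2.toReal : ℝ) : UnitAddCircle) ≠ x.1}ᶜ ∪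
       {x : Amb | x ∈ {x : Amb | x.2.1 ≠ ⊤} ∧ x.2.2 ≠ ⊥ ∧ x.2.2 ≠ ⊤ ∧
        ((x.2.2.toReal - hh x.2.1 x.2.2 : ℝ) : UnitAddCircle) ≠ x.1}ᶜ)) := by
    ext x
    have key : x.2.1 ≤ x.2.2 → x.2.1 = ⊤ → x.2.2 = ⊤ := fun h h' => by
      rw [h'] at h; exact top_le_iff.1 h
    simp only [MS, C0, F1, F2, mem_ofPred_eq, mem_inter_iff, mem_union, mem_compl_iff, mem_univ]
    tauto
  rw [this]
  exact A.isClosed_compl.inter (D.inter (B.isClosed_compl.union C.isClosed_compl))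

/-- The phase space. -/
abbrev MM : Type := MS

instance : CompactSpace MM := isCompact_iff_compactSpace.1 closed_MS.isCompact

lemma ereal_add_coe (x : EReal) (s t : ℝ) : x + ((s + t : ℝ) : EReal) = x + (t : EReal) + (s : EReal) := by
  rw [EReal.coe_add, add_comm (s : EReal), add_assoc]

def fl : Flow ℝ MM where
  toFun t x := ⟨tr t x.1, tr_mem t x.2⟩
  cont' := by
    refine Continuous.subtype_mk ?_ _
    exact cont_tr.comp (continuous_fst.prodMk (continuous_subtype_val.comp continuous_snd))
  map_add' s t x := by
    apply Subtype.ext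
    simp only [tr, ereal_add_coe, AddCircle.coe_add]
    rw [add_comm (s : UnitAddCircle), ← add_assoc]
  map_zero' x := by
    apply Subtype.ext
    simp [tr]

lemma fl_apply (t : ℝ) (x : MM) : (fl t x).1 = tr t x.1 := rfl

/-- Clamp. -/
def cl (p : EReal) : ℝ := (max (((-2 : ℝ)) : EReal) (min ((2 : ℝ) : EReal) p)).toReal

lemma cl_coe (r : ℝ) : cl r = max (-2) (min 2 r) := by
  unfold cl
  rw [← EReal.coe_strictMono.monotone.map_min, ← EReal.coe_strictMono.monotone.map_max,
    EReal.toReal_coe]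

lemma cl_top : cl ⊤ = 2 := by
  unfold cl
  rw [min_eq_left le_top, ← EReal.coe_strictMono.monotone.map_max, EReal.toReal_coe]
  norm_num

lemma cl_bot : cl ⊥ = -2 := by
  unfold cl
  rw [min_eq_right bot_le, max_eq_left bot_le, EReal.toReal_coe]

lemma cont_cl : Continuous cl := by
  rw [continuous_iff_continuousAt]
  intro x
  have h : Continuous (fun p : EReal => max (((-2 : ℝ)) : EReal) (min ((2 : ℝ) : EReal) p)) := by
    fun_prop
  refine ContinuousAt.comp (f := fun p : EReal => max (((-2 : ℝ)) : EReal) (min ((2 : ℝ) : EReal) p))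
    (contAt_toReal ?_ ?_) h.continuousAt
  · exact ((EReal.bot_lt_coe _).trans_le (le_max_left _ _)).ne'
  · exact (max_lt (EReal.coe_lt_top _) ((min_le_left _ _).trans_lt (EReal.coe_lt_top _))).ne

lemma coord (xa xb : EReal) (f g : ℝ ≃ₜ ℝ) (u : ℝ)
    (hD : ∀ t, |g t - f t + u| < 1 / 8)
    (hc : ∀ t, |cl (xa + (f t : ℝ)) - cl (xb + (g t : ℝ))| < 1 / 8) :
    (xa = ⊤ ∧ xb = ⊤) ∨ (xa = ⊥ ∧ xb = ⊥) ∨ ∃ s s' : ℝ, xa = s ∧ xb = s' ∧ |s' - s - u| < 1 / 4 := by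
  induction xa with
  | bot =>
    induction xb with
    | bot => simp
    | top => have := hc 0; simp [cl_top, cl_bot] at this; norm_num [abs_lt] at this
    | coe s =>
      have := hc (g.symm (-s))
      rw [g.apply_symm_apply, ← EReal.coe_add, EReal.bot_add, cl_bot, cl_coe] at this
      norm_num [abs_lt] at this
  | top =>
    induction xb with
    | top => simp
    | bot => have := hc 0; simp [cl_top, cl_bot] at this; norm_num [abs_lt] at this
    | coe s =>
      have := hc (g.symm (-s))
      rw [g.apply_symm_apply, ← EReal.coe_add, EReal.top_add_coe, cl_top, cl_coe] at this
      norm_num [abs_lt] at this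
  | coe s =>
    have h := hc (f.symm (-s))
    have h2 := hD (f.symm (-s))
    rw [f.apply_symm_apply] at h h2
    rw [← EReal.coe_add, cl_coe] at h
    induction xb with
    | bot => rw [EReal.bot_add, cl_bot] at h; norm_num [abs_lt] at h
    | top => rw [EReal.top_add_coe, cl_top] at h; norm_num [abs_lt] at h
    | coe s' =>
      right; right
      refine ⟨s, s', rfl, rfl, ?_⟩
      rw [← EReal.coe_add, cl_coe] at h
      have h3 : |s' + g (f.symm (-s))| < 1 / 8 := by
        generalize s' + g (f.symm (-s)) = w at h
        have e : max (-2 : ℝ) (min 2 (s + -s)) = 0 := by norm_num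
        rw [e, zero_sub, abs_neg, abs_lt] at h
        rw [abs_lt]
        obtain ⟨ha, hb⟩ := h
        constructor
        · rcases lt_max_iff.1 ha with h | h
          · norm_num at h
          · exact (lt_min_iff.1 h).2
        · rcases min_lt_iff.1 (max_lt_iff.1 hb).2 with h | h
          · norm_num at h
          · exact h
      rw [abs_lt] at *
      constructor <;> linarith [h2.1, h2.2, h3.1, h3.2]

lemma exists_lift (z : UnitAddCircle) : ∃ u : ℝ, (u : UnitAddCircle) = z ∧ |u| = ‖z‖ := by
  obtain ⟨v, rfl⟩ := QuotientAddGroup.mk_surjective z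
  refine ⟨v - round v, ?_, ?_⟩
  · have : ((round v : ℝ) : UnitAddCircle) = 0 :=
      (AddCircle.coe_eq_zero_iff (1 : ℝ)).2 ⟨round v, by simp⟩
    rw [AddCircle.coe_sub, this, sub_zero]
  · exact (UnitAddCircle.norm_eq).symm

lemma lift_small (D : ℝ → ℝ) (hD : Continuous D) (η : ℝ) (hη : η ≤ 1 / 8) (h0 : |D 0| < η)
    (h : ∀ t, ‖(D t : UnitAddCircle)‖ < η) (t : ℝ) : |D t| < η := by
  by_contra! hcon
  have hc : Continuous (fun t => |D t|) := hD.abs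
  obtain ⟨t', ht'⟩ : η ∈ range (fun t => |D t|) :=
    mem_range_of_exists_le_of_exists_ge hc ⟨0, h0.le⟩ ⟨t, hcon⟩
  have h1 := h t'
  have h2 : ‖(D t' : UnitAddCircle)‖ = |D t'| := by
    refine (AddCircle.norm_coe_eq_abs_iff (1 : ℝ) one_ne_zero).2 ?_
    simp only [] at ht'
    rw [ht']; norm_num; linarith
  simp only [] at ht'
  rw [h2, ht'] at h1
  exact lt_irrefl _ h1

lemma int_zero {w : ℝ} (h : (w : UnitAddCircle) = 0) (hw : |w| < 1) : w = 0 := by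
  obtain ⟨n, hn⟩ := (AddCircle.coe_eq_zero_iff (1 : ℝ)).1 h
  simp only [zsmul_eq_mul, mul_one] at hn
  rw [← hn] at hw ⊢
  have : |n| < 1 := by exact_mod_cast hw
  simp [Int.abs_lt_one_iff.1 this]

lemma hh_nonneg (p q : EReal) : 0 ≤ hh p q := by unfold hh; positivity

lemma hh_le {p : EReal} {q : ℝ} (h : p ≤ q) : hh p q ≤ 1 / 8 := by
  unfold hh
  induction p with
  | bot => simp
  | top => simp at h
  | coe s =>
    rw [EReal.exp_coe, ENNReal.toReal_ofReal (Real.exp_pos _).le, EReal.toReal_coe, ← Real.exp_add]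
    have : s ≤ q := by exact_mod_cast h
    have : Real.exp (s + -q) ≤ 1 := Real.exp_le_one_iff.2 (by linarith)
    linarith

lemma hh_shift (p : EReal) (q w : ℝ) : hh p ((q + w : ℝ) : EReal) = hh p q * Real.exp (-w) := by
  unfold hh
  rw [EReal.toReal_coe, EReal.toReal_coe, neg_add, Real.exp_add]; ring

lemma zero_of_eq {w c : ℝ} (hc : 0 ≤ c) (h : w = c * Real.exp (-w) - c) : w = 0 := by
  rcases lt_trichotomy w 0 with hw | hw | hw
  · have : 1 ≤ Real.exp (-w) := Real.one_le_exp (by linarith)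
    nlinarith
  · exact hw
  · have : Real.exp (-w) ≤ 1 := Real.exp_le_one_iff.2 (by linarith)
    nlinarith

/-- Two mutually shadowing points with the same label lie on a short orbit arc. -/
lemma pair (a b : MM) (f g : ℝ ≃ₜ ℝ) (f0 : f 0 = 0) (g0 : g 0 = 0) (η : ℝ) (hη : η ≤ 1 / 8)
    (h1 : ∀ t, ‖(fl (g t) b).1.1 - (fl (f t) a).1.1‖ < η)
    (h2 : ∀ t, |cl (fl (f t) a).1.2.1 - cl (fl (g t) b).1.2.1| < 1 / 8)
    (h3 : ∀ t, |cl (fl (f t) a).1.2.2 - cl (fl (g t) b).1.2.2| < 1 / 8)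
    (hl : (a.1 ∈ F1 ∧ b.1 ∈ F1) ∨ (a.1 ∈ F2 ∧ b.1 ∈ F2)) :
    ∃ s : ℝ, |s| < η ∧ fl s a = b := by
  obtain ⟨⟨θa, pa, qa⟩, ha⟩ := a
  obtain ⟨⟨θb, pb, qb⟩, hb⟩ := b
  simp only [fl_apply, tr] at h1 h2 h3 hl
  obtain ⟨u, hu, hun⟩ := exists_lift (θb - θa)
  have hθ : θb = θa + (u : UnitAddCircle) := by rw [hu]; abel
  have hu8 : |u| < η := by
    have := h1 0
    rw [hun]; simpa [f0, g0] using this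
  have hD : ∀ t, |g t - f t + u| < η := by
    refine lift_small (fun t => g t - f t + u) ((g.continuous.sub f.continuous).add_const u) η hη
      (by simpa [f0, g0] using hu8) ?_
    intro t
    convert h1 t using 2
    rw [AddCircle.coe_add, AddCircle.coe_sub, hu]; abel
  have hD' : ∀ t, |g t - f t + u| < 1 / 8 := fun t => (hD t).trans_le hη
  obtain ⟨hpa, hla, -⟩ := ha
  obtain ⟨hpb, hlb, -⟩ := hb
  have Ep : pb = pa + (u : EReal) := by
    rcases coord pa pb f g u hD' h2 with ⟨rfl, rfl⟩ | ⟨rfl, rfl⟩ | ⟨s, s', rfl, rfl, h⟩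
    · simp
    · simp
    · simp only [C0, mem_ofPred_eq, EReal.coe_ne_bot, EReal.coe_ne_top, false_or, EReal.toReal_coe] at hpa hpb
      have : s' - s - u = 0 := by
        refine int_zero ?_ (h.trans (by norm_num))
        rw [AddCircle.coe_sub, AddCircle.coe_sub, hpa, hpb, hθ]; abel
      rw [← EReal.coe_add]; congr 1; linarith
  have Eq : qb = qa + (u : EReal) := by
    rcases coord qa qb f g u hD' h3 with ⟨rfl, rfl⟩ | ⟨rfl, rfl⟩ | ⟨s, s', rfl, rfl, h⟩
    · simp
    · simp
    · simp only [F1, F2, mem_ofPred_eq, EReal.coe_ne_bot, EReal.coe_ne_top, false_or, EReal.toReal_coe] at hl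
      have : s' - s - u = 0 := by
        rcases hl with ⟨ka, kb⟩ | ⟨ka, kb⟩
        · refine int_zero ?_ (h.trans (by norm_num))
          rw [AddCircle.coe_sub, AddCircle.coe_sub, ka, kb, hθ]; abel
        · have ia := hh_le hla
          have ib := hh_le hlb
          have ja := hh_nonneg pa s
          have jb := hh_nonneg pb s'
          have e1 : (s' - hh pb s') - (s - hh pa s) - u = 0 := by
            refine int_zero ?_ ?_
            · rw [AddCircle.coe_sub, AddCircle.coe_sub (1 : ℝ) (s' - hh pb s'), ka, kb, hθ]; abel
            · rw [abs_lt] at h ⊢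
              constructor <;> linarith [h.1, h.2]
          have hpt : pa ≠ ⊤ := fun h => by
            rw [h] at hla; exact EReal.coe_ne_top _ (top_le_iff.1 hla)
          have e2 : hh pb s' = hh pa s * Real.exp (-(s' - s - u)) := by
            rw [← hh_shift, ← hh_tr _ _ u hpt, Ep, ← EReal.coe_add]
            congr 2; ring
          refine zero_of_eq ja ?_
          rw [← e2]; linarith
      rw [← EReal.coe_add]; congr 1; linarith
  refine ⟨u, hu8, ?_⟩
  apply Subtype.ext
  simp only [fl_apply, tr]
  rw [hθ, Ep, Eq]

lemma two_exp : NExpansive fl 2 := by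
  intro ε hε
  have c1 : Continuous (fun x : MM => x.1.1) := continuous_fst.comp continuous_subtype_val
  have c2 : Continuous (fun x : MM => cl x.1.2.1) :=
    cont_cl.comp (continuous_fst.comp (continuous_snd.comp continuous_subtype_val))
  have c3 : Continuous (fun x : MM => cl x.1.2.2) :=
    cont_cl.comp (continuous_snd.comp (continuous_snd.comp continuous_subtype_val))
  have hη : 0 < min ε (1 / 8) := lt_min hε (by norm_num)
  obtain ⟨δ1, p1, k1⟩ := Metric.uniformContinuous_iff.1
    (CompactSpace.uniformContinuous_of_continuous c1) (min ε (1 / 8)) hη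
  obtain ⟨δ2, p2, k2⟩ := Metric.uniformContinuous_iff.1
    (CompactSpace.uniformContinuous_of_continuous c2) (1 / 8) (by norm_num)
  obtain ⟨δ3, p3, k3⟩ := Metric.uniformContinuous_iff.1
    (CompactSpace.uniformContinuous_of_continuous c3) (1 / 8) (by norm_num)
  refine ⟨min δ1 (min δ2 δ3), lt_min p1 (lt_min p2 p3), ?_⟩
  intro A α xα hα hd
  have hdist : ∀ a ∈ A, ∀ b ∈ A, ∀ t, dist (fl (α a t) a) (fl (α b t) b) < min δ1 (min δ2 δ3) := by
    intro a ha b hb t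
    refine lt_of_le_of_lt ?_ (hd t)
    exact Metric.dist_le_diam_of_mem (isCompact_univ.isBounded.subset (subset_univ _))
      (mem_image_of_mem (fun x => fl (α x t) x) ha) (mem_image_of_mem (fun x => fl (α x t) x) hb)
  have key : ∀ a ∈ A, ∀ b ∈ A, ((a.1 ∈ F1 ∧ b.1 ∈ F1) ∨ (a.1 ∈ F2 ∧ b.1 ∈ F2)) →
      ∃ s : ℝ, |s| < ε ∧ fl s a = b := by
    intro a ha b hb hl
    obtain ⟨s, hs, h⟩ := pair a b (α a) (α b) (hα.2.2.1 a ha) (hα.2.2.1 b hb) (min ε (1 / 8))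
      (min_le_right _ _)
      (fun t => by
        rw [← dist_eq_norm]
        exact k1 ((hdist b hb a ha t).trans_le (min_le_left _ _)))
      (fun t => by
        rw [← Real.dist_eq]
        exact k2 ((hdist a ha b hb t).trans_le ((min_le_right _ _).trans (min_le_left _ _))))
      (fun t => by
        rw [← Real.dist_eq]
        exact k3 ((hdist a ha b hb t).trans_le ((min_le_right _ _).trans (min_le_right _ _)))) hl
    exact ⟨s, hs.trans_le (min_le_left _ _), h⟩
  by_cases e1 : ∃ a ∈ A, a.1 ∈ F1
  · obtain ⟨a, ha, fa⟩ := e1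
    by_cases e2 : ∃ b ∈ A, b.1 ∈ F2
    · obtain ⟨b, hb, fb⟩ := e2
      refine ⟨{a, b}, ?_, toFinite _, (ncard_insert_le a {b}).trans (by simp), ?_⟩
      · rintro x (rfl | rfl) <;> assumption
      · intro x hx
        rcases x.2.2.2 with h | h
        · exact ⟨a, by simp, key a ha x hx (Or.inl ⟨fa, h⟩)⟩
        · exact ⟨b, by simp, key b hb x hx (Or.inr ⟨fb, h⟩)⟩
    · refine ⟨{a}, by simpa using ha, toFinite _, by simp, ?_⟩
      intro x hx
      rcases x.2.2.2 with h | h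
      · exact ⟨a, by simp, key a ha x hx (Or.inl ⟨fa, h⟩)⟩
      · exact absurd ⟨x, hx, h⟩ e2
  · have e3 : ∀ x ∈ A, x.1 ∈ F2 := fun x hx => by
      rcases x.2.2.2 with h | h
      · exact absurd ⟨x, hx, h⟩ e1
      · exact h
    refine ⟨{xα}, by simpa using hα.1, toFinite _, by simp, ?_⟩
    intro x hx
    exact ⟨xα, by simp, key xα hα.1 x hx (Or.inr ⟨e3 _ hα.1, e3 x hx⟩)⟩

lemma exists_j (k : ℕ) : ∃ w : ℝ, 0 < w ∧ w = Real.exp (-(k + w)) / 8 := by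
  have hc : Continuous (fun w : ℝ => w - Real.exp (-(k + w)) / 8) := by fun_prop
  have hz : (0 : ℝ) ∈ range (fun w : ℝ => w - Real.exp (-(k + w)) / 8) := by
    refine mem_range_of_exists_le_of_exists_ge hc ⟨0, ?_⟩ ⟨1, ?_⟩
    · have := Real.exp_pos (-((k : ℝ) + 0))
      linarith
    · have : Real.exp (-((k : ℝ) + 1)) ≤ 1 :=
        Real.exp_le_one_iff.2 (by have : (0 : ℝ) ≤ k := Nat.cast_nonneg k
                                  linarith)
      linarith
  obtain ⟨w, hw⟩ := hz
  have hw' : w = Real.exp (-(k + w)) / 8 := by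
    simp only [] at hw
    linarith
  exact ⟨w, by rw [hw']; positivity, hw'⟩

lemma equi (δ : ℝ) (hδ : 0 < δ) : ∀ᶠ s : ℝ in 𝓝 0, ∀ x : EReal, dist x (x + (s : EReal)) < δ := by
  have := isCompact_univ.eventually_forall_of_forall_eventually (X := ℝ) (Y := EReal) (x₀ := (0 : ℝ))
    (P := fun s x => dist x (x + (s : EReal)) < δ) (by
      intro y _
      have hc : Continuous (fun z : ℝ × EReal => dist z.2 (z.2 + (z.1 : EReal))) :=
        continuous_snd.dist cont_addE
      exact hc.continuousAt.eventually_lt continuousAt_const (by simpa using hδ))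
  simpa using this

lemma not_one : ¬ NExpansive fl 1 := by
  intro H
  obtain ⟨δ, hδ, h⟩ := H 1 one_pos
  obtain ⟨η, hη, hs⟩ := Metric.eventually_nhds_iff.1 (equi δ hδ)
  obtain ⟨k, hk⟩ : ∃ k : ℕ, Real.exp (-(k : ℝ)) < η := by
    have : Tendsto (fun k : ℕ => Real.exp (-(k : ℝ))) atTop (𝓝 0) :=
      Real.tendsto_exp_neg_atTop_nhds_zero.comp tendsto_natCast_atTop_atTop
    exact (this.eventually_lt_const hη).exists
  obtain ⟨w, hw, hwk⟩ := exists_j k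
  have hwη : w < η := by
    have h1 : Real.exp (-(k + w)) ≤ Real.exp (-(k : ℝ)) := Real.exp_le_exp.2 (by linarith)
    have h2 := Real.exp_pos (-(k : ℝ))
    linarith
  have k0 : (0 : ℝ) ≤ k := Nat.cast_nonneg k
  have kz : (((k : ℝ)) : UnitAddCircle) = 0 :=
    (AddCircle.coe_eq_zero_iff (1 : ℝ)).2 ⟨k, by simp⟩
  have ma : ((0, 0, ((k : ℝ) : EReal)) : Amb) ∈ MS := by
    refine ⟨?_, ?_, Or.inl ?_⟩
    · simp [C0]
    · change (0 : EReal) ≤ ((k : ℝ) : EReal)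
      exact_mod_cast k0
    · right; right
      simpa only [EReal.toReal_coe] using kz
  have mb : ((0, 0, ((k + w : ℝ) : EReal)) : Amb) ∈ MS := by
    refine ⟨?_, ?_, Or.inr ?_⟩
    · simp [C0]
    · have : (0 : ℝ) ≤ k + w := by linarith
      change (0 : EReal) ≤ ((k + w : ℝ) : EReal)
      exact_mod_cast this
    · right; right
      have : hh 0 ((k + w : ℝ) : EReal) = w := by
        unfold hh
        rw [EReal.toReal_coe, EReal.exp_zero]
        simp only [ENNReal.toReal_one, one_mul]
        exact hwk.symm
      simp only [this, EReal.toReal_coe, add_sub_cancel_right]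
      exact kz
  set a : MM := ⟨_, ma⟩ with hadef
  set b : MM := ⟨_, mb⟩ with hbdef
  obtain ⟨B, hBA, hBf, hB1, hB⟩ := h {a, b} (fun _ => Homeomorph.refl ℝ) a
    ⟨by simp, fun t => rfl, fun x _ => rfl, fun t => continuousOn_const⟩ (by
      intro t
      rw [image_pair, Metric.diam_pair]
      have hd : dist (fl t a) (fl t b) =
          dist (((k : ℝ) : EReal) + (t : EReal)) ((((k + w : ℝ)) : EReal) + (t : EReal)) := by
        rw [Subtype.dist_eq, fl_apply, fl_apply]
        simp [tr, hadef, hbdef, Prod.dist_eq]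
      refine lt_of_eq_of_lt hd ?_
      have := @hs w (by rw [Real.dist_eq, sub_zero, abs_of_pos hw]; exact hwη)
        (((k : ℝ) : EReal) + (t : EReal))
      convert this using 2
      rw [EReal.coe_add, add_right_comm])
  have hne : ∀ s : ℝ, fl s a ≠ b := by
    intro s hs
    have h1 := congrArg (fun x : MM => x.1.2.1) hs
    have h2 := congrArg (fun x : MM => x.1.2.2) hs
    simp only [fl_apply, tr, hadef, hbdef] at h1 h2
    rw [← EReal.coe_add, EReal.coe_eq_coe_iff] at h2
    have h1' : s = 0 := by
      rw [zero_add] at h1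
      exact_mod_cast h1
    linarith
  have hne' : ∀ s : ℝ, fl s b ≠ a := by
    intro s hs
    apply hne (-s)
    rw [← hs, ← Flow.map_add]
    simp
  obtain ⟨c, hc, s, -, hsc⟩ := hB a (by simp)
  obtain ⟨d, hd, s', -, hsd⟩ := hB b (by simp)
  have hcd : c = d := (ncard_le_one hBf).1 hB1 c hc d hd
  subst hcd
  rcases hBA hc with h | h
  · rw [h] at hsd; exact hne _ hsd
  · rw [h] at hsc; exact hne' _ hsc

lemma NExp_mono {M : Type*} [MetricSpace M] {φ : Flow ℝ M} {m n : ℕ} (h : m ≤ n)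
    (H : NExpansive φ m) : NExpansive φ n := by
  intro ε hε
  obtain ⟨δ, hδ, k⟩ := H ε hε
  refine ⟨δ, hδ, fun A α x h1 h2 => ?_⟩
  obtain ⟨B, b1, b2, b3, b4⟩ := k A α x h1 h2
  exact ⟨B, b1, b2, b3.trans h, b4⟩

end NExpEx

end

/-- For each integer `N ≥ 2` there exist a compact metric space and a flow on it which is
N-expansive but not expansive (i.e. not 1-expansive). -/
theorem exists_nExpansive_not_expansive (N : ℕ) (hN : 2 ≤ N) :
    ∃ (M : Type) (_ : MetricSpace M) (φ : Flow ℝ M),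
      CompactSpace M ∧ NExpansive φ N ∧ ¬ NExpansive φ 1 := by
  exact ⟨NExpEx.MM, inferInstance, NExpEx.fl, inferInstance,
    NExpEx.NExp_mono hN NExpEx.two_exp, NExpEx.not_one⟩
end
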